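/- Let R₂ be the orbit space of the action of S¹ × Sp(1) × Sp(1) on Sp(3) given by (z, q₁, q₂)·g = diag(z, z, z) · g · diag(q₁, 1, q₂)⁻¹, where S¹ ⊆ Sp(1) is the circle of unit complex numbers inside the unit quaternions, equipped with the quotient topology (this action is free, and R₂ is the biquotient ΔS¹\Sp(3)/Sp(1)²). Then π₂(R₂) is isomorphic to ℤ and π₄(R₂) is isomorphic to ℤ. -/

import Mathlib

open scoped Quaternion Topology

noncomputable section

/-- `Sp 3`, the group of `3 × 3` quaternionic matrices `g` with `g* g = 1`, topologized as a
subspace of the `3 × 3` quaternionic matrices. -/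
abbrev Sp3 : Type := ↥(unitary (Matrix (Fin 3) (Fin 3) ℍ[ℝ]))

/-- The orbit relation on `Sp 3` of the action of `S¹ × Sp(1) × Sp(1)` given by
`(z, q₁, q₂) · g = diag(z, z, z) · g · diag(q₁, 1, q₂)⁻¹`, where `S¹ ⊆ Sp(1)` consists of
the unit quaternions with vanishing `j` and `k` parts (the unit complex numbers):
`g ∼ g'` iff `g' = a g h⁻¹` with `a = diag(z, z, z)` and `h = diag(q₁, 1, q₂)`. -/
def RRel (g g' : Sp3) : Prop :=
  ∃ a h : Sp3,
    (∃ z : ℍ[ℝ], ‖z‖ = 1 ∧ z.imJ = 0 ∧ z.imK = 0 ∧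
      a.val = Matrix.diagonal ![z, z, z]) ∧
    (∃ q₁ q₂ : ℍ[ℝ], ‖q₁‖ = 1 ∧ ‖q₂‖ = 1 ∧
      h.val = Matrix.diagonal ![q₁, 1, q₂]) ∧
    g' = a * g * h⁻¹

/-- The biquotient `R₂ = ΔS¹\Sp(3)/Sp(1)²`, with the quotient topology. -/
abbrev R₂ : Type := Quot RRel

/-! ### Homotopy theory of pairs -/
namespace BQ
open scoped unitInterval Topology.Homotopy
open ContinuousMap

/-- Boundary of `I × K` given the boundary `A` of `K`. -/
def bd {K : Type} (A : Set K) : Set (I × K) := {p | p.1 = 0 ∨ p.1 = 1 ∨ p.2 ∈ A}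

/-- clamp to the unit interval -/
def cl (t : ℝ) : I := Set.projIcc 0 1 zero_le_one t

@[fun_prop] theorem continuous_cl : Continuous cl := by
  unfold cl; exact continuous_projIcc

theorem cl_of_le {t : ℝ} (h : t ≤ 0) : cl t = 0 := Set.projIcc_of_le_left _ h
theorem cl_of_ge {t : ℝ} (h : 1 ≤ t) : cl t = 1 := Set.projIcc_of_right_le _ h
theorem cl_coe (t : I) : cl (t : ℝ) = t := Set.projIcc_val _ t
theorem coe_cl {t : ℝ} (h0 : 0 ≤ t) (h1 : t ≤ 1) : (cl t : ℝ) = t := by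
  unfold cl; rw [Set.projIcc_of_mem _ ⟨h0, h1⟩]
@[simp] theorem cl_zero : cl 0 = 0 := cl_of_le le_rfl
@[simp] theorem cl_one : cl 1 = 1 := cl_of_ge le_rfl

section
variable {K Y : Type} [TopologicalSpace K] [TopologicalSpace Y]

theorem hrel_iff {f g : C(K, Y)} {S : Set K} : f.HomotopicRel g S ↔
    ∃ H : C(I × K, Y), (∀ k, H (0, k) = f k) ∧ (∀ k, H (1, k) = g k) ∧
      ∀ t, ∀ k ∈ S, H (t, k) = f k := by
  constructor
  · rintro ⟨H⟩
    exact ⟨H.toContinuousMap, fun k => H.apply_zero k, fun k => H.apply_one k,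
      fun t k hk => H.eq_fst t hk⟩
  · rintro ⟨H, h0, h1, h2⟩
    exact ⟨⟨⟨H, h0, h1⟩, fun t k hk => h2 t k hk⟩⟩

theorem hrel_comp {Z : Type} [TopologicalSpace Z] {f g : C(K, Y)} {S : Set K}
    (h : f.HomotopicRel g S) (φ : C(Y, Z)) : (φ.comp f).HomotopicRel (φ.comp g) S := by
  rw [hrel_iff] at *
  obtain ⟨H, h0, h1, h2⟩ := h
  exact ⟨φ.comp H, fun k => by simp [h0], fun k => by simp [h1], fun t k hk => by
    simp [h2 t k hk]⟩

theorem hrel_precomp {K' : Type} [TopologicalSpace K'] {f g : C(K, Y)} {S : Set K} {S' : Set K'}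
    (h : f.HomotopicRel g S) (φ : C(K', K)) (hφ : ∀ k ∈ S', φ k ∈ S) :
    (f.comp φ).HomotopicRel (g.comp φ) S' := by
  rw [hrel_iff] at *
  obtain ⟨H, h0, h1, h2⟩ := h
  exact ⟨H.comp ⟨fun p => (p.1, φ p.2), by fun_prop⟩, fun k => by simp [h0], fun k => by simp [h1],
    fun t k hk => by simp [h2 t _ (hφ k hk)]⟩

/-- All maps of pairs `(K, A) → (Y, y₀)` are trivial. -/
def Triv (K : Type) [TopologicalSpace K] (A : Set K) (Y : Type) [TopologicalSpace Y] (y : Y) :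
    Prop :=
  ∀ f : C(K, Y), (∀ a ∈ A, f a = y) → f.HomotopicRel (ContinuousMap.const K y) A

/-- A map with the homotopy lifting property for compact spaces, where stationary
paths are lifted to stationary paths. -/
def RegFib {E B : Type} [TopologicalSpace E] [TopologicalSpace B] (p : C(E, B)) : Prop :=
  ∀ (K : Type) [TopologicalSpace K] [CompactSpace K] (H : C(I × K, B)) (f : C(K, E)),
    (∀ k, p (f k) = H (0, k)) → ∃ H' : C(I × K, E), (∀ z, p (H' z) = H z) ∧
      (∀ k, H' (0, k) = f k) ∧ ∀ k, (∀ t, H (t, k) = H (0, k)) → ∀ t, H' (t, k) = f k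
end

/-! ### Transport gives the homotopy lifting property -/
section transport
variable {E B : Type} [TopologicalSpace E] [TopologicalSpace B]

theorem regFib_of_transport (p : C(E, B)) (V : Set (B × B)) (hV : IsOpen V)
    (hVd : ∀ b, (b, b) ∈ V) (s : E → B → E)
    (hs : ContinuousOn (fun x : E × B => s x.1 x.2) {x | (p x.1, x.2) ∈ V})
    (hps : ∀ e b, (p e, b) ∈ V → p (s e b) = b) (hse : ∀ e, s e (p e) = e) : RegFib p := by
  intro K _ _ H f hf
  -- uniform step
  obtain ⟨δ, hδ, hδV⟩ : ∃ δ : ℝ, 0 < δ ∧ ∀ (t t' : I) (k : K), |(t : ℝ) - t'| < δ →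
      (H (t, k), H (t', k)) ∈ V := by
    let C : Set (I × I × K) := {x | (H (x.1, x.2.2), H (x.2.1, x.2.2)) ∉ V}
    have hC : IsClosed C := by
      have : IsOpen {x : I × I × K | (H (x.1, x.2.2), H (x.2.1, x.2.2)) ∈ V} :=
        hV.preimage (by fun_prop)
      exact this.isClosed_compl
    rcases C.eq_empty_or_nonempty with h | h
    · refine ⟨1, one_pos, fun t t' k _ => ?_⟩
      by_contra hh
      have : (t, t', k) ∈ C := hh
      simp [h] at this
    · obtain ⟨x, hx, hmin⟩ := hC.isCompact.exists_isMinOn h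
        (f := fun x : I × I × K => |(x.1 : ℝ) - x.2.1|) (by fun_prop)
      refine ⟨|(x.1 : ℝ) - x.2.1|, ?_, fun t t' k hlt => ?_⟩
      · rw [abs_pos, sub_ne_zero]
        intro he
        have he' : x.1 = x.2.1 := Subtype.ext he
        apply hx
        rw [he']
        exact hVd _
      · by_contra hh
        have := hmin (show (t, t', k) ∈ C from hh)
        simp only [Set.mem_ofPred_eq] at this
        linarith
  obtain ⟨N, hN⟩ := exists_nat_one_div_lt hδ
  set N' : ℝ := N + 1 with hN'
  have hNpos : 0 < N' := by positivity
  let c : ℕ → I → I := fun j t => cl (min (t : ℝ) (j / N'))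
  have hc : ∀ j, Continuous (c j) := fun j => by dsimp only [c]; fun_prop
  have hcv : ∀ j t, (c j t : ℝ) = min (t : ℝ) (j / N') := fun j t =>
    coe_cl (le_min t.2.1 (by positivity)) ((min_le_left _ _).trans t.2.2)
  have key : ∀ j : ℕ, ∃ L : C(I × K, E), (∀ t k, p (L (t, k)) = H (c j t, k)) ∧
      (∀ k, L (0, k) = f k) ∧ ∀ k, (∀ t, H (t, k) = H (0, k)) → ∀ t, L (t, k) = f k := by
    intro j
    induction j with
    | zero =>
      refine ⟨f.comp ⟨Prod.snd, by fun_prop⟩, fun t k => ?_, fun k => rfl, fun k _ t => rfl⟩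
      have : c 0 t = 0 := by
        apply Subtype.ext
        rw [hcv]
        simp [t.2.1]
      simp [this, hf]
    | succ j ih =>
      obtain ⟨L, hL1, hL2, hL3⟩ := ih
      have hmem : ∀ t k, (p (L (t, k)), H (c (j+1) t, k)) ∈ V := by
        intro t k
        rw [hL1]
        apply hδV
        rw [hcv, hcv]
        refine lt_of_le_of_lt ?_ hN
        have : ((j + 1 : ℕ) : ℝ) / N' = j / N' + 1 / N' := by push_cast; ring
        rw [this, abs_le]
        have h1 : 0 < 1 / N' := by positivity
        constructor
        · have : min (t : ℝ) (j / N' + 1 / N') ≤ min (t : ℝ) (j / N') + 1 / N' := by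
            rcases le_total (t : ℝ) (j / N') with h | h
            · rw [min_eq_left h]; exact (min_le_left _ _).trans (by linarith)
            · rw [min_eq_right h]; exact min_le_right _ _
          linarith
        · have : min (t : ℝ) (j / N') ≤ min (t : ℝ) (j / N' + 1 / N') :=
            min_le_min le_rfl (by linarith)
          linarith
      refine ⟨⟨fun x => s (L x) (H (c (j+1) x.1, x.2)), ?_⟩, ?_, ?_, ?_⟩
      · have : Continuous fun x : I × K => (L x, H (c (j+1) x.1, x.2)) := by
          have := hc (j+1)
          fun_prop
        exact hs.comp_continuous this (fun x => hmem x.1 x.2)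
      · intro t k
        exact hps _ _ (hmem t k)
      · intro k
        have h0 : c (j+1) 0 = 0 := by
          apply Subtype.ext
          rw [hcv]
          simp only [Set.Icc.coe_zero]
          exact min_eq_left (by positivity)
        show s (L (0, k)) (H (c (j+1) 0, k)) = f k
        rw [h0, hL2, ← hf, hse]
      · intro k hk t
        show s (L (t, k)) (H (c (j+1) t, k)) = f k
        rw [hL3 k hk, hk, ← hf, hse]
  obtain ⟨L, hL1, hL2, hL3⟩ := key (N+1)
  refine ⟨L, fun z => ?_, hL2, hL3⟩
  have : c (N+1) z.1 = z.1 := by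
    apply Subtype.ext
    rw [hcv]
    have : ((N+1 : ℕ) : ℝ) / N' = 1 := by
      rw [hN']; push_cast; exact div_self (by positivity)
    rw [this]; exact min_eq_left z.1.2.2
  have h2 := hL1 z.1 z.2
  rw [this] at h2
  exact h2
end transport

/-! ### Exactness statements for regular fibrations -/
section fib
variable {E B : Type} [TopologicalSpace E] [TopologicalSpace B] {p : C(E, B)}
  {K : Type} [TopologicalSpace K] [CompactSpace K] {A : Set K}

/-- the fibre -/
abbrev Fib (p : C(E, B)) (b : B) : Type := {e : E // p e = b}

/-- inclusion of the fibre -/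
def incl (p : C(E, B)) (b : B) : C(Fib p b, E) := ⟨Subtype.val, continuous_subtype_val⟩

theorem push_to_fib (hp : RegFib p) (e0 : E) (g : C(K, E)) (hg : ∀ a ∈ A, g a = e0)
    (h : (p.comp g).HomotopicRel (ContinuousMap.const K (p e0)) A) :
    ∃ g' : C(K, Fib p (p e0)), (∀ a ∈ A, g' a = ⟨e0, rfl⟩) ∧
      g.HomotopicRel ((incl p (p e0)).comp g') A := by
  obtain ⟨H, h0, h1, h2⟩ := hrel_iff.1 h
  obtain ⟨H', hH1, hH2, hH3⟩ := hp K H g (fun k => (h0 k).symm)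
  have hA : ∀ a ∈ A, ∀ t, H' (t, a) = e0 := fun a ha t => by
    rw [hH3 a (fun t => by rw [h2 t a ha, h0]) t, hg a ha]
  refine ⟨⟨fun k => ⟨H' (1, k), by rw [hH1, h1]; rfl⟩, by fun_prop⟩, ?_, ?_⟩
  · intro a ha
    exact Subtype.ext (hA a ha 1)
  · rw [hrel_iff]
    exact ⟨H', hH2, fun k => rfl, fun t k hk => by rw [hA k hk, hg k hk]⟩

theorem triv_fib_inj (hp : RegFib p) (e0 : E) (hB : Triv (I × K) (bd A) B (p e0))
    (g : C(K, Fib p (p e0))) (hg : ∀ a ∈ A, g a = ⟨e0, rfl⟩)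
    (h : ((incl p (p e0)).comp g).HomotopicRel (ContinuousMap.const K e0) A) :
    g.HomotopicRel (ContinuousMap.const K ⟨e0, rfl⟩) A := by
  obtain ⟨H, h0, h1, h2⟩ := hrel_iff.1 h
  have hbd : ∀ a ∈ bd A, (p.comp H) a = p e0 := by
    rintro ⟨t, k⟩ (rfl | rfl | hk)
    · simp only [comp_apply, h0]; exact (g k).2
    · simp [h1]
    · simp only [comp_apply]
      rw [h2 t k hk]
      simp [hg k hk, incl]
  obtain ⟨J, j0, j1, j2⟩ := hrel_iff.1 (hB (p.comp H) hbd)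
  obtain ⟨J', k0, k1, k2⟩ := hp _ J H (fun k => (j0 k).symm)
  have hst : ∀ a ∈ bd A, J' (1, a) = H a := fun a ha =>
    k2 a (fun t => by rw [j2 t a ha, j0]) 1
  rw [hrel_iff]
  refine ⟨⟨fun x => ⟨J' (1, x), by rw [k0, j1]; rfl⟩, by fun_prop⟩, ?_, ?_, ?_⟩
  · intro k
    apply Subtype.ext
    show J' (1, (0, k)) = _
    rw [hst _ (Or.inl rfl), h0]; rfl
  · intro k
    apply Subtype.ext
    show J' (1, (1, k)) = _
    rw [hst _ (Or.inr (Or.inl rfl)), h1]; rfl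
  · intro t k hk
    apply Subtype.ext
    show J' (1, (t, k)) = _
    rw [hst _ (Or.inr (Or.inr hk)), h2 t k hk]; rfl

/-- `F` is a lift of `f` which is constant on all of the boundary except the top. -/
structure IsPL (p : C(E, B)) (e0 : E) (A : Set K) (f : C(I × K, B)) (F : C(I × K, E)) : Prop where
  lift : ∀ z, p (F z) = f z
  zero : ∀ k, F (0, k) = e0
  side : ∀ t, ∀ a ∈ A, F (t, a) = e0

/-- end of a partial lift -/
def IsPL.fin {e0 : E} {f : C(I × K, B)} {F : C(I × K, E)} (h : IsPL p e0 A f F)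
    (hf : ∀ a ∈ bd A, f a = p e0) : C(K, Fib p (p e0)) :=
  ⟨fun k => ⟨F (1, k), by rw [h.lift, hf _ (Or.inr (Or.inl rfl))]⟩, by fun_prop⟩

theorem exists_PL (hp : RegFib p) (e0 : E) (f : C(I × K, B)) (hf : ∀ a ∈ bd A, f a = p e0) :
    ∃ F, IsPL p e0 A f F := by
  obtain ⟨H', h0, h1, h2⟩ := hp K f (ContinuousMap.const K e0) (fun k => by
    rw [hf _ (Or.inl rfl)]; rfl)
  exact ⟨H', h0, h1, fun t a ha => h2 a (fun t => by
    rw [hf _ (Or.inr (Or.inr ha)), hf _ (Or.inr (Or.inr ha))]) t⟩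

theorem IsPL.homotopic (hp : RegFib p) {e0 : E} {f f' : C(I × K, B)} {F F' : C(I × K, E)}
    (h : IsPL p e0 A f F) (h' : IsPL p e0 A f' F') (hf : ∀ a ∈ bd A, f a = p e0)
    (hf' : ∀ a ∈ bd A, f' a = p e0) (hff : f.HomotopicRel f' (bd A)) :
    (h.fin hf).HomotopicRel (h'.fin hf') A := by
  obtain ⟨H, h0, h1, h2⟩ := hrel_iff.1 hff
  -- the concatenation of the reverse of `F` with `F'`
  let G : C(I × K, E) := ⟨fun x => if (x.1 : ℝ) ≤ 1/2 then F (cl (1 - 2 * x.1), x.2)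
    else F' (cl (2 * x.1 - 1), x.2), by
      refine Continuous.if_le (by fun_prop) (by fun_prop) (by fun_prop) (by fun_prop) ?_
      intro x hx
      rw [hx]
      norm_num [h.zero, h'.zero]⟩
  have hH : ∀ t, ∀ a ∈ bd A, H (t, a) = p e0 := fun t a ha => by rw [h2 t a ha, hf a ha]
  -- null homotopy of the projection
  let J : C(I × (I × K), B) := ⟨fun y => if (y.2.1 : ℝ) ≤ 1/2 then
      H (0, cl (1 - 2 * y.2.1) ⊔ cl (2 * y.1 - 1), y.2.2) else
      H (cl (1 - 2 * y.1), cl (2 * y.2.1 - 1) ⊔ cl (2 * y.1 - 1), y.2.2), by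
      refine Continuous.if_le (by fun_prop) (by fun_prop) (by fun_prop) (by fun_prop) ?_
      intro x hx
      rw [hx]
      rcases le_total (x.1 : ℝ) (1/2) with hle | hle
      · rw [cl_of_le (t := 2 * (x.1 : ℝ) - 1) (by linarith)]
        norm_num
        rw [hH _ _ (Or.inl rfl), hH _ _ (Or.inl rfl)]
      · rw [cl_of_le (t := 1 - 2 * (x.1 : ℝ)) (by linarith)]
        norm_num⟩
  have J0 : ∀ z, J (0, z) = p (G z) := by
    intro z
    show (if (z.1 : ℝ) ≤ 1/2 then _ else _) = p (if (z.1 : ℝ) ≤ 1/2 then _ else _)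
    rw [cl_of_le (t := 2 * ((0 : I) : ℝ) - 1) (by norm_num)]
    rw [cl_of_ge (t := 1 - 2 * ((0 : I) : ℝ)) (by norm_num)]
    split_ifs with hz
    · rw [h0, h.lift]; congr 2; exact sup_of_le_left (cl _).2.1
    · rw [h1, h'.lift]; congr 2; exact sup_of_le_left (cl _).2.1
  have J1 : ∀ z, J (1, z) = p e0 := by
    intro z
    show (if (z.1 : ℝ) ≤ 1/2 then _ else _) = _
    rw [cl_of_ge (t := 2 * ((1 : I) : ℝ) - 1) (by norm_num)]
    have e : ∀ u : I, u ⊔ 1 = 1 := fun u => sup_of_le_right u.2.2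
    split_ifs with hz
    · rw [e]; exact hH _ _ (Or.inr (Or.inl rfl))
    · rw [e]; exact hH _ _ (Or.inr (Or.inl rfl))
  have J2 : ∀ s, ∀ a ∈ bd A, J (s, a) = p e0 := by
    have e : ∀ u : I, 1 ⊔ u = 1 := fun u => sup_of_le_left u.2.2
    rintro s ⟨t, k⟩ ha
    show (if (t : ℝ) ≤ 1/2 then _ else _) = _
    rcases ha with ha | ha | ha
    · simp only at ha
      subst ha
      rw [if_pos (by norm_num), cl_of_ge (t := 1 - 2 * ((0 : I) : ℝ)) (by norm_num), e]
      exact hH _ _ (Or.inr (Or.inl rfl))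
    · simp only at ha
      subst ha
      rw [if_neg (by norm_num), cl_of_ge (t := 2 * ((1 : I) : ℝ) - 1) (by norm_num), e]
      exact hH _ _ (Or.inr (Or.inl rfl))
    · split_ifs <;> exact hH _ _ (Or.inr (Or.inr ha))
  obtain ⟨J', k0, k1, k2⟩ := hp _ J G (fun k => (J0 k).symm)
  have hst : ∀ a ∈ bd A, J' (1, a) = G a := fun a ha =>
    k2 a (fun t => by rw [J2 t a ha, J2 0 a ha]) 1
  rw [hrel_iff]
  refine ⟨⟨fun x => ⟨J' (1, x), by rw [k0, J1]⟩, by fun_prop⟩, ?_, ?_, ?_⟩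
  · intro k
    apply Subtype.ext
    show J' (1, (0, k)) = F (1, k)
    rw [hst _ (Or.inl rfl)]
    show (if ((0 : I) : ℝ) ≤ 1/2 then _ else _) = _
    rw [if_pos (by norm_num), cl_of_ge (t := 1 - 2 * ((0 : I) : ℝ)) (by norm_num)]
  · intro k
    apply Subtype.ext
    show J' (1, (1, k)) = F' (1, k)
    rw [hst _ (Or.inr (Or.inl rfl))]
    show (if ((1 : I) : ℝ) ≤ 1/2 then _ else _) = _
    rw [if_neg (by norm_num), cl_of_ge (t := 2 * ((1 : I) : ℝ) - 1) (by norm_num)]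
  · intro t k hk
    apply Subtype.ext
    show J' (1, (t, k)) = F (1, k)
    rw [hst _ (Or.inr (Or.inr hk)), h.side _ _ hk]
    show (if (t : ℝ) ≤ 1/2 then _ else _) = _
    split_ifs
    · exact h.side _ _ hk
    · exact h'.side _ _ hk

/-- If the end of a partial lift is null homotopic, then the map lifts up to homotopy. -/
theorem IsPL.lift_of_end {e0 : E} {f : C(I × K, B)} {F : C(I × K, E)}
    (h : IsPL p e0 A f F) (hf : ∀ a ∈ bd A, f a = p e0)
    (hn : (h.fin hf).HomotopicRel (ContinuousMap.const K ⟨e0, rfl⟩) A) :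
    ∃ g : C(I × K, E), (∀ a ∈ bd A, g a = e0) ∧ f.HomotopicRel (p.comp g) (bd A) := by
  obtain ⟨H, h0, h1, h2⟩ := hrel_iff.1 hn
  let G : C(I × K, E) := ⟨fun x => if (x.1 : ℝ) ≤ 1/2 then F (cl (2 * x.1), x.2)
    else (H (cl (2 * x.1 - 1), x.2)).1, by
      refine Continuous.if_le (by fun_prop) (by fun_prop) (by fun_prop) (by fun_prop) ?_
      intro x hx
      rw [hx]
      norm_num [h0]
      rfl⟩
  have hG : ∀ z, G z = if (z.1 : ℝ) ≤ 1/2 then F (cl (2 * z.1), z.2)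
    else (H (cl (2 * z.1 - 1), z.2)).1 := fun z => rfl
  refine ⟨G, ?_, ?_⟩
  · rintro ⟨t, k⟩ (ha | ha | ha)
    · simp only at ha
      subst ha
      rw [hG, if_pos (by norm_num)]
      norm_num [h.zero]
    · simp only at ha
      subst ha
      rw [hG, if_neg (by norm_num)]
      norm_num [h1]
    · rw [hG]
      split_ifs
      · exact h.side _ _ ha
      · rw [h2 _ _ ha]; exact h.side _ _ ha
  · rw [hrel_iff]
    refine ⟨⟨fun y => f (cl ((1 - y.1) * y.2.1 + y.1 * cl (2 * y.2.1)), y.2.2), by fun_prop⟩,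
      ?_, ?_, ?_⟩
    · intro z
      simp [cl_coe]
    · intro z
      simp only [coe_mk, comp_apply, hG]
      rw [show (1 - ((1 : I) : ℝ)) * z.1 + ((1 : I) : ℝ) * cl (2 * z.1) = cl (2 * z.1) by simp,
        cl_coe]
      split_ifs with hz
      · rw [h.lift]
      · rw [cl_of_ge (by linarith), hf _ (Or.inr (Or.inl rfl))]
        exact (H _).2.symm
    · rintro t ⟨u, k⟩ ha
      rw [hf _ ha]
      show f _ = _
      apply hf
      rcases ha with ha | ha | ha
      · simp only at ha
        subst ha
        left
        simp
      · simp only at ha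
        subst ha
        right; left
        have : cl (2 * ((1 : I) : ℝ)) = 1 := cl_of_ge (by norm_num)
        simp only [this]
        simp
      · exact Or.inr (Or.inr ha)

theorem lift_surj (hp : RegFib p) (e0 : E) (hF : Triv K A (Fib p (p e0)) ⟨e0, rfl⟩)
    (f : C(I × K, B)) (hf : ∀ a ∈ bd A, f a = p e0) :
    ∃ g : C(I × K, E), (∀ a ∈ bd A, g a = e0) ∧ f.HomotopicRel (p.comp g) (bd A) := by
  obtain ⟨F, h⟩ := exists_PL hp e0 f hf
  exact h.lift_of_end hf (hF _ fun a ha => Subtype.ext (h.side _ _ ha))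
end fib
end BQ

namespace BQ
open scoped unitInterval Topology.Homotopy
open ContinuousMap

/-! ### Groups of loops -/
section loops
variable {K K' K'' X Y Z : Type} [TopologicalSpace K] [TopologicalSpace K'] [TopologicalSpace K'']
  [TopologicalSpace X] [TopologicalSpace Y] [TopologicalSpace Z]
  {A : Set K} {A' : Set K'} {A'' : Set K''} {x : X} {y : Y} {z : Z}

/-- Loops, parametrized by the pair `(K, A)` -/
def LP (A : Set K) (y : Y) : Type := {f : C(I × K, Y) // ∀ a ∈ bd A, f a = y}

/-- homotopy of loops -/
def LP.Hom (f g : LP A y) : Prop := f.1.HomotopicRel g.1 (bd A)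

theorem LP.Hom.rfl' (f : LP A y) : f.Hom f := ContinuousMap.HomotopicRel.refl _
theorem LP.Hom.symm {f g : LP A y} (h : f.Hom g) : g.Hom f := ContinuousMap.HomotopicRel.symm h
theorem LP.Hom.trans {f g k : LP A y} (h : f.Hom g) (h' : g.Hom k) : f.Hom k :=
  ContinuousMap.HomotopicRel.trans h h'

/-- constant loop -/
def LP.one : LP A y := ⟨ContinuousMap.const _ y, fun _ _ => rfl⟩

/-- concatenation of functions -/
def catF (f g : I × K → Y) (p : I × K) : Y :=
  if (p.1 : ℝ) ≤ 1/2 then f (cl (2 * p.1), p.2) else g (cl (2 * p.1 - 1), p.2)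

/-- concatenation -/
def LP.cat (f g : LP A y) : LP A y := ⟨⟨catF f.1 g.1, by
    refine Continuous.if_le (by fun_prop) (by fun_prop) (by fun_prop) (by fun_prop) ?_
    intro p hp
    rw [hp]
    norm_num
    rw [f.2 _ (Or.inr (Or.inl rfl)), g.2 _ (Or.inl rfl)]⟩, by
    rintro ⟨t, k⟩ h
    show (if (t : ℝ) ≤ 1/2 then f.1 (cl (2 * t), k) else g.1 (cl (2 * t - 1), k)) = y
    rcases h with h | h | h
    · have ht : t = 0 := h
      subst ht
      simp only [Set.Icc.coe_zero]
      rw [if_pos (by norm_num)]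
      exact f.2 _ (Or.inl (by simp))
    · have ht : t = 1 := h
      subst ht
      simp only [Set.Icc.coe_one]
      rw [if_neg (by norm_num)]
      refine g.2 _ (Or.inr (Or.inl ?_))
      norm_num
    · split_ifs
      · exact f.2 _ (Or.inr (Or.inr h))
      · exact g.2 _ (Or.inr (Or.inr h))⟩

theorem LP.cat_apply (f g : LP A y) (p) : (f.cat g).1 p =
  if (p.1 : ℝ) ≤ 1/2 then f.1 (cl (2 * p.1), p.2) else g.1 (cl (2 * p.1 - 1), p.2) := rfl

/-- Isomorphism of loop groups -/
def GIso (A : Set K) (x : X) (A' : Set K') (y : Y) : Prop :=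
  ∃ φ : LP A x → LP A' y, (∀ f g, f.Hom g → (φ f).Hom (φ g)) ∧
    (∀ f g, (φ (f.cat g)).Hom ((φ f).cat (φ g))) ∧
    (∀ f, (φ f).Hom LP.one → f.Hom LP.one) ∧ ∀ g, ∃ f, (φ f).Hom g

theorem LP.Hom.cat {f f' g g' : LP A y} (h : f.Hom f') (h' : g.Hom g') :
    (f.cat g).Hom (f'.cat g') := by
  obtain ⟨H, h0, h1, h2⟩ := hrel_iff.1 h
  obtain ⟨H', h0', h1', h2'⟩ := hrel_iff.1 h'
  have a1 : ∀ s k, H (s, (1, k)) = y := fun s k => by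
    rw [h2 _ _ (Or.inr (Or.inl rfl)), f.2 _ (Or.inr (Or.inl rfl))]
  have a2 : ∀ s k, H' (s, (0, k)) = y := fun s k => by
    rw [h2' _ _ (Or.inl rfl), g.2 _ (Or.inl rfl)]
  refine hrel_iff.2 ⟨⟨fun q => if (q.2.1 : ℝ) ≤ 1/2 then H (q.1, (cl (2 * q.2.1), q.2.2)) else
    H' (q.1, (cl (2 * q.2.1 - 1), q.2.2)), ?_⟩, ?_, ?_, ?_⟩
  · refine Continuous.if_le (by fun_prop) (by fun_prop) (by fun_prop) (by fun_prop) ?_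
    intro p hp
    rw [hp]
    norm_num
    rw [a1, a2]
  · intro k
    simp [h0, h0', LP.cat_apply]
  · intro k
    simp [h1, h1', LP.cat_apply]
  · rintro t ⟨s, k⟩ hk
    rw [(f.cat g).2 _ hk]
    show (if (s : ℝ) ≤ 1/2 then H (t, (cl (2 * s), k)) else H' (t, (cl (2 * s - 1), k))) = y
    have b1 : ∀ s k, (s, k) ∈ bd A → H (t, (s, k)) = y := fun s k h => by rw [h2 _ _ h, f.2 _ h]
    have b2 : ∀ s k, (s, k) ∈ bd A → H' (t, (s, k)) = y := fun s k h => by rw [h2' _ _ h, g.2 _ h]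
    rcases hk with h | h | h
    · have ht : s = 0 := h
      subst ht
      simp only [Set.Icc.coe_zero]
      rw [if_pos (by norm_num)]
      exact b1 _ _ (Or.inl (by simp))
    · have ht : s = 1 := h
      subst ht
      simp only [Set.Icc.coe_one]
      rw [if_neg (by norm_num)]
      refine b2 _ _ (Or.inr (Or.inl ?_))
      norm_num
    · split_ifs
      · exact b1 _ _ (Or.inr (Or.inr h))
      · exact b2 _ _ (Or.inr (Or.inr h))

theorem GIso.trans (h : GIso A x A' y) (h' : GIso A' y A'' z) : GIso A x A'' z := by
  obtain ⟨φ, h1, h2, h3, h4⟩ := h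
  obtain ⟨ψ, g1, g2, g3, g4⟩ := h'
  refine ⟨ψ ∘ φ, fun f g hh => g1 _ _ (h1 _ _ hh), fun f g => (g1 _ _ (h2 f g)).trans (g2 _ _),
    fun f hh => h3 _ (g3 _ hh), fun g => ?_⟩
  obtain ⟨f, hf⟩ := g4 g
  obtain ⟨f', hf'⟩ := h4 f
  exact ⟨f', (g1 _ _ hf').trans hf⟩

/-- precomposition with a map of parameter spaces -/
def LP.pre (f : LP A y) (φ : C(I × K', I × K)) (hφ : ∀ k ∈ bd A', φ k ∈ bd A) : LP A' y :=
  ⟨f.1.comp φ, fun a ha => f.2 _ (hφ a ha)⟩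

/-- postcomposition -/
def LP.map (φ : C(X, Y)) (hφ : φ x = y) (f : LP A x) : LP A y :=
  ⟨φ.comp f.1, fun a ha => by simp [f.2 a ha, hφ]⟩

theorem LP.map_cat (φ : C(X, Y)) (hφ : φ x = y) (f g : LP A x) :
    (f.cat g).map φ hφ = (f.map φ hφ).cat (g.map φ hφ) := by
  refine Subtype.ext (ContinuousMap.ext fun p => ?_)
  rw [LP.cat_apply]
  simp only [LP.map, LP.cat_apply, ContinuousMap.comp_apply, apply_ite φ]

theorem LP.Hom.map (φ : C(X, Y)) (hφ : φ x = y) {f g : LP A x} (h : f.Hom g) :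
    (f.map φ hφ).Hom (g.map φ hφ) := hrel_comp h φ

theorem LP.map_one (φ : C(X, Y)) (hφ : φ x = y) : (LP.one : LP A x).map φ hφ = LP.one :=
  Subtype.ext (ContinuousMap.ext fun _ => hφ)

theorem gIso_map (φ : C(X, Y)) (hφ : φ x = y)
    (h1 : ∀ f : LP A x, (f.map φ hφ).Hom LP.one → f.Hom LP.one)
    (h2 : ∀ g : LP A y, ∃ f : LP A x, (f.map φ hφ).Hom g) : GIso A x A y :=
  ⟨LP.map φ hφ, fun _ _ h => h.map φ hφ, fun f g => by rw [LP.map_cat]; exact LP.Hom.rfl' _, h1, h2⟩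

/-- change of the parameter space by a homeomorphism -/
theorem gIso_homeo (e : K ≃ₜ K') (he : ∀ k, e k ∈ A' ↔ k ∈ A) : GIso A x A' x := by
  have hs : ∀ k, e.symm k ∈ A ↔ k ∈ A' := fun k => by rw [← he, e.apply_symm_apply]
  let u : C(I × K', I × K) := ⟨fun p => (p.1, e.symm p.2), by fun_prop⟩
  let v : C(I × K, I × K') := ⟨fun p => (p.1, e p.2), by fun_prop⟩
  have hu : ∀ k ∈ bd A', u k ∈ bd A := by
    rintro ⟨t, k⟩ (h | h | h)
    exacts [Or.inl h, Or.inr (Or.inl h), Or.inr (Or.inr ((hs _).2 h))]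
  have hv : ∀ k ∈ bd A, v k ∈ bd A' := by
    rintro ⟨t, k⟩ (h | h | h)
    exacts [Or.inl h, Or.inr (Or.inl h), Or.inr (Or.inr ((he _).2 h))]
  have huv : ∀ k, u (v k) = k := fun k => by simp [u, v]
  have hvu : ∀ k, v (u k) = k := fun k => by simp [u, v]
  refine ⟨fun f => f.pre u hu, fun f g h => hrel_precomp h u hu, fun f g => LP.Hom.rfl' _, ?_, ?_⟩
  · intro f h
    have := hrel_precomp h v hv
    have e : (f.pre u hu).1.comp v = f.1 := ContinuousMap.ext fun k => by simp [LP.pre, huv]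
    rw [e] at this
    exact this
  · intro g
    refine ⟨g.pre v hv, ?_⟩
    convert LP.Hom.rfl' g using 1
    exact Subtype.ext (ContinuousMap.ext fun k => by simp [LP.pre, hvu])

/-- swap of the first two coordinates -/
def swp : C(I × (I × K), I × (I × K)) := ⟨fun p => (p.2.1, (p.1, p.2.2)), by fun_prop⟩

theorem swp_bd : ∀ k ∈ bd (bd A), swp k ∈ bd (bd A) := by
  rintro ⟨t, s, k⟩ (h | h | h | h | h)
  exacts [Or.inr (Or.inr (Or.inl h)), Or.inr (Or.inr (Or.inr (Or.inl h))), Or.inl h,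
    Or.inr (Or.inl h), Or.inr (Or.inr (Or.inr (Or.inr h)))]

theorem triv_homeo (e : K ≃ₜ K') (he : ∀ k, e k ∈ A' ↔ k ∈ A) : Triv K A Y y ↔ Triv K' A' Y y := by
  have hs : ∀ k, e.symm k ∈ A ↔ k ∈ A' := fun k => by rw [← he, e.apply_symm_apply]
  constructor
  · intro h f hf
    have := hrel_precomp (S' := A') (h (f.comp e) (fun a ha => hf _ ((he a).2 ha)))
      (e.symm : C(K', K)) (fun k hk => (hs k).2 hk)
    convert this using 1
    · exact ContinuousMap.ext fun k => by simp
    · rfl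
  · intro h f hf
    have := hrel_precomp (S' := A) (h (f.comp e.symm) (fun a ha => hf _ ((hs a).2 ha)))
      (e : C(K, K')) (fun k hk => (he k).2 hk)
    convert this using 1
    · exact ContinuousMap.ext fun k => by simp
    · rfl
end loops

/-! ### Comparison with Mathlib's homotopy groups -/
section cube
variable {X Y : Type} [TopologicalSpace X] [TopologicalSpace Y] {x : X} {y : Y}

/-- boundary of the cube -/
abbrev cb (n : ℕ) : Set (Fin n → I) := Cube.boundary (Fin n)

/-- splitting off the first coordinate -/
def consH (n : ℕ) : (I × (Fin n → I)) ≃ₜ (Fin (n+1) → I) where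
  toFun p := Fin.cons p.1 p.2
  invFun f := (f 0, fun i => f i.succ)
  left_inv p := by simp
  right_inv f := by
    refine funext (Fin.cases ?_ ?_) <;> simp
  continuous_toFun := Continuous.finCons (by fun_prop) (by fun_prop)
  continuous_invFun := by fun_prop

theorem consH_bd (n : ℕ) (k) : consH n k ∈ cb (n+1) ↔ k ∈ bd (cb n) := by
  obtain ⟨t, k⟩ := k
  simp only [Cube.boundary, consH, Homeomorph.homeomorph_mk_coe, Equiv.coe_fn_mk,
    Set.mem_ofPred_eq, Fin.exists_fin_succ, Fin.cons_zero, Fin.cons_succ, bd, or_assoc]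

/-- `π_n` is trivial -/
def TrivN (n : ℕ) (Y : Type) [TopologicalSpace Y] (y : Y) : Prop := Triv (Fin n → I) (cb n) Y y

theorem trivN_succ (n : ℕ) : TrivN (n+1) Y y ↔ Triv (I × (Fin n → I)) (bd (cb n)) Y y :=
  (triv_homeo (consH n) (consH_bd n)).symm

theorem bd_bd_consH (n : ℕ) (k : I × (I × (Fin n → I))) :
    ((k.1, consH n k.2) : I × (Fin (n+1) → I)) ∈ bd (cb (n+1)) ↔ k ∈ bd (bd (cb n)) := by
  obtain ⟨t, k⟩ := k
  have := consH_bd n k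
  simp only [bd, Set.mem_ofPred_eq] at this ⊢
  rw [this]

theorem trivN_succ2 (n : ℕ) : TrivN (n+2) Y y ↔ Triv (I × (I × (Fin n → I))) (bd (bd (cb n))) Y y := by
  rw [trivN_succ]
  exact (triv_homeo ((Homeomorph.refl I).prodCongr (consH n)) (bd_bd_consH n)).symm

/-- loops to generalized loops -/
def toG {n : ℕ} (f : LP (cb n) x) : GenLoop (Fin (n+1)) X x :=
  ⟨f.1.comp (consH n).symm, fun k hk => f.2 _ (by
    rw [← consH_bd]; exact ((consH n).apply_symm_apply k).symm ▸ hk)⟩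

/-- generalized loops to loops -/
def ofG {n : ℕ} (f : GenLoop (Fin (n+1)) X x) : LP (cb n) x :=
  ⟨f.1.comp (consH n), fun k hk => f.2 _ ((consH_bd n k).2 hk)⟩

theorem toG_ofG {n : ℕ} (f : GenLoop (Fin (n+1)) X x) : toG (ofG f) = f :=
  Subtype.ext (ContinuousMap.ext fun k => by simp [toG, ofG])
theorem ofG_toG {n : ℕ} (f : LP (cb n) x) : ofG (toG f) = f :=
  Subtype.ext (ContinuousMap.ext fun k => by simp [toG, ofG])

theorem toG_hom {n : ℕ} {f g : LP (cb n) x} (h : f.Hom g) : GenLoop.Homotopic (toG f) (toG g) :=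
  hrel_precomp h _ fun k hk => by
    rw [← consH_bd]; exact ((consH n).apply_symm_apply k).symm ▸ hk

theorem ofG_hom {n : ℕ} {f g : GenLoop (Fin (n+1)) X x} (h : GenLoop.Homotopic f g) :
    (ofG f).Hom (ofG g) :=
  hrel_precomp h _ fun k hk => (consH_bd n k).2 hk

theorem ofG_trans {n : ℕ} (f g : GenLoop (Fin (n+1)) X x) :
    ofG (GenLoop.transAt 0 f g) = (ofG f).cat (ofG g) := by
  refine Subtype.ext (ContinuousMap.ext fun ⟨t, k⟩ => ?_)
  rw [LP.cat_apply]
  show (GenLoop.transAt 0 f g) (Fin.cons t k) = if (t : ℝ) ≤ 1/2 then f (Fin.cons (cl (2 * t)) k)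
    else g (Fin.cons (cl (2 * t - 1)) k)
  rw [GenLoop.transAt, GenLoop.coe_copy]
  simp only [Fin.cons_zero, Fin.update_cons_zero]
  rfl

theorem mkIso {n m : ℕ} (h : GIso (cb n) x (cb m) y) :
    Nonempty ((π_ (n+1)) X x ≃* (π_ (m+1)) Y y) := by
  obtain ⟨φ, h1, h2, h3, h4⟩ := h
  let ψ : (π_ (n+1)) X x → (π_ (m+1)) Y y := Quotient.map (fun f => toG (φ (ofG f)))
    (fun f g hfg => toG_hom (h1 _ _ (ofG_hom hfg)))
  have hm : ∀ a b, ψ (a * b) = ψ a * ψ b := by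
    rintro ⟨a⟩ ⟨b⟩
    have e1 := HomotopyGroup.mul_spec (i := 0) (p := a) (q := b)
    have e2 := HomotopyGroup.mul_spec (i := 0) (p := toG (φ (ofG a))) (q := toG (φ (ofG b)))
    refine (congrArg ψ e1).trans (Eq.trans ?_ e2.symm)
    refine Quotient.sound ?_
    show GenLoop.Homotopic _ _
    have := h2 (ofG b) (ofG a)
    rw [← ofG_trans] at this
    refine (toG_hom this).trans ?_
    rw [← toG_ofG (GenLoop.transAt _ _ _), ofG_trans, ofG_toG, ofG_toG]
  have hone : ∀ f, GenLoop.Homotopic (toG (φ (ofG f))) GenLoop.const →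
      GenLoop.Homotopic f GenLoop.const := fun f hf => by
    have := toG_hom (h3 (ofG f) (by
      have := ofG_hom hf
      rw [ofG_toG] at this
      exact this))
    rw [toG_ofG] at this
    exact this
  let Ψ : (π_ (n+1)) X x →* (π_ (m+1)) Y y := MonoidHom.mk' ψ hm
  refine ⟨MulEquiv.ofBijective Ψ ⟨?_, ?_⟩⟩
  · rw [injective_iff_map_eq_one]
    rintro ⟨a⟩ ha
    exact Quotient.sound (hone a (Quotient.exact ha))
  · rintro ⟨b⟩
    obtain ⟨f, hf⟩ := h4 (ofG b)
    refine ⟨⟦toG f⟧, Quotient.sound ?_⟩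
    show GenLoop.Homotopic (toG (φ (ofG (toG f)))) b
    rw [ofG_toG]
    have := toG_hom hf
    rwa [toG_ofG] at this

theorem mkIsoInt {n : ℕ} (d : LP (cb n) x → ℤ) (h1 : ∀ f g, f.Hom g → d f = d g)
    (h2 : ∀ f g, d (f.cat g) = d f + d g) (h3 : ∀ f, d f = 0 → f.Hom LP.one)
    (h4 : ∀ m, ∃ f, d f = m) : Nonempty ((π_ (n+1)) X x ≃* Multiplicative ℤ) := by
  let ψ : (π_ (n+1)) X x → Multiplicative ℤ := Quotient.lift
    (fun f => Multiplicative.ofAdd (d (ofG f))) (fun f g hfg => by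
      rw [h1 _ _ (ofG_hom hfg)])
  have hm : ∀ a b, ψ (a * b) = ψ a * ψ b := by
    rintro ⟨a⟩ ⟨b⟩
    have e1 := HomotopyGroup.mul_spec (i := 0) (p := a) (q := b)
    refine (congrArg ψ e1).trans ?_
    show Multiplicative.ofAdd (d (ofG _)) = Multiplicative.ofAdd (d (ofG _)) *
      Multiplicative.ofAdd (d (ofG _))
    rw [ofG_trans, h2, ← ofAdd_add, add_comm]
  let Ψ : (π_ (n+1)) X x →* Multiplicative ℤ := MonoidHom.mk' ψ hm
  refine ⟨MulEquiv.ofBijective Ψ ⟨?_, ?_⟩⟩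
  · rw [injective_iff_map_eq_one]
    rintro ⟨a⟩ ha
    refine Quotient.sound ?_
    have := toG_hom (h3 (ofG a) ha)
    rw [toG_ofG] at this
    exact this
  · intro b
    obtain ⟨f, hf⟩ := h4 (Multiplicative.toAdd b)
    refine ⟨⟦toG f⟧, ?_⟩
    show Multiplicative.ofAdd (d (ofG (toG f))) = b
    rw [ofG_toG, hf]
    rfl
end cube
end BQ

namespace BQ
open scoped unitInterval Topology.Homotopy
open ContinuousMap

/-! ### Isomorphisms from fibrations -/
section fibiso
variable {E B K : Type} [TopologicalSpace E] [TopologicalSpace B] [TopologicalSpace K]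
  [CompactSpace K] {A : Set K} {p : C(E, B)}

theorem triv_base (hp : RegFib p) (e0 : E) (hF : Triv K A (Fib p (p e0)) ⟨e0, rfl⟩)
    (hE : Triv (I × K) (bd A) E e0) : Triv (I × K) (bd A) B (p e0) := by
  intro f hf
  obtain ⟨g, hg, hfg⟩ := lift_surj hp e0 hF f hf
  exact hfg.trans (hrel_comp (hE g hg) p)

theorem gIso_proj (hp : RegFib p) (e0 : E) (hF : Triv K A (Fib p (p e0)) ⟨e0, rfl⟩)
    (hF1 : Triv (I × K) (bd A) (Fib p (p e0)) ⟨e0, rfl⟩) : GIso A e0 A (p e0) := by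
  refine gIso_map p rfl ?_ ?_
  · intro f hf
    obtain ⟨g', h1, h2⟩ := push_to_fib hp e0 f.1 f.2 hf
    exact h2.trans (hrel_comp (hF1 g' h1) (incl p (p e0)))
  · intro g
    obtain ⟨g', h1, h2⟩ := lift_surj hp e0 hF g.1 g.2
    exact ⟨⟨g', h1⟩, h2.symm⟩

theorem gIso_incl (hp : RegFib p) (e0 : E) (hB : Triv (I × K) (bd A) B (p e0))
    (hB1 : Triv (I × (I × K)) (bd (bd A)) B (p e0)) :
    GIso A (⟨e0, rfl⟩ : Fib p (p e0)) A e0 := by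
  refine gIso_map (incl p (p e0)) rfl ?_ ?_
  · intro f hf
    exact triv_fib_inj hp e0 hB1 f.1 f.2 hf
  · intro g
    obtain ⟨g', h1, h2⟩ := push_to_fib hp e0 g.1 g.2 (hB _ fun a ha => congrArg p (g.2 a ha))
    exact ⟨⟨g', h1⟩, h2.symm⟩

theorem gIso_bdry (hp : RegFib p) (e0 : E) (hE : Triv (I × K) (bd A) E e0)
    (hE1 : Triv (I × (I × K)) (bd (bd A)) E e0) :
    GIso (bd A) (p e0) A (⟨e0, rfl⟩ : Fib p (p e0)) := by
  have hpl : ∀ f : LP (bd A) (p e0), ∃ F, IsPL p e0 (bd A) (f.1.comp swp) F := fun f =>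
    exists_PL hp e0 _ (fun a ha => f.2 _ (swp_bd a ha))
  have hb : ∀ f : LP (bd A) (p e0), ∀ a ∈ bd (bd A), (f.1.comp swp) a = p e0 :=
    fun f a ha => f.2 _ (swp_bd a ha)
  choose F hF using hpl
  refine ⟨fun f => ⟨(hF f).fin (hb f), fun a ha => Subtype.ext ((hF f).side _ _ ha)⟩, ?_, ?_, ?_, ?_⟩
  · intro f g h
    exact (hF f).homotopic hp (hF g) (hb f) (hb g) (hrel_precomp h swp swp_bd)
  · intro f g
    let G : C(I × (I × K), E) := ⟨fun q => if (q.2.1 : ℝ) ≤ 1/2 then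
      F f (q.1, (cl (2 * q.2.1), q.2.2)) else F g (q.1, (cl (2 * q.2.1 - 1), q.2.2)), by
      refine Continuous.if_le (by fun_prop) (by fun_prop) (by fun_prop) (by fun_prop) ?_
      intro q hq
      rw [hq]
      norm_num
      rw [(hF f).side _ _ (Or.inr (Or.inl rfl)), (hF g).side _ _ (Or.inl rfl)]⟩
    have hG : ∀ q, G q = if (q.2.1 : ℝ) ≤ 1/2 then
      F f (q.1, (cl (2 * q.2.1), q.2.2)) else F g (q.1, (cl (2 * q.2.1 - 1), q.2.2)) := fun _ => rfl
    have hPL : IsPL p e0 (bd A) ((f.cat g).1.comp swp) G := by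
      refine ⟨fun z => ?_, fun k => ?_, fun t a ha => ?_⟩
      · rw [hG, apply_ite p, (hF f).lift, (hF g).lift]
        rfl
      · rw [hG, (hF f).zero, (hF g).zero, ite_self]
      · obtain ⟨s, k⟩ := a
        rw [hG]
        dsimp only
        rcases ha with h | h | h
        · have ht : s = 0 := h
          subst ht
          simp only [Set.Icc.coe_zero]
          rw [if_pos (by norm_num)]
          exact (hF f).side _ _ (Or.inl (by simp))
        · have ht : s = 1 := h
          subst ht
          simp only [Set.Icc.coe_one]
          rw [if_neg (by norm_num)]
          refine (hF g).side _ _ (Or.inr (Or.inl ?_))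
          norm_num
        · split_ifs
          · exact (hF f).side _ _ (Or.inr (Or.inr h))
          · exact (hF g).side _ _ (Or.inr (Or.inr h))
    have := (hF (f.cat g)).homotopic hp hPL (hb _) (hb _) (HomotopicRel.refl _)
    refine this.trans ?_
    refine (HomotopicRel.refl _).trans (Eq.rec (motive := fun x _ => HomotopicRel _ x _)
      (HomotopicRel.refl _) (?_ : hPL.fin (hb _) = _))
    refine ContinuousMap.ext fun k => Subtype.ext ?_
    show G (1, k) = Subtype.val (if (k.1 : ℝ) ≤ 1/2 then (hF f).fin (hb f) (cl (2 * k.1), k.2) else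
      (hF g).fin (hb g) (cl (2 * k.1 - 1), k.2))
    rw [hG, apply_ite Subtype.val]
    rfl
  · intro f h
    obtain ⟨g, h1, h2⟩ := (hF f).lift_of_end (hb f) h
    have h3 := h2.trans (hrel_comp (hE1 g h1) p)
    exact hrel_precomp h3 swp swp_bd
  · intro g
    obtain ⟨H, h0, h1, h2⟩ := hrel_iff.1 (hE ((incl p (p e0)).comp g.1) (fun a ha => by
      rw [ContinuousMap.comp_apply, g.2 a ha]; rfl)).symm
    have hPL : IsPL p e0 (bd A) (p.comp H) H := ⟨fun z => rfl, fun k => by rw [h0]; rfl,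
      fun t a ha => by rw [h2 t a ha]; rfl⟩
    have hbH : ∀ a ∈ bd (bd A), (p.comp H) a = p e0 := by
      rintro ⟨t, k⟩ (h | h | h)
      · have : t = 0 := h
        subst this
        rw [ContinuousMap.comp_apply, h0]; rfl
      · have : t = 1 := h
        subst this
        rw [ContinuousMap.comp_apply, h1]; exact (g.1 k).2
      · rw [ContinuousMap.comp_apply, h2 t k h]; rfl
    let f : LP (bd A) (p e0) := ⟨(p.comp H).comp swp, fun a ha => hbH _ (swp_bd a ha)⟩
    refine ⟨f, ?_⟩
    have := (hF f).homotopic hp hPL (hb f) hbH (HomotopicRel.refl _)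
    refine this.trans ?_
    have e : hPL.fin hbH = g.1 := ContinuousMap.ext fun k => Subtype.ext (h1 k)
    rw [e]; exact HomotopicRel.refl _
end fibiso

section hequiv
variable {X Y K : Type} [TopologicalSpace X] [TopologicalSpace Y] [TopologicalSpace K] {A : Set K}
  {x : X} {y : Y}

theorem hrel_of_point {f : C(X, X)} (h : (ContinuousMap.id X).HomotopicRel f {x}) (g : C(K, X))
    (hg : ∀ a ∈ A, g a = x) : g.HomotopicRel (f.comp g) A := by
  obtain ⟨H, h0, h1, h2⟩ := hrel_iff.1 h
  exact hrel_iff.2 ⟨H.comp ⟨fun q => (q.1, g q.2), by fun_prop⟩, fun k => by simp [h0],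
    fun k => by simp [h1], fun t k hk => by
      simp only [ContinuousMap.comp_apply, ContinuousMap.coe_mk]
      rw [h2 t _ (hg k hk)]; rfl⟩

theorem triv_retract (φ : C(X, Y)) (ψ : C(Y, X)) (hφ : φ x = y) (hψ : ψ y = x)
    (h : (ContinuousMap.id X).HomotopicRel (ψ.comp φ) {x}) (hY : Triv K A Y y) :
    Triv K A X x := by
  intro f hf
  refine (hrel_of_point h f hf).trans ?_
  have := hrel_comp (hY (φ.comp f) (fun a ha => by rw [ContinuousMap.comp_apply, hf a ha, hφ])) ψ
  have e : ψ.comp (ContinuousMap.const K y) = ContinuousMap.const K x :=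
    ContinuousMap.ext fun _ => hψ
  rw [e] at this
  exact this

theorem gIso_hequiv (φ : C(X, Y)) (ψ : C(Y, X)) (hφ : φ x = y) (hψ : ψ y = x)
    (h : (ContinuousMap.id X).HomotopicRel (ψ.comp φ) {x})
    (h' : (ContinuousMap.id Y).HomotopicRel (φ.comp ψ) {y}) : GIso A x A y := by
  refine gIso_map φ hφ ?_ ?_
  · intro f hf
    refine (hrel_of_point h f.1 f.2).trans ?_
    have := hf.map ψ hψ
    rw [LP.map_one] at this
    exact this
  · intro g
    exact ⟨g.map ψ hψ, (hrel_of_point h' g.1 g.2).symm⟩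

theorem gIso_hom (e : X ≃ₜ Y) (he : e x = y) : GIso A x A y := by
  refine gIso_hequiv (e : C(X, Y)) (e.symm : C(Y, X)) he (by simp [← he]) ?_ ?_
  · have : ((e.symm : C(Y, X)).comp (e : C(X, Y))) = ContinuousMap.id X :=
      ContinuousMap.ext fun _ => by simp
    rw [this]; exact HomotopicRel.refl _
  · have : ((e : C(X, Y)).comp (e.symm : C(Y, X))) = ContinuousMap.id Y :=
      ContinuousMap.ext fun _ => by simp
    rw [this]; exact HomotopicRel.refl _

theorem triv_hom (e : X ≃ₜ Y) (he : e x = y) (hY : Triv K A Y y) : Triv K A X x := by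
  refine triv_retract (e : C(X, Y)) (e.symm : C(Y, X)) he (by simp [← he]) ?_ hY
  have : ((e.symm : C(Y, X)).comp (e : C(X, Y))) = ContinuousMap.id X :=
      ContinuousMap.ext fun _ => by simp
  rw [this]; exact HomotopicRel.refl _
end hequiv
end BQ

namespace BQ
open scoped unitInterval Topology.Homotopy
open ContinuousMap

/-! ### The circle -/
section circle
theorem triv_real {K : Type} [TopologicalSpace K] (A : Set K) (y : ℝ) : Triv K A ℝ y := by
  intro f hf
  refine hrel_iff.2 ⟨⟨fun q => f q.2 + q.1 * (y - f q.2), by fun_prop⟩, fun k => by simp,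
    fun k => by simp, fun t k hk => by simp [hf k hk]⟩

/-- the exponential map -/
def cexp : C(ℝ, Circle) := Circle.exp

theorem regFib_exp : RegFib cexp := by
  refine regFib_of_transport cexp {q | ((q.2 / q.1 : Circle) : ℂ) ∈ Complex.slitPlane} ?_ ?_
    (fun r z => r + Complex.arg ((z / cexp r : Circle) : ℂ)) ?_ ?_ ?_
  · exact Complex.isOpen_slitPlane.preimage
      (Continuous.comp (g := fun z : Circle => (z : ℂ)) continuous_subtype_val (continuous_snd.div' continuous_fst))
  · intro b
    simp
  · intro x hx
    refine ContinuousAt.continuousWithinAt ?_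
    refine ContinuousAt.add (by fun_prop) ?_
    exact ContinuousAt.comp (g := Complex.arg) (f := fun x : ℝ × Circle => ((x.2 / cexp x.1 : Circle) : ℂ))
      (Complex.continuousAt_arg hx)
      (Continuous.comp (g := fun z : Circle => (z : ℂ)) continuous_subtype_val (Continuous.div' (f := fun x : ℝ × Circle => x.2)
        (g := fun x : ℝ × Circle => cexp x.1) (by fun_prop) (by fun_prop))).continuousAt
  · intro e b _
    show Circle.exp _ = b
    rw [Circle.exp_add, Circle.exp_arg]
    exact mul_div_cancel _ _
  · intro e
    simp

theorem int_const {K : Type} [TopologicalSpace K] [PreconnectedSpace K] (g : C(K, ℝ))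
    (h : ∀ t, ∃ n : ℤ, g t = n * (2 * Real.pi)) (a b : K) : g a = g b := by
  choose n hn using h
  have hc : Continuous n := by
    rw [Int.isClosedEmbedding_coe_real.isInducing.continuous_iff]
    have : ((↑) : ℤ → ℝ) ∘ n = fun t => g t / (2 * Real.pi) := by
      funext t
      rw [hn]
      have := Real.pi_pos
      simp only [Function.comp]
      field_simp
    rw [this]
    fun_prop
  have := PreconnectedSpace.constant (inferInstance) hc (x := a) (y := b)
  rw [hn, hn, this]

theorem fib_int (r : Fib cexp (cexp 0)) : ∃ n : ℤ, r.1 = n * (2 * Real.pi) := by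
  have h := r.2
  simp only [cexp, Circle.exp_zero] at h
  obtain ⟨n, hn⟩ := Circle.exp_eq_one.1 h
  exact ⟨n, hn⟩

theorem triv_fib_exp (n : ℕ) : TrivN (n+1) (Fib cexp (cexp 0)) ⟨0, rfl⟩ := by
  intro f hf
  have : f = ContinuousMap.const _ ⟨0, rfl⟩ := by
    refine ContinuousMap.ext fun k => Subtype.ext ?_
    have h0 := hf (fun _ => 0) ⟨0, Or.inl rfl⟩
    have := int_const ((incl _ _).comp f) (fun t => fib_int (f t)) k (fun _ => 0)
    simp only [incl, ContinuousMap.comp_apply, ContinuousMap.coe_mk, h0] at this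
    exact this
  rw [this]
  exact HomotopicRel.refl _

theorem triv_circle (n : ℕ) : TrivN (n+2) Circle 1 := by
  rw [trivN_succ]
  have := triv_base regFib_exp 0 (triv_fib_exp n) (triv_real _ _)
  have e : cexp 0 = 1 := Circle.exp_zero
  rwa [e] at this

theorem pi1_circle : Nonempty ((π_ (0+1)) Circle 1 ≃* Multiplicative ℤ) := by
  have e : cexp 0 = 1 := Circle.exp_zero
  rw [← e]
  have hpl : ∀ f : LP (cb 0) (cexp 0), ∃ F, IsPL cexp 0 (cb 0) f.1 F := fun f =>
    exists_PL regFib_exp 0 _ f.2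
  choose F hF using hpl
  let k0 : Fin 0 → I := fun i => i.elim0
  have hn : ∀ f : LP (cb 0) (cexp 0), ∃ n : ℤ, F f (1, k0) = n * (2 * Real.pi) := fun f =>
    fib_int ((hF f).fin f.2 k0)
  choose d hd using hn
  have hpi := Real.pi_pos
  have key : ∀ (f g : LP (cb 0) (cexp 0)) (G) (hG : IsPL cexp 0 (cb 0) g.1 G), f.Hom g →
      G (1, k0) = d f * (2 * Real.pi) := by
    intro f g G hG h
    have := (hF f).homotopic regFib_exp hG f.2 g.2 h
    obtain ⟨H, h0, h1, h2⟩ := hrel_iff.1 this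
    have h3 := int_const ((incl _ _).comp (H.comp ⟨fun t => (t, k0), by fun_prop⟩))
      (fun t => fib_int (H (t, k0))) 0 1
    simp only [incl, ContinuousMap.comp_apply, ContinuousMap.coe_mk, h0, h1] at h3
    rw [← hd]
    exact h3.symm
  have key2 : ∀ (f g : LP (cb 0) (cexp 0)) (G) (hG : IsPL cexp 0 (cb 0) g.1 G) (n : ℤ), f.Hom g →
      G (1, k0) = n * (2 * Real.pi) → d f = n := by
    intro f g G hG n h h'
    rw [key f g G hG h] at h'
    have : (d f : ℝ) = n := mul_right_cancel₀ (by positivity) h'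
    exact_mod_cast this
  refine mkIsoInt d ?_ ?_ ?_ ?_
  · intro f g h
    exact key2 f g _ (hF g) _ h (hd g)
  · intro f g
    refine key2 (f.cat g) (f.cat g) ⟨fun q => F f (cl (2 * q.1), q.2) + F g (cl (2 * q.1 - 1), q.2),
      by fun_prop⟩ ⟨?_, ?_, ?_⟩ _ (LP.Hom.rfl' _) ?_
    · intro z
      simp only [ContinuousMap.coe_mk]
      rw [LP.cat_apply]
      have : ∀ a b, cexp (a + b) = cexp a * cexp b := Circle.exp_add
      rw [this, (hF f).lift, (hF g).lift]
      split_ifs with h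
      · rw [cl_of_le (t := 2 * z.1 - 1) (by linarith), g.2 _ (Or.inl rfl)]
        exact (congrArg _ e).trans (mul_one _)
      · rw [cl_of_ge (t := 2 * z.1) (by linarith), f.2 _ (Or.inr (Or.inl rfl))]
        exact (congrArg (fun w => w * g.1 (cl (2 * z.1 - 1), z.2)) e).trans (one_mul _)
    · intro k
      have : cl (2 * ((0 : I) : ℝ) - 1) = 0 := cl_of_le (by simp)
      simp only [ContinuousMap.coe_mk]
      rw [this, (hF g).zero]
      simp [(hF f).zero]
    · rintro t a ⟨i, _⟩
      exact i.elim0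
    · have h1 : cl (2 * ((1 : I) : ℝ)) = 1 := cl_of_ge (by norm_num)
      have h2 : cl (2 * ((1 : I) : ℝ) - 1) = 1 := cl_of_ge (by norm_num)
      simp only [ContinuousMap.coe_mk]
      rw [h1, h2, hd, hd]
      push_cast
      ring
  · intro f hf
    obtain ⟨g, h1, h2⟩ := (hF f).lift_of_end f.2 (by
      have : (hF f).fin f.2 = ContinuousMap.const _ ⟨0, rfl⟩ := by
        refine ContinuousMap.ext fun k => Subtype.ext ?_
        have hk : k = k0 := Subsingleton.elim _ _
        show F f (1, k) = 0
        rw [hk, hd, hf]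
        simp
      rw [this]; exact HomotopicRel.refl _)
    exact h2.trans (hrel_comp (triv_real _ _ g h1) cexp)
  · intro m
    let G : C(I × (Fin 0 → I), ℝ) := ⟨fun q => m * (2 * Real.pi) * q.1, by fun_prop⟩
    let f : LP (cb 0) (cexp 0) := ⟨cexp.comp G, by
      rintro ⟨t, k⟩ (h | h | h)
      · have : t = 0 := h
        subst this
        simp [G]
      · have : t = 1 := h
        subst this
        rw [e]
        exact Circle.exp_eq_one.2 ⟨m, by simp [G]⟩
      · exact h.choose.elim0⟩
    refine ⟨f, key2 f f G ⟨fun z => rfl, fun k => by simp [G], ?_⟩ m (LP.Hom.rfl' _) (by simp [G])⟩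
    rintro t a ⟨i, _⟩
    exact i.elim0
end circle
end BQ

namespace BQ
open scoped unitInterval Topology.Homotopy
open ContinuousMap

/-! ### General position -/
section gp
variable {W : Type} [NormedAddCommGroup W] [NormedSpace ℝ W] [FiniteDimensional ℝ W]
  {K : Type} [TopologicalSpace K]

/-- no vertical line meets both half-axes -/
def Sep (P : C(I × K, ℝ × W)) : Prop :=
  ∀ (x : K) (t t' : I), (P (t, x)).2 = 0 → (P (t', x)).2 = 0 → 0 < (P (t, x)).1 →
    (P (t', x)).1 < 0 → False

theorem gp0 (m : ℕ) (hm : m + 2 < 2 * Module.finrank ℝ W) (f : C(I × (Fin m → I), ℝ × W)) (ε : ℝ)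
    (hε : 0 < ε) : ∃ P : C(I × (Fin m → I), ℝ × W), (∀ q, ‖P q - f q‖ ≤ ε) ∧ Sep P := by
  let D := ℝ × (Fin m → ℝ)
  let ft : D → ℝ × W := fun q => f (cl q.1, fun i => cl (q.2 i))
  have hft : Continuous ft := by
    refine f.continuous.comp (Continuous.prodMk (continuous_cl.comp continuous_fst) ?_)
    exact continuous_pi fun i => continuous_cl.comp ((continuous_apply i).comp continuous_snd)
  obtain ⟨F, hF, hFf, -⟩ := hft.exists_contDiff_approx 1 (ε := fun _ => ε / 2)
    continuous_const (fun _ => by positivity)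
  let T := (Fin m → ℝ) × ℝ × ℝ
  let h1 : T → ℝ := fun z => (F (z.2.1, z.1)).1
  let h2 : T → ℝ := fun z => (F (z.2.2, z.1)).1
  let w1 : T → W := fun z => (F (z.2.1, z.1)).2
  let w2 : T → W := fun z => (F (z.2.2, z.1)).2
  have c1 : ContDiff ℝ 1 h1 := by fun_prop
  have c2 : ContDiff ℝ 1 h2 := by fun_prop
  have c3 : ContDiff ℝ 1 w1 := by fun_prop
  have c4 : ContDiff ℝ 1 w2 := by fun_prop
  let S : Set T := {z | h1 z - h2 z ≠ 0}
  let bb : T → W := fun z => (h1 z - h2 z)⁻¹ • (w1 z - w2 z)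
  let Φ : T → W × W := fun z => (w1 z - h1 z • bb z, bb z)
  have hcd : ∀ z ∈ S, ContDiffAt ℝ 1 Φ z := by
    intro z hz
    have hb : ContDiffAt ℝ 1 bb z :=
      ((c1.sub c2).contDiffAt.inv hz).smul (c3.sub c4).contDiffAt
    exact (c3.contDiffAt.sub (c1.contDiffAt.smul hb)).prodMk hb
  have hdim : dimH (Φ '' S) < Module.finrank ℝ (W × W) := by
    calc dimH (Φ '' S) ≤ dimH S := dimH_image_le_of_locally_lipschitzOn fun z hz => by
          obtain ⟨C, t, ht, h⟩ := (hcd z hz).exists_lipschitzOnWith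
          exact ⟨C, t, mem_nhdsWithin_of_mem_nhds ht, h⟩
      _ ≤ dimH (Set.univ : Set T) := dimH_mono (Set.subset_univ _)
      _ = Module.finrank ℝ T := Real.dimH_univ_eq_finrank T
      _ < Module.finrank ℝ (W × W) := by
        have e1 : Module.finrank ℝ T = m + 2 := by
          simp [T, Module.finrank_prod]
        have e2 : Module.finrank ℝ (W × W) = 2 * Module.finrank ℝ W := by
          rw [Module.finrank_prod]; ring
        rw [e1, e2]
        exact_mod_cast hm
  have hdense := dense_compl_of_dimH_lt_finrank hdim
  let Fr : C(I × (Fin m → I), ℝ × W) := ⟨fun q => F ((q.1 : ℝ), fun i => (q.2 i : ℝ)), by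
    refine hF.continuous.comp (Continuous.prodMk (by fun_prop) ?_)
    exact continuous_pi fun i => by fun_prop⟩
  have hFr : ∀ q, ‖Fr q - f q‖ < ε / 2 := fun q => by
    have := hFf ((q.1 : ℝ), fun i => (q.2 i : ℝ))
    rw [dist_eq_norm] at this
    simpa [ft, cl_coe, Fr] using this
  obtain ⟨M, hM⟩ : ∃ M : ℝ, ∀ q, |(Fr q).1| ≤ M := by
    have := isCompact_range (show Continuous (fun q => |(Fr q).1|) by fun_prop)
    obtain ⟨M, hM⟩ := this.bddAbove
    exact ⟨M, fun q => hM ⟨q, rfl⟩⟩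
  have hM0 : 0 ≤ M := (abs_nonneg _).trans (hM (0, fun _ => 0))
  obtain ⟨⟨a, b⟩, hab, hab2⟩ := hdense.exists_dist_lt (0 : W × W)
    (show 0 < ε / 2 / (1 + M) by positivity)
  rw [dist_comm, dist_eq_norm, sub_zero] at hab2
  have ha : ‖a‖ ≤ ε / 2 / (1 + M) := (norm_fst_le (a, b)).trans hab2.le
  have hb : ‖b‖ ≤ ε / 2 / (1 + M) := (norm_snd_le (a, b)).trans hab2.le
  refine ⟨⟨fun q => ((Fr q).1, (Fr q).2 - (a + (Fr q).1 • b)), by fun_prop⟩, ?_, ?_⟩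
  · intro q
    have e : (((Fr q).1, (Fr q).2 - (a + (Fr q).1 • b)) : ℝ × W) - f q
        = (Fr q - f q) - (0, a + (Fr q).1 • b) := by
      ext <;> simp; abel
    show ‖(((Fr q).1, (Fr q).2 - (a + (Fr q).1 • b)) : ℝ × W) - f q‖ ≤ ε
    rw [e]
    have h3 : ‖((0 : ℝ), a + (Fr q).1 • b)‖ ≤ ε / 2 := by
      rw [Prod.norm_mk, norm_zero]
      refine max_le (by positivity) ?_
      calc ‖a + (Fr q).1 • b‖ ≤ ‖a‖ + |(Fr q).1| * ‖b‖ := by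
            refine (norm_add_le _ _).trans ?_
            rw [norm_smul, Real.norm_eq_abs]
        _ ≤ ε / 2 / (1 + M) + M * (ε / 2 / (1 + M)) := by
            gcongr
            exact hM q
        _ = ε / 2 := by field_simp
    calc _ ≤ _ := norm_sub_le _ _
      _ ≤ ε := by linarith [hFr q]
  · intro x t t' e1 e2 p1 p2
    simp only [ContinuousMap.coe_mk] at e1 e2 p1 p2
    apply hab
    have e1' := sub_eq_zero.1 e1
    have e2' := sub_eq_zero.1 e2
    let z : T := (fun i => (x i : ℝ), (t : ℝ), (t' : ℝ))
    have q1 : h1 z = (Fr (t, x)).1 := rfl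
    have q2 : h2 z = (Fr (t', x)).1 := rfl
    have q3 : w1 z = (Fr (t, x)).2 := rfl
    have q4 : w2 z = (Fr (t', x)).2 := rfl
    have hz : h1 z - h2 z ≠ 0 := by rw [q1, q2]; linarith
    have hbz : bb z = b := by
      show (h1 z - h2 z)⁻¹ • (w1 z - w2 z) = b
      rw [inv_smul_eq_iff₀ hz, q3, q4, e1', e2', sub_smul, q1, q2]
      abel
    refine ⟨z, hz, ?_⟩
    show (w1 z - h1 z • bb z, bb z) = (a, b)
    rw [hbz, q3, q1, e1']
    simp

theorem gp {m : ℕ} (hm : m + 2 < 2 * Module.finrank ℝ W) (e : K ≃ₜ (Fin m → I))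
    (f : C(I × K, ℝ × W)) (w0 : W) (hw : w0 ≠ 0) (ε : ℝ) (hε : 0 < ε) :
    ∃ P : C(I × K, ℝ × W), (∀ q, ‖P q - f q‖ ≤ ε) ∧ Sep P ∧ ∀ q, f q = (0, w0) → P q = (0, w0) := by
  have hw' : 0 < ‖w0‖ := norm_pos_iff.2 hw
  set r := ‖w0‖ / 4 with hr
  obtain ⟨P0, hP0, hS0⟩ := gp0 m hm (f.comp ⟨fun q => (q.1, e.symm q.2), by fun_prop⟩)
    (min ε (‖w0‖ / 4)) (lt_min hε (by positivity))
  let P1 : C(I × K, ℝ × W) := P0.comp ⟨fun q => (q.1, e q.2), by fun_prop⟩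
  have hP1 : ∀ q, ‖P1 q - f q‖ ≤ min ε (‖w0‖ / 4) := fun q => by
    have := hP0 (q.1, e q.2)
    simpa [P1] using this
  have hS1 : Sep P1 := fun x t t' => hS0 (e x) t t'
  let φ : C(I × K, I) := ⟨fun q => cl (‖f q - (0, w0)‖ / r - 1), by fun_prop⟩
  let P : C(I × K, ℝ × W) := ⟨fun q => f q + (φ q : ℝ) • (P1 q - f q), by fun_prop⟩
  have hP : ∀ q, ‖P q - f q‖ ≤ min ε (‖w0‖ / 4) := fun q => by
    have : P q - f q = (φ q : ℝ) • (P1 q - f q) := by simp [P]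
    rw [this, norm_smul, Real.norm_eq_abs, abs_of_nonneg (φ q).2.1]
    calc _ ≤ 1 * ‖P1 q - f q‖ := by gcongr; exact (φ q).2.2
      _ ≤ _ := by rw [one_mul]; exact hP1 q
  have key : ∀ q, (P q).2 = 0 → P q = P1 q := by
    intro q hq
    have h1 : ‖w0‖ / 2 ≤ ‖f q - (0, w0)‖ := by
      have a1 : ‖(P q - f q).2‖ ≤ ‖w0‖ / 4 := (norm_snd_le _).trans ((hP q).trans (min_le_right _ _))
      have a2 : ‖(f q - (0, w0)).2‖ ≤ ‖f q - (0, w0)‖ := norm_snd_le _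
      simp only [Prod.snd_sub, hq, zero_sub, norm_neg] at a1 a2
      have a3 : ‖w0‖ ≤ ‖(f q).2‖ + ‖(f q).2 - w0‖ := by
        have := norm_sub_le (f q).2 ((f q).2 - w0)
        simpa using this
      linarith
    have h2 : φ q = 1 := by
      refine cl_of_ge ?_
      have : 2 ≤ ‖f q - (0, w0)‖ / r := by
        rw [le_div_iff₀ (by positivity), hr]; linarith
      linarith
    show f q + (φ q : ℝ) • (P1 q - f q) = P1 q
    rw [h2]; simp
  refine ⟨P, fun q => (hP q).trans (min_le_left _ _), ?_, ?_⟩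
  · intro x t t' e1 e2 p1 p2
    have k1 := key _ e1
    have k2 := key _ e2
    rw [k1] at e1 p1
    rw [k2] at e2 p2
    exact hS1 x t t' e1 e2 p1 p2
  · intro q hq
    have : φ q = 0 := by
      refine cl_of_le ?_
      rw [hq]; simp
    show f q + (φ q : ℝ) • (P1 q - f q) = _
    rw [this, hq]; simp
end gp
end BQ

namespace BQ
open scoped unitInterval Topology.Homotopy
open ContinuousMap
set_option linter.unusedSectionVars false

/-! ### Suspension -/
/-- nonzero vectors -/
abbrev NZ (V : Type) [Zero V] : Type := {v : V // v ≠ 0}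

theorem hrel_sub {K V : Type} [TopologicalSpace K] [TopologicalSpace V] [Zero V] {S : Set K}
    {f g : C(K, NZ V)} (H : I × K → V) (hc : Continuous H) (hne : ∀ q, H q ≠ 0)
    (h0 : ∀ k, H (0, k) = (f k).1) (h1 : ∀ k, H (1, k) = (g k).1)
    (h2 : ∀ t, ∀ k ∈ S, H (t, k) = (f k).1) : f.HomotopicRel g S :=
  hrel_iff.2 ⟨⟨fun q => ⟨H q, hne q⟩, by fun_prop⟩, fun k => Subtype.ext (h0 k),
    fun k => Subtype.ext (h1 k), fun t k hk => Subtype.ext (h2 t k hk)⟩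

section susp
variable {W : Type} [NormedAddCommGroup W] [NormedSpace ℝ W]

/-- complement of the south ray -/
def Y1 : Set (ℝ × W) := {y | 0 < ‖y.2‖ + max y.1 0}
/-- complement of the north ray -/
def Y2 : Set (ℝ × W) := {y | 0 < ‖y.2‖ + max (-y.1) 0}

theorem isOpen_Y1 : IsOpen (Y1 : Set (ℝ × W)) := isOpen_lt (by fun_prop) (by fun_prop)
theorem isOpen_Y2 : IsOpen (Y2 : Set (ℝ × W)) := isOpen_lt (by fun_prop) (by fun_prop)

theorem mem_Y1_of {y : ℝ × W} (h : y.2 ≠ 0) : y ∈ Y1 := by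
  have := norm_pos_iff.2 h
  show 0 < ‖y.2‖ + max y.1 0
  positivity
theorem mem_Y2_of {y : ℝ × W} (h : y.2 ≠ 0) : y ∈ Y2 := by
  have := norm_pos_iff.2 h
  show 0 < ‖y.2‖ + max (-y.1) 0
  positivity
theorem not_mem_Y1 {y : ℝ × W} (h : y ∉ Y1) : y.2 = 0 ∧ y.1 ≤ 0 := by
  have h1 : ‖y.2‖ + max y.1 0 ≤ 0 := not_lt.1 h
  have h2 := norm_nonneg y.2
  have h3 := le_max_right y.1 0
  have h4 := le_max_left y.1 0
  exact ⟨norm_eq_zero.1 (by linarith), by linarith⟩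
theorem not_mem_Y2 {y : ℝ × W} (h : y ∉ Y2) : y.2 = 0 ∧ 0 ≤ y.1 := by
  have h1 : ‖y.2‖ + max (-y.1) 0 ≤ 0 := not_lt.1 h
  have h2 := norm_nonneg y.2
  have h3 := le_max_right (-y.1) 0
  have h4 := le_max_left (-y.1) 0
  exact ⟨norm_eq_zero.1 (by linarith), by linarith⟩
theorem snd_ne_of {y : ℝ × W} (h1 : y ∈ Y1) (h2 : y ∈ Y2) : y.2 ≠ 0 := by
  intro h
  have a1 : 0 < ‖y.2‖ + max y.1 0 := h1
  have a2 : 0 < ‖y.2‖ + max (-y.1) 0 := h2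
  rw [h, norm_zero, zero_add] at a1 a2
  rcases lt_max_iff.1 a1 with b1 | b1 <;> rcases lt_max_iff.1 a2 with b2 | b2 <;> linarith

variable (w0 : W)
/-- height of the detour -/
def kk (y : ℝ × W) : ℝ := max (-y.1) 0 * (1 + ‖w0‖ / (‖y.2‖ + max y.1 0)) + ‖y.2 - w0‖
/-- displacement, north -/
def D1 (y : ℝ × W) (u : ℝ) : ℝ × W := u • ((0, w0) - y) + (u * (1 - u) * kk w0 y, 0)
/-- displacement, south -/
def D2 (y : ℝ × W) (u : ℝ) : ℝ × W := u • ((0, w0) - y) - (u * (1 - u) * kk w0 (-y.1, y.2), 0)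
/-- the loop formula -/
def LL (y1 m y2 : ℝ × W) (t : ℝ) : ℝ × W :=
  m + D1 w0 y1 (1 - cl (3 * t)) + D2 w0 y2 (cl (3 * t - 2))

variable {w0}
theorem kk_cont {T : Type} [TopologicalSpace T] {y : T → ℝ × W} (hy : Continuous y)
    (h : ∀ t, y t ∈ Y1) : Continuous fun t => kk w0 (y t) := by
  unfold kk
  have : ∀ t, ‖(y t).2‖ + max (y t).1 0 ≠ 0 := fun t => ne_of_gt (h t)
  fun_prop (disch := assumption)

theorem LL_cont {T : Type} [TopologicalSpace T] {y1 m y2 : T → ℝ × W} {t : T → ℝ}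
    (hy1 : Continuous y1) (hm : Continuous m) (hy2 : Continuous y2) (ht : Continuous t)
    (h1 : ∀ t, y1 t ∈ Y1) (h2 : ∀ t, y2 t ∈ Y2) :
    Continuous fun s => LL w0 (y1 s) (m s) (y2 s) (t s) := by
  unfold LL D1 D2
  have k1 := kk_cont (w0 := w0) hy1 h1
  have k2 : Continuous fun s => kk w0 (-(y2 s).1, (y2 s).2) :=
    kk_cont (w0 := w0) (y := fun s => (-(y2 s).1, (y2 s).2)) (by fun_prop) (fun s => h2 s)
  fun_prop

theorem kk_nonneg (y : ℝ × W) : 0 ≤ kk w0 y := by unfold kk; positivity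

theorem C1_ne (hw : w0 ≠ 0) {y : ℝ × W} (hy : y ∈ Y1) {u : ℝ} (hu0 : 0 ≤ u) (hu1 : u ≤ 1) :
    y + D1 w0 y u ≠ 0 := by
  obtain ⟨h, w⟩ := y
  intro e
  have e1 : h + u * (0 - h) + u * (1 - u) * kk w0 (h, w) = 0 := by
    have := congrArg Prod.fst e
    simp only [D1, Prod.fst_add, Prod.smul_fst, Prod.fst_sub, smul_eq_mul, Prod.fst_zero] at this
    linarith
  have e2 : w + u • (w0 - w) = 0 := by
    have := congrArg Prod.snd e
    simpa [D1] using this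
  have e2' : (1 - u) • w = - (u • w0) := by
    rw [eq_neg_iff_add_eq_zero, ← e2]; module
  have hu : u < 1 := lt_of_le_of_ne hu1 (by
    rintro rfl
    simp at e2
    exact hw e2)
  have e3 : h + u * kk w0 (h, w) = 0 := by
    have : (1 - u) * (h + u * kk w0 (h, w)) = 0 := by linarith
    exact (mul_eq_zero.1 this).resolve_left (by linarith)
  have hk := kk_nonneg (w0 := w0) (h, w)
  have hwp := norm_pos_iff.2 hw
  have hh : h ≤ 0 := by nlinarith [mul_nonneg hu0 hk]
  have hY : 0 < ‖w‖ := by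
    have : 0 < ‖w‖ + max h 0 := hy
    rwa [max_eq_right hh, add_zero] at this
  have e4 : (1 - u) * ‖w‖ = u * ‖w0‖ := by
    have := congrArg norm e2'
    rwa [norm_neg, norm_smul, norm_smul, Real.norm_eq_abs, Real.norm_eq_abs, abs_of_nonneg hu0,
      abs_of_nonneg (by linarith)] at this
  have e5 : u * (1 + ‖w0‖ / ‖w‖) = 1 := by
    field_simp
    linarith
  have hup : 0 < u := by
    rcases hu0.lt_or_eq with h | h
    · exact h
    · rw [← h] at e5; simp at e5
  have e6 : kk w0 (h, w) = -h * (1 + ‖w0‖ / ‖w‖) + ‖w - w0‖ := by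
    unfold kk
    simp only
    rw [max_eq_right hh, add_zero, max_eq_left (by linarith)]
  have e7 : u * ‖w - w0‖ = 0 := by
    rw [e6] at e3
    have : h + u * (-h * (1 + ‖w0‖ / ‖w‖) + ‖w - w0‖)
      = h - h * (u * (1 + ‖w0‖ / ‖w‖)) + u * ‖w - w0‖ := by ring
    rw [this, e5] at e3
    linarith
  have e8 : w = w0 := by
    have := (mul_eq_zero.1 e7).resolve_left hup.ne'
    exact sub_eq_zero.1 (norm_eq_zero.1 this)
  rw [e8, sub_self, smul_zero, add_zero] at e2
  exact hw e2

theorem D2_eq (y : ℝ × W) (u : ℝ) :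
    D2 w0 y u = (-(D1 w0 (-y.1, y.2) u).1, (D1 w0 (-y.1, y.2) u).2) := by
  ext <;> simp [D1, D2]; ring

theorem C2_ne (hw : w0 ≠ 0) {y : ℝ × W} (hy : y ∈ Y2) {u : ℝ} (hu0 : 0 ≤ u) (hu1 : u ≤ 1) :
    y + D2 w0 y u ≠ 0 := by
  have h1 : ((-y.1, y.2) : ℝ × W) ∈ Y1 := hy
  have := C1_ne hw h1 hu0 hu1
  intro e
  apply this
  rw [D2_eq] at e
  have e1 := congrArg Prod.fst e
  have e2 := congrArg Prod.snd e
  simp only [Prod.fst_add, Prod.snd_add, Prod.fst_zero, Prod.snd_zero] at e1 e2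
  ext
  · simp only [Prod.fst_add, Prod.fst_zero]; linarith
  · simpa using e2

@[simp] theorem D1_zero (y : ℝ × W) : D1 w0 y 0 = 0 := by simp [D1]
@[simp] theorem D2_zero (y : ℝ × W) : D2 w0 y 0 = 0 := by simp [D2]
@[simp] theorem D1_one (y : ℝ × W) : D1 w0 y 1 = (0, w0) - y := by simp [D1]
@[simp] theorem D2_one (y : ℝ × W) : D2 w0 y 1 = (0, w0) - y := by simp [D2]
@[simp] theorem D1_base (u : ℝ) : D1 w0 (0, w0) u = 0 := by simp [D1, kk]
@[simp] theorem D2_base (u : ℝ) : D2 w0 (0, w0) u = 0 := by simp [D2, kk]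

theorem LL_base (m : ℝ × W) (t : ℝ) : LL w0 (0, w0) m (0, w0) t = m := by simp [LL]

theorem LL_left {t : ℝ} (h : t ≤ 1/3) (y1 m y2 : ℝ × W) :
    LL w0 y1 m y2 t = m + D1 w0 y1 (1 - cl (3 * t)) := by
  rw [LL, cl_of_le (t := 3 * t - 2) (by linarith)]; simp
theorem LL_right {t : ℝ} (h : 2/3 ≤ t) (y1 m y2 : ℝ × W) :
    LL w0 y1 m y2 t = m + D2 w0 y2 (cl (3 * t - 2)) := by
  rw [LL, cl_of_ge (t := 3 * t) (by linarith)]; simp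
theorem LL_mid {t : ℝ} (h : 1/3 ≤ t) (h' : t ≤ 2/3) (y1 m y2 : ℝ × W) :
    LL w0 y1 m y2 t = m := by
  rw [LL, cl_of_ge (t := 3 * t) (by linarith), cl_of_le (t := 3 * t - 2) (by linarith)]; simp

theorem LL_at0 (y1 y2 : ℝ × W) : LL w0 y1 y1 y2 0 = (0, w0) := by
  rw [LL_left (by norm_num)]; simp
theorem LL_at1 (y1 y2 : ℝ × W) : LL w0 y1 y2 y2 1 = (0, w0) := by
  rw [LL_right (by norm_num), cl_of_ge (by norm_num)]; simp

theorem LL_ne (hw : w0 ≠ 0) {y1 m y2 : ℝ × W} {t : ℝ} (h1 : y1 ∈ Y1) (h2 : y2 ∈ Y2) (hm : m ≠ 0)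
    (e1 : t ≤ 1/3 → m = y1) (e2 : 2/3 ≤ t → m = y2) : LL w0 y1 m y2 t ≠ 0 := by
  rcases le_total t (1/3) with h | h
  · rw [LL_left h, e1 h]
    exact C1_ne hw h1 (by linarith [(cl (3 * t)).2.2]) (by linarith [(cl (3 * t)).2.1])
  · rcases le_total t (2/3) with h' | h'
    · rwa [LL_mid h h']
    · rw [LL_right h', e2 h']
      exact C2_ne hw h2 (cl _).2.1 (cl _).2.2

variable {K : Type} [TopologicalSpace K] {A : Set K}

/-- the suspension -/
def Sus (hw : w0 ≠ 0) (g : C(K, NZ W)) : C(I × K, NZ (ℝ × W)) :=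
  ⟨fun q => ⟨LL w0 (0, (g q.2).1) (0, (g q.2).1) (0, (g q.2).1) q.1, LL_ne hw
    (mem_Y1_of (g q.2).2) (mem_Y2_of (g q.2).2)
    (fun h => (g q.2).2 (congrArg Prod.snd h)) (fun _ => rfl) (fun _ => rfl)⟩, by
    refine Continuous.subtype_mk (LL_cont (by fun_prop) (by fun_prop) (by fun_prop) (by fun_prop)
      (fun q => mem_Y1_of (g q.2).2) (fun q => mem_Y2_of (g q.2).2)) _⟩

theorem Sus_apply (hw : w0 ≠ 0) (g : C(K, NZ W)) (q) : (Sus hw g q).1 =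
  LL w0 (0, (g q.2).1) (0, (g q.2).1) (0, (g q.2).1) q.1 := rfl

/-- base point of the suspension -/
def x0 (hw : w0 ≠ 0) : NZ (ℝ × W) := ⟨(0, w0), fun h => hw (congrArg Prod.snd h)⟩

theorem Sus_bd (hw : w0 ≠ 0) (g : C(K, NZ W)) (hg : ∀ a ∈ A, g a = ⟨w0, hw⟩) :
    ∀ a ∈ bd A, Sus hw g a = x0 hw := by
  rintro ⟨t, k⟩ (h | h | h)
  · have : t = 0 := h
    subst this
    exact Subtype.ext (LL_at0 _ _)
  · have : t = 1 := h
    subst this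
    exact Subtype.ext (LL_at1 _ _)
  · refine Subtype.ext ?_
    rw [Sus_apply]
    simp only [hg k h, LL_base]
    rfl

theorem Sus_hom (hw : w0 ≠ 0) {g g' : C(K, NZ W)} (hg : ∀ a ∈ A, g a = ⟨w0, hw⟩)
    (h : g.HomotopicRel g' A) : (Sus hw g).HomotopicRel (Sus hw g') (bd A) := by
  obtain ⟨H, h0, h1, h2⟩ := hrel_iff.1 h
  have hH : ∀ t, ∀ a ∈ bd A, (Sus hw (H.comp ⟨fun k => (t, k), by fun_prop⟩)) a = x0 hw :=
    fun t a ha => Sus_bd hw _ (fun a ha => by simp [h2 t a ha, hg a ha]) a ha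
  refine hrel_iff.2 ⟨(Sus hw H).comp ⟨fun q => (q.2.1, (q.1, q.2.2)), by fun_prop⟩, ?_, ?_, ?_⟩
  · intro k
    refine Subtype.ext ?_
    simp [Sus_apply, h0]
  · intro k
    refine Subtype.ext ?_
    simp [Sus_apply, h1]
  · intro t k hk
    rw [Sus_bd hw g hg k hk]
    exact hH t k hk

theorem Sus_const (hw : w0 ≠ 0) : Sus hw (ContinuousMap.const K ⟨w0, hw⟩) =
    ContinuousMap.const (I × K) (x0 hw) :=
  ContinuousMap.ext fun _ => Subtype.ext (LL_base _ _)

/-! ### Shrinking -/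
theorem shrink [CompactSpace K] [T2Space K] (Φ : C(I × K, ℝ × W)) (hS : Sep Φ) (hne : ∀ q, Φ q ≠ 0)
    (h1 : ∀ x, Φ (0, x) ∈ Y1) (h2 : ∀ x, Φ (1, x) ∈ Y2) :
    ∃ τ : C(K, I), (∀ (s : I) x, Φ (cl (s * τ x), x) ∈ Y1) ∧
      ∀ (s : I) x, Φ (cl (1 - s + s * τ x), x) ∈ Y2 := by
  let N : Set K := Prod.snd '' {q : I × K | (Φ q).2 = 0 ∧ 0 ≤ (Φ q).1}
  let S : Set K := Prod.snd '' {q : I × K | (Φ q).2 = 0 ∧ (Φ q).1 ≤ 0}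
  have hN : IsClosed N := isClosedMap_snd_of_compactSpace _
    ((isClosed_eq (f := fun q => (Φ q).2) (g := fun _ => 0) (by fun_prop) (by fun_prop)).inter
      (isClosed_le (f := fun _ => 0) (g := fun q => (Φ q).1) (by fun_prop) (by fun_prop)))
  have hSc : IsClosed S := isClosedMap_snd_of_compactSpace _
    ((isClosed_eq (f := fun q => (Φ q).2) (g := fun _ => 0) (by fun_prop) (by fun_prop)).inter
      (isClosed_le (f := fun q => (Φ q).1) (g := fun _ => 0) (by fun_prop) (by fun_prop)))
  have hd : Disjoint S N := by
    rw [Set.disjoint_left]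
    rintro x ⟨⟨t, x1⟩, ⟨a1, a2⟩, rfl⟩ ⟨⟨t', x2⟩, ⟨b1, b2⟩, e⟩
    have e' : x2 = x1 := e
    subst e'
    refine hS x2 t' t b1 a1 (lt_of_le_of_ne b2 fun h => hne _ (Prod.ext h.symm b1))
      (lt_of_le_of_ne a2 fun h => hne _ (Prod.ext h a1))
  obtain ⟨sg, s0, s1, s2⟩ := exists_continuous_zero_one_of_isClosed hSc hN hd
  let τ : C(K, I) := ⟨fun x => ⟨sg x, s2 x⟩, by fun_prop⟩
  refine ⟨τ, ?_, ?_⟩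
  · intro s x
    by_contra h
    obtain ⟨a1, a2⟩ := not_mem_Y1 h
    have hx : x ∈ S := ⟨_, ⟨a1, a2⟩, rfl⟩
    have hτ : τ x = 0 := Subtype.ext (s0 hx)
    apply h
    rw [hτ]
    simpa using h1 x
  · intro s x
    by_contra h
    obtain ⟨a1, a2⟩ := not_mem_Y2 h
    have hx : x ∈ N := ⟨_, ⟨a1, a2⟩, rfl⟩
    have hτ : τ x = 1 := Subtype.ext (s1 hx)
    apply h
    rw [hτ]
    simpa using h2 x
end susp
end BQ

namespace BQ
open scoped unitInterval Topology.Homotopy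
open ContinuousMap
set_option linter.unusedSectionVars false

/-! ### Freudenthal -/
theorem exists_eps {T : Type} [TopologicalSpace T] [CompactSpace T] {h : T → ℝ} (hc : Continuous h)
    (hp : ∀ t, 0 < h t) : ∃ ε : ℝ, 0 < ε ∧ ∀ t, ε < h t := by
  rcases isEmpty_or_nonempty T with hT | hT
  · exact ⟨1, one_pos, fun t => (hT.false t).elim⟩
  · obtain ⟨t, -, ht⟩ := isCompact_univ.exists_isMinOn Set.univ_nonempty hc.continuousOn
    exact ⟨h t / 2, by have := hp t; linarith, fun s => by
      have := hp t
      have := ht (Set.mem_univ s)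
      simp only [Set.mem_ofPred_eq] at this
      linarith⟩

section
variable {W : Type} [NormedAddCommGroup W] [NormedSpace ℝ W] {w0 : W}
variable {K : Type} [TopologicalSpace K] {A : Set K}

theorem segment_ne {V : Type} [NormedAddCommGroup V] [NormedSpace ℝ V] {a b : V} {ε : ℝ}
    (h : ‖b - a‖ ≤ ε) (h' : ε < ‖a‖) (s : I) : a + (s : ℝ) • (b - a) ≠ 0 := by
  intro e
  have e1 : a = -((s : ℝ) • (b - a)) := eq_neg_of_add_eq_zero_left e
  have e2 : ‖a‖ = s * ‖b - a‖ := by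
    conv_lhs => rw [e1]
    rw [norm_neg, norm_smul, Real.norm_eq_abs, abs_of_nonneg s.2.1]
  have := s.2.2
  nlinarith [norm_nonneg (b - a)]

variable [CompactSpace K] [T2Space K] [FiniteDimensional ℝ W]

theorem surjS {m : ℕ} (hm : m + 2 < 2 * Module.finrank ℝ W) (e : K ≃ₜ (Fin m → I)) (hw : w0 ≠ 0)
    (f : C(I × K, NZ (ℝ × W))) (hf : ∀ a ∈ bd A, f a = x0 hw) :
    ∃ g : C(K, NZ W), (∀ a ∈ A, g a = ⟨w0, hw⟩) ∧ f.HomotopicRel (Sus hw g) (bd A) := by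
  obtain ⟨ε, hε, hε'⟩ := exists_eps (h := fun q => ‖(f q).1‖) (by fun_prop)
    (fun q => norm_pos_iff.2 (f q).2)
  obtain ⟨P, hP1, hP2, hP3⟩ := gp hm e (⟨fun q => (f q).1, by fun_prop⟩ : C(I × K, ℝ × W)) w0 hw ε hε
  simp only [ContinuousMap.coe_mk] at hP1 hP3
  have hPne : ∀ q, P q ≠ 0 := fun q => by
    have := segment_ne (hP1 q) (hε' q) 1
    simpa using this
  have hPb : ∀ a ∈ bd A, P a = (0, w0) := fun a ha => hP3 a (by rw [hf a ha]; rfl)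
  have b0 : ∀ x, P (0, x) = (0, w0) := fun x => hPb _ (Or.inl rfl)
  have b1 : ∀ x, P (1, x) = (0, w0) := fun x => hPb _ (Or.inr (Or.inl rfl))
  have bA : ∀ t, ∀ x ∈ A, P (t, x) = (0, w0) := fun t x hx => hPb _ (Or.inr (Or.inr hx))
  obtain ⟨τ, hτ1, hτ2⟩ := shrink P hP2 hPne (fun x => by rw [b0]; exact mem_Y1_of hw)
    (fun x => by rw [b1]; exact mem_Y2_of hw)
  let f' : C(I × K, NZ (ℝ × W)) := ⟨fun q => ⟨P q, hPne q⟩, by fun_prop⟩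
  have h1 : f.HomotopicRel f' (bd A) := by
    refine hrel_sub (fun q => (f q.2).1 + (q.1 : ℝ) • (P q.2 - (f q.2).1)) (by fun_prop)
      (fun q => segment_ne (hP1 _) (hε' _) _) (fun k => by simp) (fun k => by simp [f']) ?_
    intro t k hk
    rw [hPb k hk, hf k hk]
    simp [x0]
  have hm1 : ∀ x, P (τ x, x) ∈ Y1 := fun x => by
    have := hτ1 1 x
    simpa [cl_coe] using this
  have hm2 : ∀ x, P (τ x, x) ∈ Y2 := fun x => by
    have := hτ2 1 x
    simpa [cl_coe] using this
  have hm : ∀ x, (P (τ x, x)).2 ≠ 0 := fun x => snd_ne_of (hm1 x) (hm2 x)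
  let f2 : C(I × K, NZ (ℝ × W)) := ⟨fun q => f' (cl (3 * q.1 - 1), q.2), by fun_prop⟩
  have h2 : f'.HomotopicRel f2 (bd A) := by
    refine hrel_iff.2 ⟨⟨fun q => f' (cl ((1 - q.1) * q.2.1 + q.1 * cl (3 * q.2.1 - 1)), q.2.2),
      by fun_prop⟩, fun k => by simp [cl_coe], fun k => by simp [cl_coe, f2], ?_⟩
    rintro t ⟨u, k⟩ (h | h | h)
    · have : u = 0 := h
      subst this
      simp [cl_of_le (show (-1 : ℝ) ≤ 0 by norm_num)]
    · have : u = 1 := h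
      subst this
      simp [cl_of_ge (show (1 : ℝ) ≤ 3 - 1 by norm_num)]
    · exact Subtype.ext ((bA _ _ h).trans (bA _ _ h).symm)
  let f3 : C(I × K, NZ (ℝ × W)) := ⟨fun q => ⟨LL w0 (P (τ q.2, q.2)) (P (τ q.2, q.2))
      (P (τ q.2, q.2)) q.1, LL_ne hw (hm1 _) (hm2 _) (hPne _) (fun _ => rfl) (fun _ => rfl)⟩,
    (LL_cont (by fun_prop) (by fun_prop) (by fun_prop) (by fun_prop) (fun q => hm1 _)
      (fun q => hm2 _)).subtype_mk _⟩
  have h3 : f2.HomotopicRel f3 (bd A) := by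
    refine hrel_sub (fun q => LL w0 (P (cl (q.1 * τ q.2.2), q.2.2))
      (P (cl (q.1 * τ q.2.2 + cl (3 * q.2.1 - 1) * (1 - q.1)), q.2.2))
      (P (cl (1 - q.1 + q.1 * τ q.2.2), q.2.2)) q.2.1)
      (LL_cont (by fun_prop) (by fun_prop) (by fun_prop) (by fun_prop) (fun q => hτ1 _ _)
        (fun q => hτ2 _ _)) (fun q => LL_ne hw (hτ1 _ _) (hτ2 _ _) (hPne _) ?_ ?_) ?_ ?_ ?_
    · intro h
      rw [cl_of_le (t := 3 * (q.2.1 : ℝ) - 1) (by linarith)]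
      simp
    · intro h
      rw [cl_of_ge (t := 3 * (q.2.1 : ℝ) - 1) (by linarith)]
      congr 3
      simp
      ring
    · intro k
      simp [cl_coe, b0, b1, LL_base, f2, f']
    · intro k
      simp [cl_coe, f3]
    · have e1 : ∀ k ∈ bd A, (f2 k).1 = (0, w0) := by
        rintro ⟨u, k⟩ (h | h | h)
        · have : u = 0 := h
          subst this
          simp [f2, f', cl_of_le (show (-1 : ℝ) ≤ 0 by norm_num), b0]
        · have : u = 1 := h
          subst this
          simp [f2, f', cl_of_ge (show (1 : ℝ) ≤ 3 - 1 by norm_num), b1]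
        · exact bA _ _ h
      intro t k hk
      rw [e1 k hk]
      obtain ⟨u, k⟩ := k
      rcases hk with h | h | h
      · have : u = 0 := h
        subst this
        simp [cl_of_le (show (-1 : ℝ) ≤ 0 by norm_num), LL_at0]
      · have : u = 1 := h
        subst this
        have : (t : ℝ) * τ k + (1 - t) = 1 - t + t * τ k := by ring
        simp [cl_of_ge (show (1 : ℝ) ≤ 3 - 1 by norm_num), this, LL_at1]
      · have h' : k ∈ A := h
        simp only [bA _ _ h', LL_base]
  let g : C(K, NZ W) := ⟨fun x => ⟨(P (τ x, x)).2, hm x⟩, by fun_prop⟩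
  have hg : ∀ a ∈ A, g a = ⟨w0, hw⟩ := fun a ha => Subtype.ext (by simp [g, bA _ _ ha])
  refine ⟨g, hg, ((h1.trans h2).trans h3).trans ?_⟩
  refine hrel_sub (fun q => LL w0 ((1 - q.1) * (P (τ q.2.2, q.2.2)).1, (P (τ q.2.2, q.2.2)).2)
      ((1 - q.1) * (P (τ q.2.2, q.2.2)).1, (P (τ q.2.2, q.2.2)).2)
      ((1 - q.1) * (P (τ q.2.2, q.2.2)).1, (P (τ q.2.2, q.2.2)).2) q.2.1)
      (LL_cont (by fun_prop) (by fun_prop) (by fun_prop) (by fun_prop) (fun q => mem_Y1_of (hm _))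
        (fun q => mem_Y2_of (hm _))) (fun q => LL_ne hw (mem_Y1_of (hm _)) (mem_Y2_of (hm _))
        (fun h => hm _ (congrArg Prod.snd h)) (fun _ => rfl) (fun _ => rfl)) ?_ ?_ ?_
  · intro k
    simp [f3]
  · intro k
    simp [Sus_apply, g]
  · rintro t ⟨u, k⟩ (h | h | h)
    · have : u = 0 := h
      subst this
      simp [f3, LL_at0]
    · have : u = 1 := h
      subst this
      simp [f3, LL_at1]
    · have h' : k ∈ A := h
      simp [f3, bA _ _ h']

theorem LL_Y1 (hw : w0 ≠ 0) {w : W} (h : w ≠ 0) {t : ℝ} (ht : t ≤ 2/3) :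
    LL w0 (0, w) (0, w) (0, w) t ∈ Y1 := by
  rcases le_total t (1/3) with h' | h'
  · rw [LL_left h']
    set u : ℝ := 1 - (cl (3 * t) : ℝ)
    have hu0 : 0 ≤ u := by have := (cl (3 * t)).2.2; simp only [u]; linarith
    have hu1 : u ≤ 1 := by have := (cl (3 * t)).2.1; simp only [u]; linarith
    by_contra hn
    obtain ⟨h1, h2⟩ := not_mem_Y1 hn
    refine C1_ne hw (mem_Y1_of (y := (0, w)) h) hu0 hu1 (Prod.ext (le_antisymm h2 ?_) h1)
    simp [D1]
    have := kk_nonneg (w0 := w0) ((0 : ℝ), w)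
    have : 0 ≤ 1 - u := by linarith
    positivity
  · rw [LL_mid h' ht]
    exact mem_Y1_of h

theorem LL_Y2 (hw : w0 ≠ 0) {w : W} (h : w ≠ 0) {t : ℝ} (ht : 1/3 ≤ t) :
    LL w0 (0, w) (0, w) (0, w) t ∈ Y2 := by
  rcases le_total (2/3) t with h' | h'
  · rw [LL_right h']
    set u : ℝ := (cl (3 * t - 2) : ℝ)
    have hu0 : 0 ≤ u := (cl (3 * t - 2)).2.1
    have hu1 : u ≤ 1 := (cl (3 * t - 2)).2.2
    by_contra hn
    obtain ⟨h1, h2⟩ := not_mem_Y2 hn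
    refine C2_ne hw (mem_Y2_of (y := (0, w)) h) hu0 hu1 (Prod.ext (le_antisymm ?_ h2) h1)
    simp [D2]
    have := kk_nonneg (w0 := w0) ((0 : ℝ), w)
    have : 0 ≤ 1 - u := by linarith
    positivity
  · rw [LL_mid ht h']
    exact mem_Y2_of h

theorem norm_pr {y z : ℝ × W} {ε : ℝ} (h : ‖y - z‖ ≤ ε) : |y.1 - z.1| ≤ ε ∧ ‖y.2 - z.2‖ ≤ ε :=
  ⟨(norm_fst_le (y - z)).trans h, (norm_snd_le (y - z)).trans h⟩

theorem Y1_near {y z : ℝ × W} {ε : ℝ} (h : ‖y - z‖ ≤ ε) (hz : 2 * ε < ‖z.2‖ + max z.1 0) :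
    y ∈ Y1 := by
  obtain ⟨h1, h2⟩ := norm_pr h
  show 0 < ‖y.2‖ + max y.1 0
  have h3 := norm_sub_norm_le z.2 y.2
  rw [norm_sub_rev] at h3
  have h4 := abs_le.1 h1
  have h5 : max z.1 0 ≤ max y.1 0 + ε := by
    have := le_max_left y.1 0
    have := le_max_right y.1 0
    have := (abs_nonneg _).trans h1
    exact max_le (by linarith) (by linarith)
  linarith

theorem Y2_near {y z : ℝ × W} {ε : ℝ} (h : ‖y - z‖ ≤ ε) (hz : 2 * ε < ‖z.2‖ + max (-z.1) 0) :
    y ∈ Y2 := by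
  refine Y1_near (y := (-y.1, y.2)) (z := (-z.1, z.2)) (ε := ε) ?_ hz
  obtain ⟨h1, h2⟩ := norm_pr h
  refine max_le ?_ h2
  show ‖(-y.1) - (-z.1)‖ ≤ ε
  rw [neg_sub_neg, norm_sub_rev]
  exact h1

theorem injS {m : ℕ} (hm : m + 3 < 2 * Module.finrank ℝ W) (e : K ≃ₜ (Fin m → I)) (hw : w0 ≠ 0)
    (g : C(K, NZ W)) (hg : ∀ a ∈ A, g a = ⟨w0, hw⟩)
    (h : (Sus hw g).HomotopicRel (ContinuousMap.const _ (x0 hw)) (bd A)) :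
    g.HomotopicRel (ContinuousMap.const _ ⟨w0, hw⟩) A := by
  obtain ⟨H, h0, h1, h2⟩ := hrel_iff.1 h
  replace h2 : ∀ t, ∀ a ∈ bd A, H (t, a) = x0 hw := fun t a ha => by
    rw [h2 t a ha, Sus_bd hw g hg a ha]
  let Φ : C(I × (I × K), ℝ × W) := ⟨fun q => (H (cl (2 * q.2.1 - 1),
    (cl (1/2 + (q.1 - 1/2) * cl (2 * q.2.1)), q.2.2))).1, by fun_prop⟩
  have Φa : ∀ t s k, Φ (t, (s, k)) = (H (cl (2 * s - 1),
    (cl (1/2 + (t - 1/2) * cl (2 * s)), k))).1 := fun _ _ _ => rfl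
  have a1 : ∀ x, Φ (0, x) ∈ Y1 := by
    rintro ⟨s, k⟩
    rw [Φa]
    rcases le_total (s : ℝ) (1/2) with hs | hs
    · rw [cl_of_le (t := 2 * (s : ℝ) - 1) (by linarith), h0, Sus_apply,
        coe_cl (t := 2 * (s : ℝ)) (by linarith [s.2.1]) (by linarith)]
      refine LL_Y1 hw (g k).2 ?_
      have := s.2.1
      simp only [Set.Icc.coe_zero]
      rw [coe_cl (by linarith) (by linarith)]
      linarith
    · rw [cl_of_ge (t := 2 * (s : ℝ)) (by linarith), h2 _ _ (Or.inl (by simp))]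
      exact mem_Y1_of hw
  have a2 : ∀ x, Φ (1, x) ∈ Y2 := by
    rintro ⟨s, k⟩
    rw [Φa]
    rcases le_total (s : ℝ) (1/2) with hs | hs
    · rw [cl_of_le (t := 2 * (s : ℝ) - 1) (by linarith), h0, Sus_apply,
        coe_cl (t := 2 * (s : ℝ)) (by linarith [s.2.1]) (by linarith)]
      refine LL_Y2 hw (g k).2 ?_
      have := s.2.1
      simp only [Set.Icc.coe_one]
      rw [coe_cl (by linarith) (by linarith)]
      linarith
    · rw [cl_of_ge (t := 2 * (s : ℝ)) (by linarith), h2 _ _ (Or.inr (Or.inl (by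
        simp only [Set.Icc.coe_one]; exact cl_of_ge (by norm_num))))]
      exact mem_Y2_of hw
  obtain ⟨ε1, e1p, e1⟩ := exists_eps (h := fun x => ‖(Φ (0, x)).2‖ + max (Φ (0, x)).1 0)
    (by fun_prop) a1
  obtain ⟨ε2, e2p, e2⟩ := exists_eps (h := fun x => ‖(Φ (1, x)).2‖ + max (-(Φ (1, x)).1) 0)
    (by fun_prop) a2
  obtain ⟨ε3, e3p, e3⟩ := exists_eps (h := fun x => ‖Φ x‖) (by fun_prop)
    (fun x => norm_pos_iff.2 (H _).2)
  obtain ⟨ε4, e4p, e4⟩ := exists_eps (h := fun x => ‖(g x).1‖) (by fun_prop)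
    (fun x => norm_pos_iff.2 (g x).2)
  obtain ⟨ε, hε, f1, f2, f3, f4⟩ : ∃ ε : ℝ, 0 < ε ∧ 2 * ε ≤ ε1 ∧ 2 * ε ≤ ε2 ∧ ε ≤ ε3 ∧ ε ≤ ε4 := by
    refine ⟨min (min (ε1/2) (ε2/2)) (min ε3 ε4), by positivity, ?_, ?_, ?_, ?_⟩
    · have := (min_le_left (min (ε1/2) (ε2/2)) (min ε3 ε4)).trans (min_le_left _ _); linarith
    · have := (min_le_left (min (ε1/2) (ε2/2)) (min ε3 ε4)).trans (min_le_right _ _); linarith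
    · exact (min_le_right _ _).trans (min_le_left _ _)
    · exact (min_le_right _ _).trans (min_le_right _ _)
  let e' : (I × K) ≃ₜ (Fin (m + 1) → I) := ((Homeomorph.refl I).prodCongr e).trans (consH m)
  obtain ⟨P, hP1, hP2, hP3⟩ := gp (m := m + 1) (by omega) e' Φ w0 hw ε hε
  have hPne : ∀ q, P q ≠ 0 := fun q => by
    have := segment_ne (hP1 q) (f3.trans_lt (e3 q)) 1
    simpa using this
  obtain ⟨τ, hτ1, hτ2⟩ := shrink P hP2 hPne
    (fun x => Y1_near (hP1 _) (f1.trans_lt (e1 x))) (fun x => Y2_near (hP1 _) (f2.trans_lt (e2 x)))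
  have hm : ∀ x, (P (τ x, x)).2 ≠ 0 := fun x => snd_ne_of
    (by have := hτ1 1 x; simpa [cl_coe] using this) (by have := hτ2 1 x; simpa [cl_coe] using this)
  have bA : ∀ t s, ∀ k ∈ A, P (t, (s, k)) = (0, w0) := fun t s k hk => hP3 _ (by
    rw [Φa, h2 _ _ (Or.inr (Or.inr hk))]; rfl)
  have hΦ0 : ∀ t k, Φ (t, (0, k)) = (0, (g k).1) := by
    intro t k
    rw [Φa]
    simp only [Set.Icc.coe_zero, mul_zero, cl_zero, add_zero, zero_sub]
    rw [cl_of_le (by norm_num), h0, Sus_apply, coe_cl (by norm_num) (by norm_num)]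
    exact LL_mid (by norm_num) (by norm_num) _ _ _
  have hP0 : ∀ t k, ‖(P (t, (0, k))).2 - (g k).1‖ ≤ ε := by
    intro t k
    have := (norm_pr (hP1 (t, (0, k)))).2
    rwa [hΦ0] at this
  let g0 : C(K, NZ W) := ⟨fun k => ⟨(P (τ (0, k), (0, k))).2, hm _⟩, by fun_prop⟩
  have h3 : g.HomotopicRel g0 A := by
    refine hrel_sub (fun q => (g q.2).1 + (q.1 : ℝ) • ((P (τ (0, q.2), (0, q.2))).2 - (g q.2).1))
      (by fun_prop) (fun q => segment_ne (hP0 _ _) (f4.trans_lt (e4 _)) _) (fun k => by simp)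
      (fun k => by simp [g0]) ?_
    intro t k hk
    rw [bA _ _ _ hk, hg k hk]
    simp
  refine h3.trans (hrel_sub (fun q => (P (τ q, q)).2) (by fun_prop) (fun q => hm q)
    (fun k => rfl) ?_ ?_)
  · intro k
    have : P (τ (1, k), (1, k)) = (0, w0) := hP3 _ (by
      rw [Φa]
      simp only [Set.Icc.coe_one]
      rw [cl_of_ge (t := 2 * 1 - 1) (by norm_num), h1]; rfl)
    rw [this]; rfl
  · intro t k hk
    rw [bA _ _ _ hk]
    simp [g0, bA _ _ _ hk]

/-- suspension of loops -/
def SE (hw : w0 ≠ 0) (f : LP A (⟨w0, hw⟩ : NZ W)) : LP (bd A) (x0 hw) :=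
  ⟨(Sus hw f.1).comp swp, fun a ha => Sus_bd hw f.1 f.2 _ (swp_bd a ha)⟩

theorem SE_cat (hw : w0 ≠ 0) (f g : LP A (⟨w0, hw⟩ : NZ W)) :
    SE hw (f.cat g) = (SE hw f).cat (SE hw g) := by
  refine Subtype.ext (ContinuousMap.ext fun q => ?_)
  refine Eq.trans ?_ (LP.cat_apply _ _ _).symm
  obtain ⟨s, t, k⟩ := q
  refine Subtype.ext ?_
  show LL w0 (0, ((f.cat g).1 (s, k)).1) (0, ((f.cat g).1 (s, k)).1)
        (0, ((f.cat g).1 (s, k)).1) t = _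
  rw [LP.cat_apply]
  simp only
  split_ifs <;> rfl

theorem gIso_sus {m : ℕ} (hm : m + 4 < 2 * Module.finrank ℝ W) (e : K ≃ₜ (Fin m → I)) (hw : w0 ≠ 0) :
    GIso A (⟨w0, hw⟩ : NZ W) (bd A) (x0 hw) := by
  let e' : (I × K) ≃ₜ (Fin (m + 1) → I) := ((Homeomorph.refl I).prodCongr e).trans (consH m)
  refine ⟨SE hw, ?_, ?_, ?_, ?_⟩
  · intro f g h
    exact hrel_precomp (Sus_hom hw f.2 h) swp swp_bd
  · intro f g
    rw [SE_cat]
    exact LP.Hom.rfl' _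
  · intro f h
    refine injS (m := m + 1) (by omega) e' hw f.1 f.2 ?_
    exact hrel_precomp h swp swp_bd
  · intro g
    obtain ⟨f, hf, hh⟩ := surjS (m := m + 1) (by omega) e' hw (g.1.comp swp)
      (fun a ha => g.2 _ (swp_bd a ha))
    exact ⟨⟨f, hf⟩, (hrel_precomp hh swp swp_bd).symm⟩

theorem triv_sus {m : ℕ} (hm : m + 2 < 2 * Module.finrank ℝ W) (e : K ≃ₜ (Fin m → I)) (hw : w0 ≠ 0)
    (h : Triv K A (NZ W) ⟨w0, hw⟩) : Triv (I × K) (bd A) (NZ (ℝ × W)) (x0 hw) := by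
  intro f hf
  obtain ⟨g, hg, hfg⟩ := surjS hm e hw f hf
  refine hfg.trans ?_
  have := Sus_hom hw hg (h g hg)
  rwa [Sus_const] at this
end
end BQ

namespace BQ
open scoped unitInterval Topology.Homotopy
open ContinuousMap
set_option linter.unusedSectionVars false

/-! ### Spheres -/
section
variable {V W : Type} [NormedAddCommGroup V] [NormedSpace ℝ V] [NormedAddCommGroup W]
  [NormedSpace ℝ W]

/-- linear equivalences act on nonzero vectors -/
def nzH (L : V ≃L[ℝ] W) : NZ V ≃ₜ NZ W where
  toFun v := ⟨L v.1, by simpa using v.2⟩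
  invFun v := ⟨L.symm v.1, by simpa using v.2⟩
  left_inv v := by simp
  right_inv v := by simp
  continuous_toFun := by fun_prop
  continuous_invFun := by fun_prop

theorem exists_nzH [FiniteDimensional ℝ V] [FiniteDimensional ℝ W]
    (h : Module.finrank ℝ V = Module.finrank ℝ W) (v : NZ V) (w : NZ W) :
    ∃ e : NZ V ≃ₜ NZ W, e v = w := by
  let L := ContinuousLinearEquiv.ofFinrankEq h
  obtain ⟨M, hM⟩ := SeparatingDual.exists_continuousLinearEquiv_apply_eq (R := ℝ) (nzH L v).2 w.2
  exact ⟨nzH (L.trans M), Subtype.ext hM⟩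

end

theorem conn (k : ℕ) : ∀ (V : Type) [NormedAddCommGroup V] [NormedSpace ℝ V] [FiniteDimensional ℝ V],
    k + 2 ≤ Module.finrank ℝ V → ∀ v : NZ V, TrivN k (NZ V) v := by
  induction k with
  | zero =>
    intro V _ _ _ hV v f hf
    have h1 : 1 < Module.rank ℝ V := by
      rw [← Module.finrank_eq_rank]
      exact_mod_cast (show 1 < Module.finrank ℝ V by omega)
    have h2 := isPathConnected_compl_singleton_of_one_lt_rank h1 (0 : V)
    have h3 : IsPathConnected {x : V | x ≠ 0} := h2
    rw [isPathConnected_iff_pathConnectedSpace] at h3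
    let k0 : Fin 0 → I := fun i => i.elim0
    obtain ⟨γ⟩ : Joined (f k0 : NZ V) v := h3.joined (f k0) v
    refine hrel_iff.2 ⟨⟨fun q => γ q.1, by fun_prop⟩, fun k => ?_, fun k => ?_, ?_⟩
    · have : k = k0 := Subsingleton.elim _ _
      simp [this]
    · simp
    · rintro t k ⟨i, _⟩
      exact i.elim0
  | succ k ih =>
    intro V _ _ _ hV v
    obtain ⟨d, hd⟩ : ∃ d, Module.finrank ℝ V = d + 1 := ⟨Module.finrank ℝ V - 1, by omega⟩
    let W := Fin d → ℝ
    have hW : Module.finrank ℝ W = d := by simp [W]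
    let w0 : W := fun _ => 1
    have hw : w0 ≠ 0 := fun h => by
      have := congrFun h ⟨0, by omega⟩
      exact one_ne_zero this
    obtain ⟨e, he⟩ := exists_nzH (V := V) (W := ℝ × W) (by
      rw [Module.finrank_prod, Module.finrank_self, hW, hd, add_comm]) v (x0 hw)
    refine triv_hom e he ?_
    have := triv_sus (m := k) (by rw [hW]; omega) (Homeomorph.refl _) hw (ih W (by rw [hW]; omega) _)
    exact (trivN_succ k).2 this

/-! ### Hopf -/
/-- the radius -/
def hr (b : ℝ × ℂ) : ℝ := √(b.1 ^ 2 + Complex.normSq b.2)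

theorem hr_sq (b : ℝ × ℂ) : hr b ^ 2 = b.1 ^ 2 + b.2.re * b.2.re + b.2.im * b.2.im := by
  rw [hr, Real.sq_sqrt (by have := Complex.normSq_nonneg b.2; positivity), Complex.normSq_apply]
  ring
theorem hr_nonneg (b : ℝ × ℂ) : 0 ≤ hr b := Real.sqrt_nonneg _

theorem hr_cont : Continuous hr := by
  unfold hr
  have := Complex.continuous_normSq
  fun_prop

/-- the Hopf map, formula -/
def hopfF (e : ℂ × ℂ) : ℝ × ℂ :=
  (Complex.normSq e.1 - Complex.normSq e.2, 2 * (e.1 * (starRingEnd ℂ) e.2))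

theorem hopfF_cont : Continuous hopfF := by
  unfold hopfF
  have := Complex.continuous_normSq
  have := Complex.continuous_conj
  fun_prop

theorem hr_hopfF (e : ℂ × ℂ) : hr (hopfF e) = Complex.normSq e.1 + Complex.normSq e.2 := by
  have h1 := Complex.normSq_nonneg e.1
  have h2 := Complex.normSq_nonneg e.2
  have h := hr_sq (hopfF e)
  have h3 := hr_nonneg (hopfF e)
  rw [← sq_eq_sq₀ h3 (by positivity), h]
  simp [hopfF, Complex.normSq_apply]
  ring

theorem hr_pos {b : ℝ × ℂ} (hb : b ≠ 0) : 0 < hr b := by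
  rcases (hr_nonneg b).lt_or_eq with h | h
  · exact h
  · exfalso
    have := hr_sq b
    rw [← h] at this
    apply hb
    refine Prod.ext ?_ (Complex.ext ?_ ?_) <;> simp <;> nlinarith [sq_nonneg b.1, mul_self_nonneg b.2.re, mul_self_nonneg b.2.im]

theorem hopfF_ne {e : ℂ × ℂ} (he : e ≠ 0) : hopfF e ≠ 0 := by
  intro h
  have := hr_hopfF e
  rw [h] at this
  have h0 : hr 0 = 0 := by simp [hr]
  rw [h0] at this
  have h1 := Complex.normSq_nonneg e.1
  have h2 := Complex.normSq_nonneg e.2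
  exact he (Prod.ext (Complex.normSq_eq_zero.1 (by linarith)) (Complex.normSq_eq_zero.1 (by linarith)))

/-- the Hopf map -/
def hopf : C(NZ (ℂ × ℂ), NZ (ℝ × ℂ)) := ⟨fun e => ⟨hopfF e.1, hopfF_ne e.2⟩,
  (hopfF_cont.comp continuous_subtype_val).subtype_mk _⟩

/-- pairing -/
def hN (a b : ℝ × ℂ) : ℝ := hr a * hr b + a.1 * b.1 + a.2.re * b.2.re + a.2.im * b.2.im

theorem hN_cont {T : Type} [TopologicalSpace T] {a b : T → ℝ × ℂ} (ha : Continuous a)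
    (hb : Continuous b) : Continuous fun t => hN (a t) (b t) := by
  unfold hN
  have := hr_cont
  fun_prop

/-- transport for the Hopf map -/
def hS (e : ℂ × ℂ) (b : ℝ × ℂ) : ℂ × ℂ :=
  ((√(2 * hN (hopfF e) b))⁻¹ : ℝ) • (((hr b + b.1 : ℝ) : ℂ) * e.1 + b.2 * e.2,
    (starRingEnd ℂ) b.2 * e.1 + ((hr b - b.1 : ℝ) : ℂ) * e.2)

theorem hS_p {e : ℂ × ℂ} {b : ℝ × ℂ} (h : 0 < hN (hopfF e) b) : hopfF (hS e b) = b := by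
  rw [hS]
  obtain ⟨D, hD⟩ : ∃ D : ℝ, D = √(2 * hN (hopfF e) b) := ⟨_, rfl⟩
  have hDp : 0 < D := hD ▸ Real.sqrt_pos.2 (by linarith)
  have hD2 : D ^ 2 = 2 * hN (hopfF e) b := hD ▸ Real.sq_sqrt (by linarith)
  rw [← hD]
  have hr2 := hr_sq b
  have hD0 : D ≠ 0 := hDp.ne'
  have hh := hr_hopfF e
  rw [hN, hh] at hD2
  simp only [hopfF, Complex.normSq_apply] at hD2
  simp at hD2
  have k1 : D⁻¹ ^ 2 * D ^ 2 = 1 := by rw [inv_pow]; field_simp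
  have key : ∀ x y : ℝ, x = D ^ 2 * y → D⁻¹ ^ 2 * x = y := fun x y hxy => by
    rw [hxy, ← mul_assoc, k1, one_mul]
  refine Prod.ext ?_ (Complex.ext ?_ ?_)
  · simp only [hopfF, Complex.normSq_apply]
    simp
    refine Eq.trans ?_ (key (((hr b + b.1) * e.1.re + (b.2.re * e.2.re - b.2.im * e.2.im)) ^ 2
        + ((hr b + b.1) * e.1.im + (b.2.re * e.2.im + b.2.im * e.2.re)) ^ 2
        - ((b.2.re * e.1.re + b.2.im * e.1.im) + (hr b - b.1) * e.2.re) ^ 2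
        - ((b.2.re * e.1.im - b.2.im * e.1.re) + (hr b - b.1) * e.2.im) ^ 2) _ ?_)
    · ring
    · rw [hD2]
      linear_combination (e.1.re ^ 2 + e.1.im ^ 2 - e.2.re ^ 2 - e.2.im ^ 2) * hr2
  · simp only [hopfF]
    simp
    refine Eq.trans ?_ (key (2 * (
      ((hr b + b.1) * e.1.re + (b.2.re * e.2.re - b.2.im * e.2.im)) *
       ((b.2.re * e.1.re + b.2.im * e.1.im) + (hr b - b.1) * e.2.re) +
       ((hr b + b.1) * e.1.im + (b.2.re * e.2.im + b.2.im * e.2.re)) *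
       ((b.2.re * e.1.im - b.2.im * e.1.re) + (hr b - b.1) * e.2.im))) _ ?_)
    · ring
    · rw [hD2]
      linear_combination (2 * (e.1.re * e.2.re + e.1.im * e.2.im)) * hr2
  · simp only [hopfF]
    simp
    refine Eq.trans ?_ (key (2 * (
      -((hr b + b.1) * e.1.re + (b.2.re * e.2.re - b.2.im * e.2.im)) *
       ((b.2.re * e.1.im - b.2.im * e.1.re) + (hr b - b.1) * e.2.im) +
       ((hr b + b.1) * e.1.im + (b.2.re * e.2.im + b.2.im * e.2.re)) *
       ((b.2.re * e.1.re + b.2.im * e.1.im) + (hr b - b.1) * e.2.re))) _ ?_)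
    · ring
    · rw [hD2]
      linear_combination (2 * (e.1.im * e.2.re - e.1.re * e.2.im)) * hr2

theorem hN_self (b : ℝ × ℂ) : hN b b = 2 * hr b ^ 2 := by
  have := hr_sq b
  rw [hN]; linarith

theorem hS_self {e : ℂ × ℂ} (he : e ≠ 0) : hS e (hopfF e) = e := by
  have hp := hr_pos (hopfF_ne he)
  have h1 : √(2 * hN (hopfF e) (hopfF e)) = 2 * hr (hopfF e) := by
    rw [hN_self, show 2 * (2 * hr (hopfF e) ^ 2) = (2 * hr (hopfF e)) ^ 2 by ring,
      Real.sqrt_sq (by positivity)]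
  rw [hS, h1, inv_smul_eq_iff₀ (by positivity), hr_hopfF]
  refine Prod.ext (Complex.ext ?_ ?_) (Complex.ext ?_ ?_) <;>
    simp [hopfF, Complex.normSq_apply] <;> ring

theorem regFib_hopf : RegFib hopf := by
  classical
  refine regFib_of_transport hopf {x | 0 < hN x.1.1 x.2.1} ?_ ?_
    (fun e b => if h : 0 < hN (hopfF e.1) b.1 then ⟨hS e.1 b.1, fun h0 => b.2 (by
      rw [← hS_p h, h0]; simp [hopfF])⟩ else e) ?_ ?_ ?_
  · exact isOpen_lt continuous_const (hN_cont (by fun_prop) (by fun_prop))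
  · intro b
    show 0 < hN b.1 b.1
    rw [hN_self]
    have := hr_pos b.2
    positivity
  · rw [continuousOn_iff_continuous_domRestrict]
    refine Topology.IsInducing.subtypeVal.continuous_iff.2 ?_
    have : Continuous fun x : {x : NZ (ℂ × ℂ) × NZ (ℝ × ℂ) | (hopf x.1, x.2) ∈
        {x : NZ (ℝ × ℂ) × NZ (ℝ × ℂ) | 0 < hN x.1.1 x.2.1}} => hS x.1.1.1 x.1.2.1 := by
      unfold hS
      have h1 := Complex.continuous_conj
      have h2 := hr_cont
      have h3 : Continuous fun x : {x : NZ (ℂ × ℂ) × NZ (ℝ × ℂ) | (hopf x.1, x.2) ∈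
        {x : NZ (ℝ × ℂ) × NZ (ℝ × ℂ) | 0 < hN x.1.1 x.2.1}} =>
          (√(2 * hN (hopfF x.1.1.1) x.1.2.1))⁻¹ := by
        refine Continuous.inv₀ ?_ ?_
        · have := hN_cont (T := {x : NZ (ℂ × ℂ) × NZ (ℝ × ℂ) | (hopf x.1, x.2) ∈
            {x : NZ (ℝ × ℂ) × NZ (ℝ × ℂ) | 0 < hN x.1.1 x.2.1}})
            (a := fun x => hopfF x.1.1.1) (b := fun x => x.1.2.1)
            (hopfF_cont.comp (by fun_prop)) (by fun_prop)
          fun_prop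
        · rintro ⟨x, hx⟩
          have hx' : 0 < hN (hopfF x.1.1) x.2.1 := hx
          exact (Real.sqrt_pos.2 (by linarith)).ne'
      fun_prop
    convert this using 2 with x
    have hx : 0 < hN (hopfF x.1.1.1) x.1.2.1 := x.2
    simp [hx]
  · intro e b h
    have hx : 0 < hN (hopfF e.1) b.1 := h
    rw [dif_pos hx]
    exact Subtype.ext (hS_p hx)
  · intro e
    have hx : 0 < hN (hopfF e.1) (hopf e).1 := by
      show 0 < hN (hopfF e.1) (hopfF e.1)
      rw [hN_self]
      have := hr_pos (hopfF_ne e.2)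
      positivity
    rw [dif_pos hx]
    exact Subtype.ext (hS_self e.2)

/-- base point -/
def he0 : NZ (ℂ × ℂ) := ⟨(1, 0), by simp⟩

theorem hfib (e : Fib hopf (hopf he0)) : e.1.1.2 = 0 ∧ ‖e.1.1.1‖ = 1 := by
  have h : hopfF e.1.1 = hopfF (1, 0) := congrArg Subtype.val e.2
  have h1 := congrArg Prod.fst h
  have h2 := congrArg Prod.snd h
  simp [hopfF] at h1 h2
  have h3 : e.1.1.2 = 0 := by
    rcases h2 with h2 | h2
    · rw [h2] at h1
      simp at h1
      have := Complex.normSq_nonneg e.1.1.2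
      linarith
    · exact h2
  refine ⟨h3, ?_⟩
  rw [h3] at h1
  simp [Complex.normSq_eq_norm_sq] at h1
  rcases h1 with h1 | h1
  · exact h1
  · have := norm_nonneg e.1.1.1
    linarith

/-- the fibre of the Hopf map -/
def hfibH : Fib hopf (hopf he0) ≃ₜ Circle where
  toFun e := ⟨e.1.1.1, mem_sphere_zero_iff_norm.2 (hfib e).2⟩
  invFun z := ⟨⟨((z : ℂ), 0), by simp⟩, Subtype.ext (by
    simp [hopf, hopfF, he0])⟩
  left_inv e := by
    refine Subtype.ext (Subtype.ext (Prod.ext rfl ?_))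
    exact (hfib e).1.symm
  right_inv z := rfl
  continuous_toFun := by fun_prop
  continuous_invFun := by fun_prop

theorem gIso_cons {n : ℕ} {X : Type} [TopologicalSpace X] (x : X) : GIso (cb (n+1)) x (bd (cb n)) x :=
  gIso_homeo (consH n).symm fun k => by
    rw [← consH_bd, (consH n).apply_symm_apply]
theorem gIso_cons' {n : ℕ} {X : Type} [TopologicalSpace X] (x : X) : GIso (bd (cb n)) x (cb (n+1)) x :=
  gIso_homeo (consH n) (consH_bd n)

theorem pi2_hopf : Nonempty ((π_ (1+1)) (NZ (ℝ × ℂ)) (hopf he0) ≃* Multiplicative ℤ) := by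
  have h1 : GIso (bd (cb 0)) (hopf he0) (cb 0) (⟨he0, rfl⟩ : Fib hopf (hopf he0)) :=
    gIso_bdry regFib_hopf he0 ((trivN_succ 0).1 (conn 1 _ (by simp) _))
      ((trivN_succ2 0).1 (conn 2 _ (by simp) _))
  have h2 : GIso (cb 0) (⟨he0, rfl⟩ : Fib hopf (hopf he0)) (cb 0) (1 : Circle) :=
    gIso_hom hfibH (Subtype.ext rfl)
  obtain ⟨a⟩ := mkIso (((gIso_cons _).trans h1).trans h2)
  obtain ⟨b⟩ := pi1_circle
  exact ⟨a.trans b⟩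

theorem pi4_nz5 (V : Type) [NormedAddCommGroup V] [NormedSpace ℝ V] [FiniteDimensional ℝ V]
    (hV : Module.finrank ℝ V = 5) (v : NZ V) :
    Nonempty ((π_ (3+1)) (NZ V) v ≃* Multiplicative ℤ) := by
  have hw := (hopf he0).2
  have h1 : GIso (cb 1) (hopf he0) (cb 2) (x0 hw) :=
    (gIso_sus (m := 1) (by simp) (Homeomorph.refl _) hw).trans (gIso_cons' _)
  have h2 : GIso (cb 2) (x0 hw) (cb 3) (x0 (x0 hw).2) :=
    (gIso_sus (m := 2) (by simp) (Homeomorph.refl _) (x0 hw).2).trans (gIso_cons' _)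
  obtain ⟨e, he⟩ := exists_nzH (V := V) (W := ℝ × (ℝ × (ℝ × ℂ))) (by simp [hV]) v (x0 (x0 hw).2)
  obtain ⟨a⟩ := mkIso (h1.trans h2)
  obtain ⟨b⟩ := mkIso (n := 3) (m := 3) (gIso_hom e he)
  obtain ⟨c⟩ := pi2_hopf
  exact ⟨b.trans (a.symm.trans c)⟩
end BQ

namespace BQ
open scoped unitInterval Topology.Homotopy
open ContinuousMap
set_option linter.unusedSectionVars false

/-! ### Fibrations of quotients -/
section quot

theorem quot_eq {X : Type} {r : X → X → Prop} (hr : Equivalence r) {a b : X} :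
    Quot.mk r a = Quot.mk r b ↔ r a b :=
  ⟨fun h => hr.eqvGen_iff.1 (Quot.eqvGen_exact h), fun h => Quot.sound h⟩

theorem isOpenQuotientMap_mk {X : Type} [TopologicalSpace X] {r : X → X → Prop}
    (hr : Equivalence r)
    (h : ∀ a b, r a b → ∃ φ : X → X, Continuous φ ∧ φ b = a ∧ ∀ y, r (φ y) y) :
    IsOpenQuotientMap (Quot.mk r) := by
  refine ⟨Quot.mk_surjective, continuous_quot_mk, ?_⟩
  intro U hU
  have hq : Topology.IsQuotientMap (Quot.mk r) := isQuotientMap_quot_mk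
  rw [← hq.isOpen_preimage, isOpen_iff_mem_nhds]
  rintro b ⟨a, haU, hab⟩
  have hab' : r a b := (quot_eq hr).1 hab
  obtain ⟨φ, hφ, hb, hy⟩ := h a b hab'
  have : φ ⁻¹' U ∈ 𝓝 b := hφ.continuousAt.preimage_mem_nhds (by rw [hb]; exact hU.mem_nhds haU)
  filter_upwards [this] with y hyU
  exact ⟨φ y, hyU, Quot.sound (hy y)⟩

theorem regFib_quot {E' E B' B : Type} [TopologicalSpace E'] [TopologicalSpace E]
    [TopologicalSpace B'] [TopologicalSpace B] {qE : E' → E} {qB : B' → B}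
    (hE : IsOpenQuotientMap qE) (hB : IsOpenQuotientMap qB) (p : C(E, B)) (p' : E' → B')
    (hp : ∀ e, p (qE e) = qB (p' e)) (U : Set (B' × B')) (hUo : IsOpen U)
    (hUd : ∀ b, (b, b) ∈ U)
    (hUs : ∀ a b a' b', qB a = qB a' → qB b = qB b' → (a, b) ∈ U → (a', b') ∈ U)
    (s' : E' → B' → E')
    (hs : ∀ e b, (p' e, b) ∈ U → ContinuousAt (fun x : E' × B' => s' x.1 x.2) (e, b))
    (hsq : ∀ e b e' b', qE e = qE e' → qB b = qB b' → (p' e, b) ∈ U →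
      qE (s' e b) = qE (s' e' b'))
    (hps : ∀ e b, (p' e, b) ∈ U → qB (p' (s' e b)) = qB b)
    (hse : ∀ e, qE (s' e (p' e)) = qE e) : RegFib p := by
  let rE : E → E' := Function.surjInv hE.surjective
  let rB : B → B' := Function.surjInv hB.surjective
  have hrE : ∀ e, qE (rE e) = e := Function.surjInv_eq hE.surjective
  have hrB : ∀ e, qB (rB e) = e := Function.surjInv_eq hB.surjective
  have hEB := hE.prodMap hB
  have hBB := hB.prodMap hB
  have key : ∀ a b, (qB a, qB b) ∈ Prod.map qB qB '' U ↔ (a, b) ∈ U := by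
    intro a b
    constructor
    · rintro ⟨⟨a', b'⟩, h, h'⟩
      obtain ⟨h1, h2⟩ := Prod.mk.inj h'
      exact hUs _ _ _ _ h1 h2 h
    · intro h
      exact ⟨(a, b), h, rfl⟩
  refine regFib_of_transport p (Prod.map qB qB '' U) (hBB.isOpenMap _ hUo) ?_
    (fun e b => qE (s' (rE e) (rB b))) ?_ ?_ ?_
  · intro b
    rw [← hrB b, key]
    exact hUd _
  · rintro ⟨e, b⟩ h
    apply ContinuousAt.continuousWithinAt
    obtain ⟨e, rfl⟩ := hE.surjective e
    obtain ⟨b, rfl⟩ := hB.surjective b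
    have hm : (p' e, b) ∈ U := by
      rw [← key, ← hp]; exact h
    have : (qE e, qB b) = Prod.map qE qB (e, b) := rfl
    rw [this, ← hEB.continuousAt_comp_iff]
    have hc : ContinuousAt (fun x : E' × B' => qE (s' x.1 x.2)) (e, b) :=
      hE.continuous.continuousAt.comp (hs e b hm)
    refine hc.congr ?_
    have hpc : Continuous (fun x : E' × B' => (qB (p' x.1), qB x.2)) := by
      simp_rw [← hp]
      exact ((p.continuous.comp (hE.continuous.comp continuous_fst))).prodMk
        (hB.continuous.comp continuous_snd)
    have hop : IsOpen ((fun x : E' × B' => (qB (p' x.1), qB x.2)) ⁻¹' (Prod.map qB qB '' U)) :=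
      (hBB.isOpenMap _ hUo).preimage hpc
    have hmem := hop.mem_nhds (show (e, b) ∈ _ from (key _ _).2 hm)
    filter_upwards [hmem] with x hx
    exact hsq _ _ _ _ (hrE _).symm (hrB _).symm ((key _ _).1 hx)
  · intro e b h
    show p (qE (s' (rE e) (rB b))) = b
    rw [hp, hps, hrB]
    rw [← key, ← hp, hrE, hrB]; exact h
  · intro e
    show qE (s' (rE e) (rB (p e))) = e
    have h : qB (p' (rE e)) = p e := by rw [← hp, hrE]
    rw [← hsq (rE e) (p' (rE e)) (rE e) (rB (p e)) rfl (by rw [h, hrB]) (hUd _), hse, hrE]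
end quot

/-! ### Spheres for a gauge -/
section gauge
variable {V : Type} [NormedAddCommGroup V] [NormedSpace ℝ V] {ρ : V → ℝ}

/-- A continuous positively homogeneous gauge -/
structure Gauge (ρ : V → ℝ) : Prop where
  cont : Continuous ρ
  hom : ∀ (t : ℝ) v, 0 < t → ρ (t • v) = t * ρ v
  pos : ∀ v, v ≠ 0 → 0 < ρ v

/-- the unit sphere of a gauge -/
abbrev GS (ρ : V → ℝ) : Type := {v : V // ρ v = 1}

theorem Gauge.zero (h : Gauge ρ) : ρ 0 = 0 := by
  have := h.hom 2 0 (by norm_num)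
  simp at this
  linarith

def gsIn (h : Gauge ρ) : C(GS ρ, NZ V) :=
  ⟨fun v => ⟨v.1, fun h0 => by have := v.2; rw [h0, h.zero] at this; norm_num at this⟩, by fun_prop⟩

def gsOut (h : Gauge ρ) : C(NZ V, GS ρ) :=
  ⟨fun v => ⟨(ρ v.1)⁻¹ • v.1, by
    rw [h.hom _ _ (inv_pos.2 (h.pos _ v.2)), inv_mul_cancel₀ (h.pos _ v.2).ne']⟩, by
    have := h.cont
    refine Continuous.subtype_mk ?_ _
    refine Continuous.smul (Continuous.inv₀ (by fun_prop) fun v => (h.pos _ v.2).ne') (by fun_prop)⟩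

theorem gs_out_in (h : Gauge ρ) (v : GS ρ) : gsOut h (gsIn h v) = v := by
  apply Subtype.ext
  show (ρ v.1)⁻¹ • v.1 = v.1
  rw [v.2]; simp

theorem gs_hom (h : Gauge ρ) (v : GS ρ) :
    (ContinuousMap.id (NZ V)).HomotopicRel ((gsIn h).comp (gsOut h)) {gsIn h v} := by
  have hpos : ∀ q : I × NZ V, 0 < 1 - (q.1 : ℝ) + q.1 * (ρ q.2.1)⁻¹ := by
    rintro ⟨t, w⟩
    have h1 := inv_pos.2 (h.pos _ w.2)
    have h2 := t.2.1
    have h3 := t.2.2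
    dsimp only
    rcases h2.eq_or_lt with h4 | h4
    · rw [← h4]; norm_num
    · have := mul_pos h4 h1
      linarith
  refine hrel_sub (fun q => (1 - (q.1 : ℝ) + q.1 * (ρ q.2.1)⁻¹) • q.2.1) ?_ ?_ ?_ ?_ ?_
  · have := h.cont
    have h2 : Continuous fun q : I × NZ V => (ρ q.2.1)⁻¹ :=
      Continuous.inv₀ (by fun_prop) fun v => (h.pos _ v.2.2).ne'
    fun_prop
  · intro q
    exact smul_ne_zero (hpos q).ne' q.2.2
  · intro k; simp
  · intro k; simp [gsIn, gsOut]
  · rintro t k rfl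
    have : ρ (gsIn h v).1 = 1 := v.2
    simp [this]

variable {K : Type} [TopologicalSpace K] [CompactSpace K] {A : Set K}

theorem gIso_gs (h : Gauge ρ) (v : GS ρ) : GIso A v A (gsIn h v) := by
  refine gIso_hequiv (gsIn h) (gsOut h) rfl (gs_out_in h v) ?_ (gs_hom h v)
  have : (gsOut h).comp (gsIn h) = ContinuousMap.id _ := ContinuousMap.ext (gs_out_in h)
  rw [this]
  exact ContinuousMap.HomotopicRel.refl _

theorem triv_gs (h : Gauge ρ) (v : GS ρ) (hT : Triv K A (NZ V) (gsIn h v)) : Triv K A (GS ρ) v := by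
  refine triv_retract (gsIn h) (gsOut h) rfl (gs_out_in h v) ?_ hT
  have : (gsOut h).comp (gsIn h) = ContinuousMap.id _ := ContinuousMap.ext (gs_out_in h)
  rw [this]
  exact ContinuousMap.HomotopicRel.refl _

end gauge

end BQ

namespace BQ
open scoped unitInterval Topology.Homotopy
open ContinuousMap
open scoped Matrix
set_option linter.unusedSectionVars false

/-! ### Geometry of the biquotient -/

abbrev M33 : Type := Matrix (Fin 3) (Fin 3) ℍ[ℝ]
abbrev M31 : Type := Matrix (Fin 3) (Fin 1) ℍ[ℝ]

theorem qstar_mul_self (q : ℍ[ℝ]) : star q * q = ((‖q‖ ^ 2 : ℝ) : ℍ[ℝ]) := by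
  rw [Quaternion.star_mul_self, Quaternion.normSq_eq_norm_mul_self, sq]
theorem qself_mul_star (q : ℍ[ℝ]) : q * star q = ((‖q‖ ^ 2 : ℝ) : ℍ[ℝ]) := by
  rw [Quaternion.self_mul_star, Quaternion.normSq_eq_norm_mul_self, sq]

/-- scalar matrices -/
def Z (ζ : ℂ) : M33 := Matrix.diagonal fun _ => (ζ : ℍ[ℝ])

theorem Z_mul (a b : ℂ) : Z a * Z b = Z (a * b) := by
  simp [Z, Matrix.diagonal_mul_diagonal]
theorem Z_one : Z 1 = 1 := by
  simp [Z]
theorem star_coe (a : ℂ) : star (a : ℍ[ℝ]) = ((starRingEnd ℂ a : ℂ) : ℍ[ℝ]) := by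
  ext <;> simp
theorem Z_star (a : ℂ) : star (Z a) = Z (starRingEnd ℂ a) := by
  rw [Matrix.star_eq_conjTranspose, Z, Z, Matrix.diagonal_conjTranspose]
  congr 1
  funext i
  exact star_coe a
theorem norm_coeC (c : ℂ) : ‖(c : ℍ[ℝ])‖ = ‖c‖ := by
  have h : ‖(c : ℍ[ℝ])‖ ^ 2 = ‖c‖ ^ 2 := by
    rw [sq, ← Quaternion.normSq_eq_norm_mul_self, Quaternion.normSq_def', ← Complex.normSq_eq_norm_sq,
      Complex.normSq_apply]
    simp
    ring
  exact (pow_left_inj₀ (norm_nonneg _) (norm_nonneg _) two_ne_zero).1 h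
theorem continuous_coeC : Continuous (fun c : ℂ => (c : ℍ[ℝ])) := by
  have := Quaternion.ofComplex.toLinearMap.continuous_of_finiteDimensional
  exact this
theorem continuous_Z : Continuous Z := by
  unfold Z
  refine Continuous.matrix_diagonal ?_
  exact continuous_pi fun _ => continuous_coeC

theorem circle_conj_mul (ζ : Circle) : starRingEnd ℂ (ζ : ℂ) * ζ = 1 := by
  rw [← Circle.coe_inv_eq_conj, ← Circle.coe_mul]; simp
theorem circle_mul_conj (ζ : Circle) : (ζ : ℂ) * starRingEnd ℂ (ζ : ℂ) = 1 := by
  rw [mul_comm, circle_conj_mul]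

theorem continuous_circle_coe : Continuous (fun ζ : Circle => (ζ : ℂ)) := by fun_prop

/-- complex numbers of norm one -/
def mkC (c : ℂ) (h : ‖c‖ = 1) : Circle := ⟨c, mem_sphere_zero_iff_norm.2 h⟩
theorem mkC_coe (c : ℂ) (h : ‖c‖ = 1) : (mkC c h : ℂ) = c := rfl

/-- scalar matrices as elements of `Sp 3` -/
def Zu (ζ : Circle) : Sp3 := ⟨Z ζ, by
  rw [Unitary.mem_iff, Z_star, Z_mul, Z_mul, circle_conj_mul, circle_mul_conj, Z_one]
  exact ⟨rfl, rfl⟩⟩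

theorem Zu_val (ζ : Circle) : (Zu ζ).val = Z ζ := rfl
theorem Zu_mul (a b : Circle) : Zu a * Zu b = Zu (a * b) := by
  apply Subtype.ext
  show Z a * Z b = Z (a * b : Circle)
  rw [Z_mul, Circle.coe_mul]
theorem Zu_one : Zu 1 = 1 := Subtype.ext (by show Z (1 : Circle) = 1; rw [Circle.coe_one, Z_one])
theorem Zu_inv (a : Circle) : (Zu a)⁻¹ = Zu a⁻¹ := by
  rw [inv_eq_iff_mul_eq_one, Zu_mul, mul_inv_cancel, Zu_one]
theorem continuous_Zu : Continuous Zu :=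
  (continuous_Z.comp continuous_circle_coe).subtype_mk _

/-- the subgroup `Sp(1)²` -/
def IsH (h : Sp3) : Prop := ∃ q₁ q₂ : ℍ[ℝ], ‖q₁‖ = 1 ∧ ‖q₂‖ = 1 ∧
      h.val = Matrix.diagonal ![q₁, 1, q₂]

theorem isH_one : IsH 1 := ⟨1, 1, by simp, by simp, by
  show (1 : M33) = _
  apply Matrix.ext; intro i j; fin_cases i <;> fin_cases j <;> simp [Matrix.diagonal]⟩
theorem isH_mul {a b : Sp3} (ha : IsH a) (hb : IsH b) : IsH (a * b) := by
  obtain ⟨p, q, hp, hq, h⟩ := ha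
  obtain ⟨p', q', hp', hq', h'⟩ := hb
  refine ⟨p * p', q * q', by simp [hp, hp'], by simp [hq, hq'], ?_⟩
  show a.val * b.val = _
  rw [h, h', Matrix.diagonal_mul_diagonal]
  congr 1
  funext i
  fin_cases i <;> simp
theorem isH_inv {a : Sp3} (ha : IsH a) : IsH a⁻¹ := by
  obtain ⟨p, q, hp, hq, h⟩ := ha
  refine ⟨star p, star q, by simp [hp], by simp [hq], ?_⟩
  show star a.val = _
  rw [h, Matrix.star_eq_conjTranspose, Matrix.diagonal_conjTranspose]
  congr 1
  funext i
  fin_cases i <;> simp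

theorem rrel_iff (g g' : Sp3) : RRel g g' ↔ ∃ ζ : Circle, ∃ h : Sp3, IsH h ∧ g' = Zu ζ * g * h⁻¹ := by
  constructor
  · rintro ⟨a, h, ⟨z, hz, hJ, hK, ha⟩, hh, e⟩
    have hzn : ‖(⟨z.re, z.imI⟩ : ℂ)‖ = 1 := by
      have h1 : ‖z‖ ^ 2 = 1 := by rw [hz]; norm_num
      rw [sq, ← Quaternion.normSq_eq_norm_mul_self, Quaternion.normSq_def', hJ, hK] at h1
      have h2 : ‖(⟨z.re, z.imI⟩ : ℂ)‖ ^ 2 = 1 := by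
        rw [← Complex.normSq_eq_norm_sq, Complex.normSq_mk]; linarith
      nlinarith [norm_nonneg (⟨z.re, z.imI⟩ : ℂ)]
    refine ⟨mkC ⟨z.re, z.imI⟩ hzn, h, hh, ?_⟩
    rw [e]
    congr 2
    apply Subtype.ext
    rw [ha, Zu_val, Z, mkC_coe]
    congr 1
    funext i
    have : z = ((⟨z.re, z.imI⟩ : ℂ) : ℍ[ℝ]) := by
      ext <;> simp [hJ, hK]
    fin_cases i <;> exact this
  · rintro ⟨ζ, h, hh, e⟩
    refine ⟨Zu ζ, h, ⟨((ζ : ℂ) : ℍ[ℝ]), ?_, by simp, by simp, ?_⟩, hh, e⟩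
    · have h2 : ‖((ζ : ℂ) : ℍ[ℝ])‖ = ‖(ζ : ℂ)‖ := norm_coeC _
      rw [h2, Circle.norm_coe]
    · rw [Zu_val, Z]
      congr 1
      funext i
      fin_cases i <;> rfl

theorem rrel_equiv : Equivalence RRel where
  refl g := (rrel_iff _ _).2 ⟨1, 1, isH_one, by rw [Zu_one]; simp⟩
  symm := by
    intro g g' h
    rw [rrel_iff] at *
    obtain ⟨ζ, h, hh, rfl⟩ := h
    exact ⟨ζ⁻¹, h⁻¹, isH_inv hh, by rw [← Zu_inv]; group⟩
  trans := by
    intro g g' g'' h h'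
    rw [rrel_iff] at *
    obtain ⟨ζ, h, hh, rfl⟩ := h
    obtain ⟨ζ', h', hh', rfl⟩ := h'
    exact ⟨ζ' * ζ, h' * h, isH_mul hh' hh, by rw [← Zu_mul]; group⟩

theorem oq_R : IsOpenQuotientMap (Quot.mk RRel) := by
  refine isOpenQuotientMap_mk rrel_equiv ?_
  intro a b hab
  obtain ⟨ζ, h, hh, rfl⟩ := (rrel_iff _ _).1 hab
  refine ⟨fun y => (Zu ζ)⁻¹ * y * h,
    (continuous_const.mul continuous_id).mul continuous_const, by group, fun y => ?_⟩
  exact (rrel_iff _ _).2 ⟨ζ, h, hh, by group⟩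

/-! ### The Stiefel manifold -/

/-- unit columns -/
abbrev StE : Type := {V : M31 // Vᴴ * V = 1}

/-- action on unit columns -/
def act (g : Sp3) (V : StE) : StE := ⟨g.val * V.1, by
  rw [Matrix.conjTranspose_mul, Matrix.mul_assoc, ← Matrix.mul_assoc _ g.val V.1,
    ← Matrix.star_eq_conjTranspose g.val, Unitary.coe_star_mul_self, Matrix.one_mul, V.2]⟩

theorem act_val (g : Sp3) (V : StE) : (act g V).1 = g.val * V.1 := rfl
theorem act_mul (g g' : Sp3) (V : StE) : act (g * g') V = act g (act g' V) :=
  Subtype.ext (Matrix.mul_assoc _ _ _)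
theorem act_one (V : StE) : act 1 V = V := Subtype.ext (Matrix.one_mul _)
theorem continuous_act : Continuous (fun x : Sp3 × StE => act x.1 x.2) := by
  refine Continuous.subtype_mk ?_ _
  exact Continuous.matrix_mul (by fun_prop) (by fun_prop)

/-- second basis vector -/
def e1 : StE := ⟨Matrix.of fun i _ => if i = 1 then 1 else 0, by
  apply Matrix.ext; intro i j
  fin_cases i; fin_cases j
  simp [Matrix.mul_apply, Fin.sum_univ_three]⟩

def mid (g : Sp3) : StE := act g e1
theorem mid_apply (g : Sp3) (i : Fin 3) : (mid g).1 i 0 = g.val i 1 := by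
  show (g.val * e1.1) i 0 = _
  simp [Matrix.mul_apply, Fin.sum_univ_three, e1]
theorem mid_mul (g g' : Sp3) : mid (g * g') = act g (mid g') := act_mul _ _ _
theorem continuous_mid : Continuous mid :=
  continuous_act.comp (by fun_prop : Continuous fun g : Sp3 => (g, e1))
theorem act_h {h : Sp3} (hh : IsH h) : act h e1 = e1 := by
  obtain ⟨p, q, hp, hq, e⟩ := hh
  apply Subtype.ext
  rw [act_val, e]
  apply Matrix.ext; intro i j
  fin_cases i <;> simp [e1]

/-- circle orbits of columns -/
def BRel (V V' : StE) : Prop := ∃ ζ : Circle, V' = act (Zu ζ) V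

abbrev BB : Type := Quot BRel

theorem brel_equiv : Equivalence BRel where
  refl V := ⟨1, by rw [Zu_one, act_one]⟩
  symm := by
    rintro V _ ⟨ζ, rfl⟩
    exact ⟨ζ⁻¹, by rw [← act_mul, Zu_mul, inv_mul_cancel, Zu_one, act_one]⟩
  trans := by
    rintro V _ _ ⟨ζ, rfl⟩ ⟨ζ', rfl⟩
    exact ⟨ζ' * ζ, by rw [← act_mul, Zu_mul]⟩

theorem continuous_act' (g : Sp3) : Continuous (act g) :=
  continuous_act.comp (by fun_prop : Continuous fun V : StE => (g, V))

theorem oq_B : IsOpenQuotientMap (Quot.mk BRel) := by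
  refine isOpenQuotientMap_mk brel_equiv ?_
  rintro a _ ⟨ζ, rfl⟩
  refine ⟨act (Zu ζ⁻¹), continuous_act' _, ?_, fun y => ⟨ζ, ?_⟩⟩
  · rw [← act_mul, Zu_mul, inv_mul_cancel, Zu_one, act_one]
  · rw [← act_mul, Zu_mul, mul_inv_cancel, Zu_one, act_one]

/-- The projection of the biquotient to the base -/
def prR : C(R₂, BB) := ⟨Quot.lift (fun g => Quot.mk BRel (mid g)) (by
    intro g g' h
    obtain ⟨ζ, h, hh, rfl⟩ := (rrel_iff _ _).1 h
    refine Quot.sound ⟨ζ, ?_⟩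
    rw [mid_mul, mid, act_h (isH_inv hh), act_mul]; rfl),
  continuous_quot_lift _ (continuous_quot_mk.comp continuous_mid)⟩

end BQ

namespace BQ
open scoped unitInterval Topology.Homotopy
open ContinuousMap
open scoped Matrix
set_option linter.unusedSectionVars false

/-! ### The complex pairing and the circle bundle -/

/-- complex part of a quaternion -/
def cpx (q : ℍ[ℝ]) : ℂ := ⟨q.re, q.imI⟩

theorem cpx_mul_left (c : ℂ) (q : ℍ[ℝ]) : cpx (c * q) = c * cpx q := by
  apply Complex.ext <;> simp [cpx]
theorem cpx_mul_right (q : ℍ[ℝ]) (c : ℂ) : cpx (q * c) = cpx q * c := by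
  apply Complex.ext <;> simp [cpx]
theorem cpx_add (q r : ℍ[ℝ]) : cpx (q + r) = cpx q + cpx r := by
  apply Complex.ext <;> simp [cpx]
theorem continuous_cpx : Continuous cpx := by
  have h : ∀ q, cpx q = (q.re : ℂ) + (q.imI : ℂ) * Complex.I := fun q => by
    apply Complex.ext <;> simp [cpx]
  have := Quaternion.continuous_re
  have := Quaternion.continuous_imI
  rw [show cpx = _ from funext h]
  fun_prop

/-- complex pairing of two columns -/
def cc (x y : M31) : ℂ := cpx (∑ k, x k 0 * star (y k 0))

theorem Z_mul_apply (z : ℂ) (x : M31) (k : Fin 3) : (Z z * x) k 0 = z * x k 0 := by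
  rw [Z, Matrix.diagonal_mul]

theorem cc_left (z : ℂ) (x y : M31) : cc (Z z * x) y = z * cc x y := by
  unfold cc
  simp_rw [Z_mul_apply]
  rw [← cpx_mul_left, Finset.mul_sum]
  simp_rw [mul_assoc]
theorem cc_right (z : ℂ) (x y : M31) : cc x (Z z * y) = cc x y * starRingEnd ℂ z := by
  unfold cc
  simp_rw [Z_mul_apply, star_mul, star_coe]
  rw [← cpx_mul_right, Finset.sum_mul]
  simp_rw [mul_assoc]
theorem continuous_cc : Continuous (fun x : M31 × M31 => cc x.1 x.2) := by
  unfold cc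
  refine continuous_cpx.comp ?_
  refine continuous_finsetSum _ fun k _ => Continuous.mul ?_ ?_
  · exact (continuous_apply_apply k 0).comp continuous_fst
  · exact ((continuous_apply_apply k 0).comp continuous_snd).star

theorem qsum3 (f : Fin 3 → ℝ) : ((∑ k, f k : ℝ) : ℍ[ℝ]) = ∑ k, (f k : ℍ[ℝ]) := by
  simp [Fin.sum_univ_three]

theorem stE_sum (V : StE) : ∑ k, ‖V.1 k 0‖ ^ 2 = 1 := by
  have h := congrArg (fun M : Matrix (Fin 1) (Fin 1) ℍ[ℝ] => (M 0 0).re) V.2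
  simp only [Matrix.mul_apply, Matrix.conjTranspose_apply, qstar_mul_self] at h
  rw [← qsum3] at h
  simpa using h

theorem cc_self (V : StE) : cc V.1 V.1 = 1 := by
  unfold cc
  simp_rw [qself_mul_star]
  have := stE_sum V
  have h2 : (∑ k, ((‖V.1 k 0‖ ^ 2 : ℝ) : ℍ[ℝ])) = ((1 : ℝ) : ℍ[ℝ]) := by
    rw [← this, qsum3]
  rw [h2]
  apply Complex.ext <;> simp [cpx]

theorem cc_re (u v : M31) : (cc u v).re = ((vᴴ * u) 0 0).re := by
  unfold cc cpx
  simp only [Matrix.mul_apply, Matrix.conjTranspose_apply, Fin.sum_univ_three]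
  simp
  ring

/-- the pairing on unit columns -/
def cE (u v : StE) : ℂ := cc u.1 v.1
theorem cE_left (z : Circle) (u v : StE) : cE (act (Zu z) u) v = z * cE u v := cc_left _ _ _
theorem cE_right (z : Circle) (u v : StE) : cE u (act (Zu z) v) = cE u v * starRingEnd ℂ (z : ℂ) :=
  cc_right _ _ _
theorem cE_self (u : StE) : cE u u = 1 := cc_self u
theorem continuous_cE : Continuous (fun x : StE × StE => cE x.1 x.2) :=
  continuous_cc.comp (by fun_prop : Continuous fun x : StE × StE => (x.1.1, x.2.1))

theorem continuous_cE' (v : StE) {X : Type} [TopologicalSpace X] {f : X → StE} (hf : Continuous f) :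
    Continuous (fun x => cE (f x) v) :=
  continuous_cE.comp (f := fun x => (f x, v)) (hf.prodMk continuous_const)
theorem continuous_actZ (v : StE) : Continuous (fun z : Circle => act (Zu z) v) :=
  continuous_act.comp (f := fun z : Circle => (Zu z, v)) (continuous_Zu.prodMk continuous_const)

/-- phase of a complex number -/
def ph (c : ℂ) : Circle := if h : c = 0 then 1 else mkC (c / ‖c‖) (by
  rw [norm_div, Complex.norm_real, norm_norm, div_self (norm_ne_zero_iff.2 h)])

theorem ph_coe {c : ℂ} (h : c ≠ 0) : (ph c : ℂ) = c / ‖c‖ := by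
  rw [ph, dif_neg h, mkC_coe]

theorem ph_circle (z : Circle) : ph z = z := by
  have h : (ph z : ℂ) = z := by
    rw [ph_coe (Circle.coe_ne_zero z), Circle.norm_coe]; simp
  exact Circle.ext h

theorem ph_one : ph 1 = 1 := by
  rw [← Circle.coe_one, ph_circle]

theorem ph_mul {c : ℂ} (h : c ≠ 0) (z w : Circle) :
    ph (z * c * starRingEnd ℂ (w : ℂ)) = z * ph c * w⁻¹ := by
  have h1 : (starRingEnd ℂ (w : ℂ)) ≠ 0 := by simp
  have h2 : (z * c * starRingEnd ℂ (w : ℂ)) ≠ 0 :=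
    mul_ne_zero (mul_ne_zero (Circle.coe_ne_zero z) h) h1
  apply Circle.ext
  rw [ph_coe h2, Circle.coe_mul, Circle.coe_mul, ph_coe h, Circle.coe_inv_eq_conj]
  simp only [norm_mul, Circle.norm_coe, RCLike.norm_conj, one_mul, mul_one]
  ring

theorem continuousAt_ph {c : ℂ} (h : c ≠ 0) : ContinuousAt ph c := by
  have hI : Topology.IsInducing (fun z : Circle => (z : ℂ)) := Topology.IsInducing.subtypeVal
  rw [hI.continuousAt_iff]
  have h1 : ContinuousAt (fun c : ℂ => c / ‖c‖) c := by
    have : (‖c‖ : ℂ) ≠ 0 := by simpa using h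
    fun_prop (disch := assumption)
  refine h1.congr ?_
  filter_upwards [isOpen_ne.mem_nhds h] with x hx
  exact (ph_coe hx).symm

theorem cE_ph {u v : StE} (h : cE u v ≠ 0) :
    cE u (act (Zu (ph (cE u v))) v) = ‖cE u v‖ := by
  rw [cE_right, ph_coe h, map_div₀, Complex.conj_ofReal, ← mul_div_assoc, Complex.mul_conj,
    Complex.normSq_eq_norm_sq]
  have : (‖cE u v‖ : ℂ) ≠ 0 := by simpa using h
  push_cast
  field_simp

theorem qB_eq {u v : StE} : Quot.mk BRel u = Quot.mk BRel v ↔ ∃ ζ : Circle, v = act (Zu ζ) u :=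
  quot_eq brel_equiv

theorem cE_act (z w : Circle) (u v : StE) :
    cE (act (Zu z) u) (act (Zu w) v) = z * cE u v * starRingEnd ℂ (w : ℂ) := by
  rw [cE_left, cE_right, mul_assoc]

theorem hUs {a b a' b' : StE} (h1 : Quot.mk BRel a = Quot.mk BRel a')
    (h2 : Quot.mk BRel b = Quot.mk BRel b') (h : cE a b ≠ 0) : cE a' b' ≠ 0 := by
  obtain ⟨z, rfl⟩ := qB_eq.1 h1
  obtain ⟨w, rfl⟩ := qB_eq.1 h2
  rw [cE_act]
  refine mul_ne_zero (mul_ne_zero (Circle.coe_ne_zero z) h) ?_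
  simp

/-- aligned representative -/
def ali (u v : StE) : StE := act (Zu (ph (cE u v))) v

theorem ali_act (z w : Circle) {u v : StE} (h : cE u v ≠ 0) :
    ali (act (Zu z) u) (act (Zu w) v) = act (Zu z) (ali u v) := by
  unfold ali
  rw [cE_act, ph_mul h, ← act_mul, ← act_mul, Zu_mul, Zu_mul, inv_mul_cancel_right]

theorem ali_self (u : StE) : ali u u = u := by
  unfold ali
  rw [cE_self, ph_one, Zu_one, act_one]

theorem ali_q (u v : StE) : Quot.mk BRel (ali u v) = Quot.mk BRel v :=
  (Quot.sound ⟨_, rfl⟩ : Quot.mk BRel v = _).symm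

theorem continuousAt_ali {u v : StE} (h : cE u v ≠ 0) :
    ContinuousAt (fun x : StE × StE => ali x.1 x.2) (u, v) := by
  unfold ali
  have h1 : ContinuousAt (fun x : StE × StE => ph (cE x.1 x.2)) (u, v) :=
    ContinuousAt.comp (g := ph) (f := fun x : StE × StE => cE x.1 x.2) (x := (u, v))
      (continuousAt_ph h) continuous_cE.continuousAt
  have h2 : ContinuousAt (fun x : StE × StE => (Zu (ph (cE x.1 x.2)), x.2)) (u, v) :=
    (ContinuousAt.comp (g := Zu) (f := fun x : StE × StE => ph (cE x.1 x.2)) (x := (u, v))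
      continuous_Zu.continuousAt h1).prodMk continuousAt_snd
  exact ContinuousAt.comp (g := fun x : Sp3 × StE => act x.1 x.2)
    (f := fun x : StE × StE => (Zu (ph (cE x.1 x.2)), x.2)) (x := (u, v))
    continuous_act.continuousAt h2

/-- the circle bundle -/
def prE : C(StE, BB) := ⟨Quot.mk BRel, continuous_quot_mk⟩

theorem regFib_prE : RegFib prE := by
  refine regFib_quot (qE := id) (qB := Quot.mk BRel) IsOpenQuotientMap.id oq_B prE id
    (fun _ => rfl) {x | cE x.1 x.2 ≠ 0} (isOpen_ne.preimage continuous_cE) ?_ ?_ ali ?_ ?_ ?_ ?_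
  · intro b
    show cE b b ≠ 0
    rw [cE_self]; exact one_ne_zero
  · intro a b a' b' h1 h2 h
    exact hUs h1 h2 h
  · intro e b h
    exact continuousAt_ali h
  · intro e b e' b' h1 h2 h
    cases h1
    obtain ⟨w, rfl⟩ := qB_eq.1 h2
    have := ali_act 1 w h
    rw [Zu_one, act_one, act_one] at this
    exact this.symm
  · intro e b _
    exact ali_q e b
  · intro e
    exact ali_self e

theorem cE_fib (v : StE) (e : Fib prE (prE v)) : ∃ z : Circle, e.1 = act (Zu z) v := by
  have he : Quot.mk BRel e.1 = Quot.mk BRel v := e.2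
  exact qB_eq.1 he.symm

theorem continuous_fibE (v : StE) : Continuous (fun e : Fib prE (prE v) => ph (cE e.1 v)) := by
  have hc : Continuous (fun e : Fib prE (prE v) => cE e.1 v) :=
    continuous_cE' v continuous_subtype_val
  rw [continuous_iff_continuousAt]
  intro e
  have h : cE e.1 v ≠ 0 := by
    obtain ⟨z, hz⟩ := cE_fib v e
    rw [hz, cE_left, cE_self, mul_one]
    exact Circle.coe_ne_zero z
  exact ContinuousAt.comp (g := ph) (f := fun e : Fib prE (prE v) => cE e.1 v) (x := e)
      (continuousAt_ph h) hc.continuousAt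

/-- the fibre of the circle bundle -/
def fibE (v : StE) : Fib prE (prE v) ≃ₜ Circle where
  toFun e := ph (cE e.1 v)
  invFun z := ⟨act (Zu z) v, (Quot.sound ⟨z, rfl⟩ : Quot.mk BRel v = _).symm⟩
  left_inv := by
    rintro ⟨e, he⟩
    obtain ⟨z, rfl⟩ := qB_eq.1 (show Quot.mk BRel v = Quot.mk BRel e from he.symm)
    apply Subtype.ext
    show act (Zu (ph (cE (act (Zu z) v) v))) v = act (Zu z) v
    rw [cE_left, cE_self, mul_one, ph_circle]
  right_inv := by
    intro z
    show ph (cE (act (Zu z) v) v) = z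
    rw [cE_left, cE_self, mul_one, ph_circle]
  continuous_toFun := continuous_fibE v
  continuous_invFun := by
    refine Continuous.subtype_mk ?_ _
    exact continuous_actZ v

theorem fibE_base (v : StE) : fibE v ⟨v, rfl⟩ = 1 := by
  show ph (cE v v) = 1
  rw [cE_self, ph_one]

/-! ### The Stiefel manifold is a sphere -/

/-- the Euclidean norm on triples of quaternions -/
def rho3 (v : Fin 3 → ℍ[ℝ]) : ℝ := √(∑ k, ‖v k‖ ^ 2)

theorem gauge_rho3 : Gauge rho3 where
  cont := by unfold rho3; fun_prop
  hom := by
    intro t v ht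
    unfold rho3
    simp only [Pi.smul_apply, norm_smul, mul_pow, ← Finset.mul_sum]
    rw [Real.sqrt_mul (by positivity), Real.sqrt_sq (norm_nonneg _), Real.norm_of_nonneg ht.le]
  pos := by
    intro v hv
    obtain ⟨k, hk⟩ := Function.ne_iff.1 hv
    refine Real.sqrt_pos.2 (Finset.sum_pos' (fun _ _ => by positivity) ⟨k, Finset.mem_univ _, ?_⟩)
    have : ‖v k‖ ≠ 0 := norm_ne_zero_iff.2 hk
    positivity

theorem stE_iff (V : M31) : Vᴴ * V = 1 ↔ rho3 (fun k => V k 0) = 1 := by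
  rw [rho3, Real.sqrt_eq_one]
  constructor
  · intro h
    exact stE_sum ⟨V, h⟩
  · intro h
    apply Matrix.ext
    intro i j
    fin_cases i; fin_cases j
    show (Vᴴ * V) 0 0 = (1 : Matrix (Fin 1) (Fin 1) ℍ[ℝ]) 0 0
    simp only [Matrix.mul_apply, Matrix.conjTranspose_apply, qstar_mul_self]
    rw [← qsum3, h]
    simp

/-- unit columns form a sphere -/
def stEH : StE ≃ₜ GS rho3 where
  toFun V := ⟨fun k => V.1 k 0, (stE_iff _).1 V.2⟩
  invFun v := ⟨Matrix.of fun k _ => v.1 k, (stE_iff _).2 v.2⟩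
  left_inv V := by
    apply Subtype.ext
    apply Matrix.ext
    intro i j
    fin_cases j
    rfl
  right_inv v := rfl
  continuous_toFun := by
    refine Continuous.subtype_mk (continuous_pi fun k => ?_) _
    exact (continuous_apply_apply k 0).comp continuous_subtype_val
  continuous_invFun := by
    refine Continuous.subtype_mk (continuous_matrix fun i j => ?_) _
    exact (continuous_apply i).comp continuous_subtype_val

theorem trivN_stE (k : ℕ) (hk : k ≤ 10) (v : StE) : TrivN k StE v := by
  refine triv_hom stEH rfl (triv_gs gauge_rho3 _ (conn k _ ?_ _))
  rw [Module.finrank_pi_fintype]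
  simp [Quaternion.finrank_eq_four]
  omega

theorem trivN_fibE (k : ℕ) (v : StE) : TrivN (k + 2) (Fib prE (prE v)) ⟨v, rfl⟩ :=
  triv_hom (fibE v) (fibE_base v) (triv_circle k)

theorem trivN_BB4 (v : StE) : TrivN 4 BB (prE v) := by
  rw [trivN_succ 3]
  exact triv_base regFib_prE v (trivN_fibE 1 v) ((trivN_succ 3).1 (trivN_stE 4 (by norm_num) v))
theorem trivN_BB5 (v : StE) : TrivN 5 BB (prE v) := by
  rw [trivN_succ 4]
  exact triv_base regFib_prE v (trivN_fibE 2 v) ((trivN_succ 4).1 (trivN_stE 5 (by norm_num) v))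

theorem pi2_BB (v : StE) : Nonempty ((π_ (1 + 1)) BB (prE v) ≃* Multiplicative ℤ) := by
  have h1 : GIso (bd (cb 0)) (prE v) (cb 0) (⟨v, rfl⟩ : Fib prE (prE v)) :=
    gIso_bdry regFib_prE v ((trivN_succ 0).1 (trivN_stE 1 (by norm_num) v))
      ((trivN_succ2 0).1 (trivN_stE 2 (by norm_num) v))
  have h2 : GIso (cb 0) (⟨v, rfl⟩ : Fib prE (prE v)) (cb 0) (1 : Circle) :=
    gIso_hom (fibE v) (fibE_base v)
  obtain ⟨e⟩ := mkIso (((gIso_cons (n := 0) (prE v)).trans h1).trans h2)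
  obtain ⟨f⟩ := pi1_circle
  exact ⟨e.trans f⟩

end BQ

namespace BQ
open scoped unitInterval Topology.Homotopy
open ContinuousMap
open scoped Matrix
set_option linter.unusedSectionVars false

/-! ### Transport in `Sp 3` -/

abbrev M11 : Type := Matrix (Fin 1) (Fin 1) ℍ[ℝ]

/-- inverse of a one by one matrix -/
def inv1 (A : M11) : M11 := Matrix.of fun _ _ => (A 0 0)⁻¹

theorem ext11 {A B : M11} (h : A 0 0 = B 0 0) : A = B := by
  apply Matrix.ext; intro i j
  fin_cases i; fin_cases j; exact h
theorem mul11 (A B : M11) : (A * B) 0 0 = A 0 0 * B 0 0 := by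
  simp [Matrix.mul_apply]
theorem inv1_apply (A : M11) : inv1 A 0 0 = (A 0 0)⁻¹ := rfl

theorem inv1_a (A : M11) : (inv1 A)ᴴ * A * inv1 A = (inv1 A)ᴴ := by
  apply ext11
  rw [mul11, mul11, Matrix.conjTranspose_apply, inv1_apply]
  by_cases h : A 0 0 = 0
  · simp [h]
  · rw [mul_assoc, mul_inv_cancel₀ h, mul_one]
theorem inv1_b (A : M11) : (inv1 A)ᴴ * Aᴴ * inv1 A = inv1 A := by
  apply ext11
  rw [mul11, mul11, Matrix.conjTranspose_apply, Matrix.conjTranspose_apply, inv1_apply]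
  by_cases h : A 0 0 = 0
  · simp [h]
  · rw [← star_mul, mul_inv_cancel₀ h, star_one, one_mul]
theorem inv1_c (A : M11) : inv1 A * A * (inv1 A)ᴴ = (inv1 A)ᴴ := by
  apply ext11
  rw [mul11, mul11, Matrix.conjTranspose_apply, inv1_apply]
  by_cases h : A 0 0 = 0
  · simp [h]
  · rw [inv_mul_cancel₀ h, one_mul]
theorem inv1_d (A : M11) : inv1 A * Aᴴ * (inv1 A)ᴴ = inv1 A := by
  apply ext11
  rw [mul11, mul11, Matrix.conjTranspose_apply, Matrix.conjTranspose_apply, inv1_apply]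
  by_cases h : A 0 0 = 0
  · simp [h]
  · rw [mul_assoc, ← star_mul, inv_mul_cancel₀ h, star_one, mul_one]
theorem inv1_mul (A : M11) (h : A 0 0 ≠ 0) : inv1 A * A = 1 := by
  apply ext11
  rw [mul11, inv1_apply, inv_mul_cancel₀ h]
  simp

def Am (u v : M31) : M11 := 1 + vᴴ * u
def Qm (u v : M31) : M33 := -1 + (u + v) * inv1 (Am u v) * (u + v)ᴴ
def Pm (u : M31) : M33 := u * uᴴ + u * uᴴ - 1

theorem gram (u v : StE) : (u.1 + v.1)ᴴ * (u.1 + v.1) = Am u.1 v.1 + (Am u.1 v.1)ᴴ := by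
  simp only [Am, Matrix.conjTranspose_add, Matrix.add_mul, Matrix.mul_add, u.2, v.2,
    Matrix.conjTranspose_one, Matrix.conjTranspose_mul, Matrix.conjTranspose_conjTranspose]
  abel

theorem Qm_star (u v : M31) : (Qm u v)ᴴ = -1 + (u + v) * (inv1 (Am u v))ᴴ * (u + v)ᴴ := by
  simp only [Qm, Matrix.conjTranspose_add, Matrix.conjTranspose_mul, Matrix.conjTranspose_neg,
    Matrix.conjTranspose_one, Matrix.conjTranspose_conjTranspose, Matrix.mul_assoc]

theorem Q_aux (W : M31) (C D : M11) (h : C * (Wᴴ * W) * D = C + D) :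
    (-1 + W * C * Wᴴ) * (-1 + W * D * Wᴴ) = 1 := by
  have e : (W * C * Wᴴ) * (W * D * Wᴴ) = W * (C * (Wᴴ * W) * D) * Wᴴ := by
    simp only [Matrix.mul_assoc]
  rw [h, Matrix.mul_add, Matrix.add_mul] at e
  rw [add_mul, mul_add, mul_add, e]
  noncomm_ring

theorem Qm_unitary (u v : StE) : Qm u.1 v.1 ∈ unitary M33 := by
  rw [Unitary.mem_iff, Matrix.star_eq_conjTranspose, Qm_star]
  constructor
  · refine Q_aux _ _ _ ?_
    rw [gram, Matrix.mul_add, Matrix.add_mul, inv1_a, inv1_b]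
  · refine Q_aux _ _ _ ?_
    rw [gram, Matrix.mul_add, Matrix.add_mul, inv1_c, inv1_d, add_comm]

theorem Pm_star (u : M31) : (Pm u)ᴴ = Pm u := by
  simp only [Pm, Matrix.conjTranspose_sub, Matrix.conjTranspose_mul, Matrix.conjTranspose_add,
    Matrix.conjTranspose_one, Matrix.conjTranspose_conjTranspose]

theorem Pm_sq (u : StE) : Pm u.1 * Pm u.1 = 1 := by
  have h1 : (u.1 * u.1ᴴ) * (u.1 * u.1ᴴ) = u.1 * u.1ᴴ := by
    rw [Matrix.mul_assoc, ← Matrix.mul_assoc u.1ᴴ, u.2, Matrix.one_mul]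
  unfold Pm
  rw [sub_mul, mul_sub, add_mul, mul_add, h1]
  noncomm_ring

theorem Pm_unitary (u : StE) : Pm u.1 ∈ unitary M33 := by
  rw [Unitary.mem_iff, Matrix.star_eq_conjTranspose, Pm_star]
  exact ⟨Pm_sq u, Pm_sq u⟩

/-- transport matrix -/
def TT (u v : StE) : Sp3 := ⟨Qm u.1 v.1 * Pm u.1, mul_mem (Qm_unitary u v) (Pm_unitary u)⟩

theorem TT_val (u v : StE) : (TT u v).val = Qm u.1 v.1 * Pm u.1 := rfl

theorem Pm_mul (u : StE) : Pm u.1 * u.1 = u.1 := by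
  unfold Pm
  rw [Matrix.sub_mul, Matrix.add_mul, Matrix.mul_assoc, u.2, Matrix.mul_one, Matrix.one_mul,
    add_sub_cancel_right]

theorem TT_act {u v : StE} (h : Am u.1 v.1 0 0 ≠ 0) : act (TT u v) u = v := by
  apply Subtype.ext
  rw [act_val, TT_val, Matrix.mul_assoc, Pm_mul]
  have h1 : (u.1 + v.1)ᴴ * u.1 = Am u.1 v.1 := by
    rw [Matrix.conjTranspose_add, Matrix.add_mul, u.2, Am]
  rw [Qm, Matrix.add_mul, Matrix.mul_assoc, Matrix.mul_assoc, h1, inv1_mul _ h]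
  rw [Matrix.mul_one, Matrix.neg_mul, Matrix.one_mul, neg_add_cancel_left]

theorem TT_self (u : StE) : TT u u = 1 := by
  apply Subtype.ext
  show Qm u.1 u.1 * Pm u.1 = 1
  have hi : inv1 (Am u.1 u.1) + inv1 (Am u.1 u.1) = 1 := by
    apply ext11
    have hx : (1 + 1 : ℍ[ℝ]) ≠ 0 := by
      intro h
      have := congrArg (fun q : ℍ[ℝ] => q.re) h
      simp only [Quaternion.re_add, Quaternion.re_one, Quaternion.re_zero] at this
      norm_num at this
    have h1 := mul_inv_cancel₀ hx
    rw [add_mul, one_mul] at h1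
    rw [Matrix.add_apply, inv1_apply, Am, u.2, Matrix.add_apply, Matrix.one_apply_eq]
    exact h1
  have hQ : Qm u.1 u.1 = Pm u.1 := by
    have e : (u.1 + u.1) * inv1 (Am u.1 u.1) * (u.1 + u.1)ᴴ =
        u.1 * (inv1 (Am u.1 u.1) + inv1 (Am u.1 u.1)) * u.1ᴴ +
        u.1 * (inv1 (Am u.1 u.1) + inv1 (Am u.1 u.1)) * u.1ᴴ := by
      simp only [Matrix.conjTranspose_add, Matrix.add_mul, Matrix.mul_add]
    rw [Qm, e, hi, Matrix.mul_one, Pm]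
    abel
  rw [hQ]
  exact Pm_sq u

theorem Am_act (g : Sp3) (u v : StE) : Am (act g u).1 (act g v).1 = Am u.1 v.1 := by
  unfold Am
  rw [act_val, act_val, Matrix.conjTranspose_mul, Matrix.mul_assoc, ← Matrix.mul_assoc _ g.val u.1,
    ← Matrix.star_eq_conjTranspose g.val, Unitary.coe_star_mul_self, Matrix.one_mul]

theorem TT_conj (g : Sp3) (u v : StE) : TT (act g u) (act g v) = g * TT u v * g⁻¹ := by
  apply Subtype.ext
  have hg : star g.val * g.val = 1 := Unitary.coe_star_mul_self g
  have hg' : g.val * star g.val = 1 := Unitary.coe_mul_star_self g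
  have hQ : Qm (act g u).1 (act g v).1 = g.val * Qm u.1 v.1 * star g.val := by
    rw [Qm, Qm, Am_act, act_val, act_val, ← Matrix.mul_add, Matrix.conjTranspose_mul, mul_add,
      add_mul, mul_neg, mul_one, neg_mul, hg']
    simp only [Matrix.mul_assoc, Matrix.star_eq_conjTranspose]
  have hP : Pm (act g u).1 = g.val * Pm u.1 * star g.val := by
    rw [Pm, Pm, act_val, Matrix.conjTranspose_mul, mul_sub, sub_mul, mul_one, hg', mul_add, add_mul]
    simp only [Matrix.mul_assoc, Matrix.star_eq_conjTranspose]
  show Qm (act g u).1 (act g v).1 * Pm (act g u).1 = g.val * (Qm u.1 v.1 * Pm u.1) * star g.val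
  rw [hQ, hP]
  calc _ = g.val * Qm u.1 v.1 * (star g.val * g.val) * Pm u.1 * star g.val := by
        simp only [mul_assoc]
    _ = _ := by rw [hg, mul_one]; simp only [mul_assoc]

section cat
variable {X : Type} [TopologicalSpace X] {x : X} {l m n : ℕ}

theorem cat_mul {f : X → Matrix (Fin l) (Fin m) ℍ[ℝ]} {g : X → Matrix (Fin m) (Fin n) ℍ[ℝ]}
    (hf : ContinuousAt f x) (hg : ContinuousAt g x) : ContinuousAt (fun y => f y * g y) x := by
  have hm : Continuous (fun x : Matrix (Fin l) (Fin m) ℍ[ℝ] × Matrix (Fin m) (Fin n) ℍ[ℝ] =>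
      x.1 * x.2) := continuous_fst.matrix_mul continuous_snd
  exact ContinuousAt.comp (g := fun x : Matrix (Fin l) (Fin m) ℍ[ℝ] × Matrix (Fin m) (Fin n) ℍ[ℝ] =>
      x.1 * x.2) (f := fun y => (f y, g y)) hm.continuousAt (hf.prodMk hg)

theorem cat_star {f : X → Matrix (Fin l) (Fin m) ℍ[ℝ]}
    (hf : ContinuousAt f x) : ContinuousAt (fun y => (f y)ᴴ) x := by
  have hm : Continuous (fun x : Matrix (Fin l) (Fin m) ℍ[ℝ] => xᴴ) :=
    continuous_id.matrix_conjTranspose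
  exact ContinuousAt.comp (g := fun x : Matrix (Fin l) (Fin m) ℍ[ℝ] => xᴴ) (f := f)
    hm.continuousAt hf

theorem cat_inv1 {f : X → M11} (hf : ContinuousAt f x) (h : f x 0 0 ≠ 0) :
    ContinuousAt (fun y => inv1 (f y)) x := by
  have h0 : ContinuousAt (fun y => f y 0 0) x :=
    ContinuousAt.comp (g := fun A : M11 => A 0 0) (f := f)
      (continuous_apply_apply 0 0).continuousAt hf
  have h1 : ContinuousAt (fun y => (f y 0 0)⁻¹) x := h0.inv₀ h
  exact continuousAt_pi.2 fun _ => continuousAt_pi.2 fun _ => h1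
end cat

theorem continuousAt_TT {u v : StE} (h : Am u.1 v.1 0 0 ≠ 0) :
    ContinuousAt (fun x : StE × StE => TT x.1 x.2) (u, v) := by
  have hI : Topology.IsInducing (fun g : Sp3 => g.val) := Topology.IsInducing.subtypeVal
  rw [hI.continuousAt_iff]
  have c1 : ContinuousAt (fun x : StE × StE => x.1.1) (u, v) :=
    (continuous_subtype_val.comp continuous_fst).continuousAt
  have c2 : ContinuousAt (fun x : StE × StE => x.2.1) (u, v) :=
    (continuous_subtype_val.comp continuous_snd).continuousAt
  have cA : ContinuousAt (fun x : StE × StE => Am x.1.1 x.2.1) (u, v) :=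
    continuousAt_const.add (cat_mul (cat_star c2) c1)
  have cP : ContinuousAt (fun x : StE × StE => Pm x.1.1) (u, v) :=
    ((cat_mul c1 (cat_star c1)).add (cat_mul c1 (cat_star c1))).sub continuousAt_const
  have cW := c1.add c2
  have cQ : ContinuousAt (fun x : StE × StE => Qm x.1.1 x.2.1) (u, v) :=
    continuousAt_const.add (cat_mul (cat_mul cW (cat_inv1 cA h)) (cat_star cW))
  exact cat_mul cQ cP

theorem Am_ali {u v : StE} (h : cE u v ≠ 0) : Am u.1 (ali u v).1 0 0 ≠ 0 := by
  intro h0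
  have h1 := cE_ph h
  have h2 : (cE u (ali u v)).re = ‖cE u v‖ := by
    have := congrArg Complex.re h1
    rw [Complex.ofReal_re] at this
    exact this
  have h3 : (cE u (ali u v)).re = (((ali u v).1ᴴ * u.1) 0 0).re := cc_re _ _
  have h4 : (Am u.1 (ali u v).1 0 0).re = 1 + (((ali u v).1ᴴ * u.1) 0 0).re := by
    simp [Am]
  rw [h0, ← h3, h2] at h4
  have h5 := norm_nonneg (cE u v)
  simp at h4
  linarith

/-- transport in `Sp 3` -/
def tr (g : Sp3) (v : StE) : Sp3 := TT (mid g) (ali (mid g) v) * g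

theorem mid_tr {g : Sp3} {v : StE} (h : cE (mid g) v ≠ 0) : mid (tr g v) = ali (mid g) v := by
  rw [tr, mid_mul, TT_act (Am_ali h)]

theorem mid_h {h : Sp3} (hh : IsH h) (g : Sp3) : mid (g * h⁻¹) = mid g := by
  rw [mid_mul, mid, act_h (isH_inv hh)]; rfl

theorem regFib_prR : RegFib prR := by
  refine regFib_quot (qE := Quot.mk RRel) (qB := Quot.mk BRel) oq_R oq_B prR mid
    (fun _ => rfl) {x | cE x.1 x.2 ≠ 0} (isOpen_ne.preimage continuous_cE) ?_ ?_ tr ?_ ?_ ?_ ?_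
  · intro b
    show cE b b ≠ 0
    rw [cE_self]; exact one_ne_zero
  · intro a b a' b' h1 h2 h
    exact hUs h1 h2 h
  · intro g v h
    have c1 : ContinuousAt (fun x : Sp3 × StE => (mid x.1, x.2)) (g, v) :=
      ((continuous_mid.comp continuous_fst).prodMk continuous_snd).continuousAt
    have c2 : ContinuousAt (fun x : Sp3 × StE => ali (mid x.1) x.2) (g, v) :=
      ContinuousAt.comp (g := fun x : StE × StE => ali x.1 x.2)
        (f := fun x : Sp3 × StE => (mid x.1, x.2)) (x := (g, v)) (continuousAt_ali h) c1
    have c3 : ContinuousAt (fun x : Sp3 × StE => (mid x.1, ali (mid x.1) x.2)) (g, v) :=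
      (continuous_mid.comp continuous_fst).continuousAt.prodMk c2
    have c4 : ContinuousAt (fun x : Sp3 × StE => TT (mid x.1) (ali (mid x.1) x.2)) (g, v) :=
      ContinuousAt.comp (g := fun x : StE × StE => TT x.1 x.2)
        (f := fun x : Sp3 × StE => (mid x.1, ali (mid x.1) x.2)) (x := (g, v))
        (continuousAt_TT (Am_ali h)) c3
    exact c4.mul continuousAt_fst
  · intro g v g' v' h1 h2 h
    obtain ⟨w, rfl⟩ := qB_eq.1 h2
    obtain ⟨z, k, hk, rfl⟩ := (rrel_iff _ _).1 ((quot_eq rrel_equiv).1 h1)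
    apply Quot.sound
    rw [rrel_iff]
    refine ⟨z, k, hk, ?_⟩
    have hm : mid (Zu z * g * k⁻¹) = act (Zu z) (mid g) := by rw [mid_h hk, mid_mul]
    rw [tr, hm, ali_act z w h, TT_conj, tr]
    group
  · intro g v h
    rw [mid_tr h, ali_q]
  · intro g
    rw [tr, ali_self, TT_self, one_mul]

end BQ

namespace BQ
open scoped unitInterval Topology.Homotopy
open ContinuousMap
open scoped Matrix
set_option linter.unusedSectionVars false

/-! ### The fibre of the biquotient over the base -/

theorem cols (K : Sp3) (i j : Fin 3) :
    star (K.val 0 i) * K.val 0 j + star (K.val 1 i) * K.val 1 j + star (K.val 2 i) * K.val 2 j =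
      if i = j then 1 else 0 := by
  have h := congrFun (congrFun (Unitary.coe_star_mul_self K) i) j
  rw [Matrix.mul_apply, Fin.sum_univ_three, Matrix.one_apply] at h
  exact h

theorem col_norm (K : Sp3) (j : Fin 3) :
    ‖K.val 0 j‖ ^ 2 + ‖K.val 1 j‖ ^ 2 + ‖K.val 2 j‖ ^ 2 = 1 := by
  have h := cols K j j
  rw [qstar_mul_self, qstar_mul_self, qstar_mul_self, if_pos rfl, ← Quaternion.coe_add,
    ← Quaternion.coe_add] at h
  have := congrArg (fun q : ℍ[ℝ] => q.re) h
  simp only [Quaternion.re_coe, Quaternion.re_one] at this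
  exact this

theorem entry_le (K : Sp3) (i j : Fin 3) : ‖K.val i j‖ ≤ 1 := by
  have h := col_norm K j
  have h0 := sq_nonneg ‖K.val 0 j‖
  have h1 := sq_nonneg ‖K.val 1 j‖
  have h2 := sq_nonneg ‖K.val 2 j‖
  have h3 : ‖K.val i j‖ ^ 2 ≤ 1 := by
    fin_cases i <;> simp only [Fin.zero_eta, Fin.mk_one, Fin.reduceFinMk] <;> linarith
  exact (sq_le_one_iff₀ (norm_nonneg _)).1 h3

theorem compact_Sp3 : CompactSpace Sp3 := by
  have : ProperSpace ℍ[ℝ] := FiniteDimensional.proper_real _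
  have hb : IsCompact (Set.pi Set.univ fun _ : Fin 3 => Set.pi Set.univ fun _ : Fin 3 =>
      Metric.closedBall (0 : ℍ[ℝ]) 1) :=
    isCompact_univ_pi fun _ => isCompact_univ_pi fun _ => isCompact_closedBall 0 1
  have hcl : IsClosed {A : M33 | star A * A = 1 ∧ A * star A = 1} :=
    (isClosed_eq (continuous_star.mul continuous_id) continuous_const).inter
      (isClosed_eq (continuous_id.mul continuous_star) continuous_const)
  have hs : {A : M33 | star A * A = 1 ∧ A * star A = 1} ⊆
      (Set.pi Set.univ fun _ : Fin 3 => Set.pi Set.univ fun _ : Fin 3 =>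
      Metric.closedBall (0 : ℍ[ℝ]) 1) := by
    intro A hA i _ j _
    rw [mem_closedBall_zero_iff]
    exact entry_le ⟨A, Unitary.mem_iff.2 hA⟩ i j
  have hc : IsCompact {A : M33 | star A * A = 1 ∧ A * star A = 1} := hb.of_isClosed_subset hcl hs
  exact isCompact_iff_compactSpace.1 hc

/-- The Hopf type map -/
def jv (a b : ℍ[ℝ]) : ℝ × ℍ[ℝ] := (‖a‖ ^ 2 - ‖b‖ ^ 2, (2 : ℝ) • (a * star b))

theorem jv_mul (a b p : ℍ[ℝ]) (hp : ‖p‖ = 1) : jv (a * p) (b * p) = jv a b := by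
  unfold jv
  rw [norm_mul, norm_mul, hp, mul_one, mul_one, star_mul, mul_assoc, ← mul_assoc p, qself_mul_star,
    hp, one_pow, Quaternion.coe_one, one_mul]

theorem continuous_jv : Continuous (fun x : ℍ[ℝ] × ℍ[ℝ] => jv x.1 x.2) := by
  unfold jv
  fun_prop

/-- normalized matrix -/
def XX (g0 g : Sp3) : M33 :=
  star g0.val * (Z (starRingEnd ℂ (cE (mid g) (mid g0))) * g.val)

theorem XX_act (g0 g h : Sp3) (z : Circle) (hh : IsH h) :
    XX g0 (Zu z * g * h⁻¹) = XX g0 g * (h⁻¹).val := by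
  unfold XX
  rw [mid_h hh, mid_mul, cE_left, map_mul]
  have e : (Zu z * g * h⁻¹).val = Z z * (g.val * (h⁻¹).val) := by
    rw [mul_assoc]; rfl
  rw [e, mul_comm (starRingEnd ℂ (z : ℂ)), ← mul_assoc (Z _) (Z _), Z_mul, mul_assoc,
    circle_conj_mul, mul_one]
  simp only [mul_assoc]

theorem jv_XX (g0 g h : Sp3) (z : Circle) (hh : IsH h) :
    jv (XX g0 (Zu z * g * h⁻¹) 0 0) (XX g0 (Zu z * g * h⁻¹) 2 0) =
      jv (XX g0 g 0 0) (XX g0 g 2 0) := by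
  rw [XX_act _ _ _ _ hh]
  obtain ⟨p, q, hp, hq, e⟩ := isH_inv hh
  rw [e, Matrix.mul_diagonal, Matrix.mul_diagonal]
  exact jv_mul _ _ _ hp

theorem continuous_XX (g0 : Sp3) : Continuous (XX g0) := by
  unfold XX
  have h1 : Continuous (fun g => cE (mid g) (mid g0)) := continuous_cE' _ continuous_mid
  have h2 : Continuous (fun g : Sp3 => Z (starRingEnd ℂ (cE (mid g) (mid g0)))) :=
    continuous_Z.comp (Complex.continuous_conj.comp h1)
  exact continuous_const.mul (h2.mul continuous_subtype_val)

theorem continuous_entry (i j : Fin 3) : Continuous (fun M : M33 => M i j) :=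
  continuous_apply_apply i j

/-- invariant of a matrix -/
def j0 (g0 g : Sp3) : ℝ × ℍ[ℝ] := jv (XX g0 g 0 0) (XX g0 g 2 0)

theorem continuous_j0 (g0 : Sp3) : Continuous (j0 g0) := by
  have h0 : Continuous (fun g => XX g0 g 0 0) := (continuous_entry 0 0).comp (continuous_XX g0)
  have h2 : Continuous (fun g => XX g0 g 2 0) := (continuous_entry 2 0).comp (continuous_XX g0)
  exact continuous_jv.comp (f := fun g => (XX g0 g 0 0, XX g0 g 2 0)) (h0.prodMk h2)

theorem j0_rel (g0 g g' : Sp3) (h : RRel g g') : j0 g0 g = j0 g0 g' := by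
  obtain ⟨ζ, k, hk, rfl⟩ := (rrel_iff _ _).1 h
  exact (jv_XX g0 g k ζ hk).symm

/-- invariant of the biquotient -/
def jR (g0 : Sp3) : C(R₂, ℝ × ℍ[ℝ]) :=
  ⟨Quot.lift (j0 g0) (j0_rel g0), continuous_quot_lift _ (continuous_j0 g0)⟩

theorem jR_mk (g0 g : Sp3) (h : mid g = mid g0) :
    jR g0 (Quot.mk _ g) = jv ((g0⁻¹ * g).val 0 0) ((g0⁻¹ * g).val 2 0) := by
  have : XX g0 g = (g0⁻¹ * g).val := by
    unfold XX
    rw [h, cE_self, map_one, Z_one, one_mul]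
    rfl
  show jv (XX g0 g 0 0) (XX g0 g 2 0) = _
  rw [this]

theorem mid_rel {g0 g : Sp3} (h : mid g = mid g0) : mid (g0⁻¹ * g) = e1 := by
  rw [mid_mul, h, mid, ← act_mul, inv_mul_cancel, act_one]

theorem e1_0 : e1.1 0 0 = 0 := by simp [e1]
theorem e1_1 : e1.1 1 0 = 1 := by simp [e1]
theorem e1_2 : e1.1 2 0 = 0 := by simp [e1]

theorem K_facts {K : Sp3} (h : mid K = e1) : K.val 0 1 = 0 ∧ K.val 1 1 = 1 ∧ K.val 2 1 = 0 ∧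
    K.val 1 0 = 0 ∧ K.val 1 2 = 0 := by
  have h0 : K.val 0 1 = 0 := by rw [← mid_apply, h, e1_0]
  have h1 : K.val 1 1 = 1 := by rw [← mid_apply, h, e1_1]
  have h2 : K.val 2 1 = 0 := by rw [← mid_apply, h, e1_2]
  refine ⟨h0, h1, h2, ?_, ?_⟩
  · have := cols K 1 0
    rw [h0, h1, h2] at this
    simpa using this
  · have := cols K 1 2
    rw [h0, h1, h2] at this
    simpa using this

theorem K_norm {K : Sp3} (h : mid K = e1) : ‖K.val 0 0‖ ^ 2 + ‖K.val 2 0‖ ^ 2 = 1 := by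
  have := col_norm K 0
  rw [(K_facts h).2.2.2.1] at this
  simpa using this

theorem L_isH {L : Sp3} (h : mid L = e1) (h20 : L.val 2 0 = 0) : IsH L := by
  obtain ⟨a, b, c, d, e⟩ := K_facts h
  have hn : ‖L.val 0 0‖ = 1 := by
    have := K_norm h
    rw [h20] at this
    simp at this
    exact this.resolve_right (by linarith [norm_nonneg (L.val 0 0)])
  have h02 : L.val 0 2 = 0 := by
    have := cols L 0 2
    rw [d, h20] at this
    simp at this
    rcases this with h | h
    · rw [h] at hn; simp at hn
    · exact h
  have h22 : ‖L.val 2 2‖ = 1 := by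
    have := col_norm L 2
    rw [h02, e] at this
    simp at this
    exact this.resolve_right (by linarith [norm_nonneg (L.val 2 2)])
  refine ⟨L.val 0 0, L.val 2 2, hn, h22, ?_⟩
  apply Matrix.ext
  intro i j
  fin_cases i <;> fin_cases j <;> simp [a, b, c, d, e, h20, h02]

theorem jv_inj {a b a' b' : ℍ[ℝ]} (h : ‖a‖ ^ 2 + ‖b‖ ^ 2 = 1) (h' : ‖a'‖ ^ 2 + ‖b'‖ ^ 2 = 1)
    (hj : jv a b = jv a' b') : ∃ q, a' = a * q ∧ b' = b * q := by
  obtain ⟨h1, h2⟩ := Prod.mk.inj hj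
  have h3 : a * star b = a' * star b' := smul_right_injective _ (two_ne_zero (α := ℝ)) h2
  have h3' : b * star a = b' * star a' := by
    have := congrArg star h3
    simpa using this
  have ha : ‖a‖ ^ 2 = ‖a'‖ ^ 2 := by linarith
  have hb : ‖b‖ ^ 2 = ‖b'‖ ^ 2 := by linarith
  have key : ((‖a'‖ ^ 2 : ℝ) : ℍ[ℝ]) + ((‖b'‖ ^ 2 : ℝ) : ℍ[ℝ]) = 1 := by
    rw [← Quaternion.coe_add, h', Quaternion.coe_one]
  refine ⟨star a * a' + star b * b', ?_, ?_⟩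
  · rw [mul_add, ← mul_assoc, ← mul_assoc, qself_mul_star, h3, mul_assoc a', qstar_mul_self, ha,
      Quaternion.coe_commutes, ← mul_add, key, mul_one]
  · rw [mul_add, ← mul_assoc, ← mul_assoc, qself_mul_star, h3', mul_assoc b', qstar_mul_self, hb,
      Quaternion.coe_commutes (‖b'‖ ^ 2), ← mul_add, key, mul_one]

theorem j_inj {g0 g g' : Sp3} (h : mid g = mid g0) (h' : mid g' = mid g0)
    (hj : jR g0 (Quot.mk _ g) = jR g0 (Quot.mk _ g')) :
    (Quot.mk RRel g : R₂) = Quot.mk RRel g' := by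
  rw [jR_mk _ _ h, jR_mk _ _ h'] at hj
  have hK := mid_rel h
  have hK' := mid_rel h'
  obtain ⟨q, hq0, hq2⟩ := jv_inj (K_norm hK) (K_norm hK') hj
  generalize hKe : g0⁻¹ * g = K at *
  generalize hKe' : g0⁻¹ * g' = K' at *
  have hL : mid (K⁻¹ * K') = e1 := by
    rw [mid_mul, hK', ← hK, ← mid_mul, inv_mul_cancel, mid, act_one]
    exact hK.symm
  have hL2 : (K⁻¹ * K').val 2 0 = 0 := by
    show (star K.val * K'.val) 2 0 = 0
    rw [Matrix.mul_apply, Fin.sum_univ_three]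
    show star (K.val 0 2) * K'.val 0 0 + star (K.val 1 2) * K'.val 1 0 +
      star (K.val 2 2) * K'.val 2 0 = 0
    have hc := cols K 2 0
    rw [(K_facts hK).2.2.2.1, mul_zero] at hc
    rw [(K_facts hK').2.2.2.1, mul_zero, hq0, hq2, ← mul_assoc, ← mul_assoc, add_zero, ← add_mul]
    rw [add_zero] at hc
    rw [hc]
    simp
  have hH := L_isH hL hL2
  apply Quot.sound
  rw [rrel_iff]
  refine ⟨1, (K⁻¹ * K')⁻¹, isH_inv hH, ?_⟩
  rw [Zu_one, ← hKe, ← hKe']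
  group

/-- gauge on the five dimensional space -/
def rho5 (v : ℝ × ℍ[ℝ]) : ℝ := √(v.1 ^ 2 + ‖v.2‖ ^ 2)

theorem gauge_rho5 : Gauge rho5 where
  cont := by unfold rho5; fun_prop
  hom := by
    intro t v ht
    unfold rho5
    rw [Prod.smul_fst, Prod.smul_snd, norm_smul, smul_eq_mul, mul_pow, mul_pow, Real.norm_eq_abs,
      sq_abs, ← mul_add, Real.sqrt_mul (by positivity), Real.sqrt_sq ht.le]
  pos := by
    rintro ⟨h, w⟩ hv
    refine Real.sqrt_pos.2 ?_
    dsimp only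
    by_cases hh : h = 0
    · have : ‖w‖ ≠ 0 := by
        rw [norm_ne_zero_iff]
        rintro rfl
        exact hv (by rw [hh]; rfl)
      positivity
    · positivity

theorem jv_rho {a b : ℍ[ℝ]} (h : ‖a‖ ^ 2 + ‖b‖ ^ 2 = 1) : rho5 (jv a b) = 1 := by
  unfold rho5 jv
  rw [Real.sqrt_eq_one]
  dsimp only
  rw [norm_smul, norm_mul, norm_star, Real.norm_of_nonneg (by norm_num)]
  have : (‖a‖ ^ 2 + ‖b‖ ^ 2) ^ 2 = 1 := by rw [h]; norm_num
  linarith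

theorem jv_surj (v : GS rho5) : ∃ (a : ℝ) (b : ℍ[ℝ]), a ^ 2 + ‖b‖ ^ 2 = 1 ∧
    jv (a : ℍ[ℝ]) b = v.1 := by
  obtain ⟨⟨h, w⟩, hv⟩ := v
  rw [rho5, Real.sqrt_eq_one] at hv
  dsimp only at hv ⊢
  have hw := norm_nonneg w
  by_cases hh : h = -1
  · subst hh
    have : ‖w‖ ^ 2 = 0 := by linarith
    have hw0 : w = 0 := by simpa using this
    refine ⟨0, 1, by simp, ?_⟩
    rw [hw0]
    simp [jv]
  · have h1 : 0 < 1 + h := by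
      rcases lt_trichotomy (1 + h) 0 with h' | h' | h'
      · nlinarith [sq_nonneg ‖w‖]
      · exact absurd (by linarith) hh
      · exact h'
    have ha : 0 < √((1 + h) / 2) := Real.sqrt_pos.2 (by linarith)
    have ha2 : √((1 + h) / 2) ^ 2 = (1 + h) / 2 := Real.sq_sqrt (by linarith)
    generalize √((1 + h) / 2) = a at ha ha2
    have hb : ‖(2 * a)⁻¹ • star w‖ ^ 2 = (1 - h) / 2 := by
      rw [norm_smul, norm_star, mul_pow, norm_inv, Real.norm_of_nonneg (by positivity), inv_pow,
        mul_pow, ha2]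
      have : ‖w‖ ^ 2 = (1 - h) * (1 + h) := by linarith
      rw [this]
      field_simp
    refine ⟨a, (2 * a)⁻¹ • star w, ?_, ?_⟩
    · rw [ha2, hb]; ring
    · unfold jv
      rw [hb]
      refine Prod.ext ?_ ?_
      · show ‖(a : ℍ[ℝ])‖ ^ 2 - (1 - h) / 2 = h
        rw [Quaternion.norm_coe, Real.norm_eq_abs, sq_abs, ha2]; ring
      · show (2 : ℝ) • ((a : ℍ[ℝ]) * star ((2 * a)⁻¹ • star w)) = w
        have : star ((2 * a)⁻¹ • star w) = (2 * a)⁻¹ • w := by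
          rw [Quaternion.star_smul, star_star]
        rw [this, Quaternion.coe_mul_eq_smul, smul_smul, smul_smul]
        have : (2 * a * (2 * a)⁻¹) = 1 := mul_inv_cancel₀ (by positivity)
        rw [this, one_smul]

/-- rotations in the fibre -/
def Gm (a : ℝ) (b : ℍ[ℝ]) : M33 := !![(a : ℍ[ℝ]), 0, -star b; 0, 1, 0; b, 0, (a : ℍ[ℝ])]

theorem Gm_unitary {a : ℝ} {b : ℍ[ℝ]} (h : a ^ 2 + ‖b‖ ^ 2 = 1) : Gm a b ∈ unitary M33 := by
  have hk : ((|a| : ℝ) : ℍ[ℝ]) ^ 2 + ((‖b‖ : ℝ) : ℍ[ℝ]) ^ 2 = 1 := by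
    rw [← Quaternion.coe_pow, ← Quaternion.coe_pow, ← Quaternion.coe_add, sq_abs, h,
      Quaternion.coe_one]
  have hk' := hk
  rw [add_comm] at hk'
  have c1 := Quaternion.coe_commutes a b
  have c2 := Quaternion.coe_commutes a (star b)
  rw [Unitary.mem_iff, Matrix.star_eq_conjTranspose]
  constructor
  · apply Matrix.ext
    intro i j
    fin_cases i <;> fin_cases j <;>
      simp [Gm, Matrix.mul_apply,
        Fin.sum_univ_three, qstar_mul_self, qself_mul_star, hk, hk', c1, c2]
  · apply Matrix.ext
    intro i j
    fin_cases i <;> fin_cases j <;>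
      simp [Gm, Matrix.mul_apply,
        Fin.sum_univ_three, qstar_mul_self, qself_mul_star, hk, hk', c1, c2]

/-- rotations in the fibre, as group elements -/
def Gu (a : ℝ) (b : ℍ[ℝ]) (h : a ^ 2 + ‖b‖ ^ 2 = 1) : Sp3 := ⟨Gm a b, Gm_unitary h⟩

theorem mid_Gu (a : ℝ) (b : ℍ[ℝ]) (h : a ^ 2 + ‖b‖ ^ 2 = 1) : mid (Gu a b h) = e1 := by
  apply Subtype.ext
  apply Matrix.ext
  intro i j
  obtain rfl : j = 0 := Subsingleton.elim _ _
  rw [mid_apply]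
  show Gm a b i 1 = _
  fin_cases i <;> simp [Gm, e1]

/-- the fibre -/
abbrev FF (g0 : Sp3) : Type := Fib prR (prR (Quot.mk RRel g0))

theorem fib_rep (g0 : Sp3) (x : FF g0) : ∃ g, mid g = mid g0 ∧ x.1 = Quot.mk RRel g := by
  obtain ⟨g, hg⟩ := Quot.mk_surjective x.1
  have h := x.2
  rw [← hg] at h
  have h' : Quot.mk BRel (mid g) = Quot.mk BRel (mid g0) := h
  obtain ⟨ζ, hζ⟩ := qB_eq.1 h'
  refine ⟨Zu ζ * g, by rw [mid_mul, hζ], ?_⟩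
  rw [← hg]
  exact Quot.sound ((rrel_iff _ _).2 ⟨ζ, 1, isH_one, by simp⟩)

/-- points of the fibre from matrices -/
def toFF (g0 : Sp3) (g : {g : Sp3 // mid g = mid g0}) : FF g0 :=
  ⟨Quot.mk RRel g.1, congrArg (Quot.mk BRel) g.2⟩

theorem continuous_toFF (g0 : Sp3) : Continuous (toFF g0) := by
  unfold toFF
  exact Continuous.subtype_mk (continuous_quot_mk.comp continuous_subtype_val) _

theorem surj_toFF (g0 : Sp3) : Function.Surjective (toFF g0) := by
  intro x
  obtain ⟨g, hg, hx⟩ := fib_rep g0 x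
  exact ⟨⟨g, hg⟩, Subtype.ext hx.symm⟩

theorem compact_FF (g0 : Sp3) : CompactSpace (FF g0) := by
  have := compact_Sp3
  have hc : IsClosed {g : Sp3 | mid g = mid g0} := isClosed_eq continuous_mid continuous_const
  have : CompactSpace {g : Sp3 // mid g = mid g0} := isCompact_iff_compactSpace.1 hc.isCompact
  rw [← isCompact_univ_iff, ← (surj_toFF g0).range_eq]
  exact isCompact_range (continuous_toFF g0)

theorem jFF_mem (g0 : Sp3) (x : FF g0) : rho5 (jR g0 x.1) = 1 := by
  obtain ⟨g, hg, hx⟩ := fib_rep g0 x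
  rw [hx, jR_mk _ _ hg]
  exact jv_rho (K_norm (mid_rel hg))

/-- the fibre maps to the sphere -/
def jFF (g0 : Sp3) (x : FF g0) : GS rho5 := ⟨jR g0 x.1, jFF_mem g0 x⟩

theorem continuous_jFF (g0 : Sp3) : Continuous (jFF g0) := by
  unfold jFF
  exact Continuous.subtype_mk ((jR g0).continuous.comp continuous_subtype_val) _

theorem bij_jFF (g0 : Sp3) : Function.Bijective (jFF g0) := by
  constructor
  · intro x x' h
    obtain ⟨g, hg, hx⟩ := fib_rep g0 x
    obtain ⟨g', hg', hx'⟩ := fib_rep g0 x'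
    have h1 : jR g0 x.1 = jR g0 x'.1 := congrArg Subtype.val h
    rw [hx, hx'] at h1
    apply Subtype.ext
    rw [hx, hx']
    exact j_inj hg hg' h1
  · intro v
    obtain ⟨a, b, hab, hv⟩ := jv_surj v
    have hm : mid (g0 * Gu a b hab) = mid g0 := by rw [mid_mul, mid_Gu, mid]
    refine ⟨toFF g0 ⟨g0 * Gu a b hab, hm⟩, Subtype.ext ?_⟩
    show jR g0 (Quot.mk RRel (g0 * Gu a b hab)) = v.1
    rw [jR_mk _ _ hm, inv_mul_cancel_left, ← hv]
    show jv (Gm a b 0 0) (Gm a b 2 0) = _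
    simp [Gm]

/-- the fibre is a four sphere -/
def FFH (g0 : Sp3) : FF g0 ≃ₜ GS rho5 :=
  haveI := compact_FF g0
  Continuous.homeoOfEquivCompactToT2 (f := Equiv.ofBijective (jFF g0) (bij_jFF g0))
    (continuous_jFF g0)

theorem finrank5 : Module.finrank ℝ (ℝ × ℍ[ℝ]) = 5 := by
  rw [Module.finrank_prod, Quaternion.finrank_eq_four]
  simp

theorem trivN_FF (k : ℕ) (hk : k ≤ 3) (g0 : Sp3) (x : FF g0) : TrivN k (FF g0) x := by
  refine triv_hom (FFH g0) rfl (triv_gs gauge_rho5 _ (conn k _ ?_ _))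
  rw [finrank5]
  omega

theorem pi2_R (g0 : Sp3) : Nonempty ((π_ (1 + 1)) R₂ (Quot.mk RRel g0) ≃* Multiplicative ℤ) := by
  have h1 : GIso (cb 1) (Quot.mk RRel g0 : R₂) (cb 1) (prR (Quot.mk RRel g0)) :=
    gIso_proj regFib_prR _ (trivN_FF 1 (by norm_num) g0 _)
      ((trivN_succ 1).1 (trivN_FF 2 (by norm_num) g0 _))
  obtain ⟨e⟩ := mkIso h1
  obtain ⟨f⟩ := pi2_BB (mid g0)
  exact ⟨e.trans f⟩

theorem pi4_R (g0 : Sp3) : Nonempty ((π_ (3 + 1)) R₂ (Quot.mk RRel g0) ≃* Multiplicative ℤ) := by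
  have h1 : GIso (cb 3) (⟨Quot.mk RRel g0, rfl⟩ : FF g0) (cb 3) (Quot.mk RRel g0 : R₂) :=
    gIso_incl regFib_prR _ ((trivN_succ 3).1 (trivN_BB4 (mid g0)))
      ((trivN_succ2 3).1 (trivN_BB5 (mid g0)))
  have h2 : GIso (cb 3) (⟨Quot.mk RRel g0, rfl⟩ : FF g0) (cb 3)
      (FFH g0 ⟨Quot.mk RRel g0, rfl⟩) := gIso_hom (FFH g0) rfl
  have h3 := h2.trans (gIso_gs (A := cb 3) gauge_rho5 (FFH g0 ⟨Quot.mk RRel g0, rfl⟩))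
  obtain ⟨e⟩ := mkIso h1
  obtain ⟨e'⟩ := mkIso h3
  obtain ⟨f⟩ := pi4_nz5 (ℝ × ℍ[ℝ]) finrank5 (gsIn gauge_rho5 (FFH g0 ⟨Quot.mk RRel g0, rfl⟩))
  exact ⟨e.symm.trans (e'.trans f)⟩

end BQ

/-- `π₂(R₂) ≅ ℤ` and `π₄(R₂) ≅ ℤ` (for any basepoint). -/
theorem statement14 (x : R₂) :
    Nonempty ((π_ (1 + 1)) R₂ x ≃* Multiplicative ℤ) ∧
      Nonempty ((π_ (3 + 1)) R₂ x ≃* Multiplicative ℤ) := by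
  obtain ⟨g, rfl⟩ := Quot.mk_surjective x
  exact ⟨BQ.pi2_R g, BQ.pi4_R g⟩
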